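/- Let M = (A, <, P₁, …, Pₙ) be a labelled linear ordering where (A, <) is an infinite scattered linear order. Then there exists a set Q ⊆ A such that Q is not MSO-definable in M and the MSO theory of the expansion M' = (A, <, P₁, …, Pₙ, Q) is recursive in (Turing reducible to) the MSO theory of M. -/

import Mathlib

namespace Paper

/-! ## Syntax and semantics of monadic second-order logic over labelled linear orders

A labelled linear ordering `M = (A, <, P₁, …, Pₙ)` is represented by a type `A`,
a binary relation `r : A → A → Prop` (the order) and `P : Fin n → Set A`
(the unary predicates). -/

/-- MSO formulas over the signature `{<, P₀, …, P_{n-1}}`.  First-order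
variables and second-order (set) variables are both indexed by `ℕ`. -/
inductive MSO (n : ℕ) : Type
  | lt (i j : ℕ) : MSO n
  | pred (k : Fin n) (i : ℕ) : MSO n
  | mem (i j : ℕ) : MSO n
  | not (φ : MSO n) : MSO n
  | and (φ ψ : MSO n) : MSO n
  | ex1 (i : ℕ) (φ : MSO n) : MSO n
  | ex2 (j : ℕ) (φ : MSO n) : MSO n

namespace MSO

variable {n : ℕ}

/-- Satisfaction of an MSO formula in the structure `(A, r, P)` under the
first-order assignment `v` and the second-order assignment `V`. -/
def Sat {A : Type} (r : A → A → Prop) (P : Fin n → Set A)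
    (v : ℕ → A) (V : ℕ → Set A) : MSO n → Prop
  | lt i j => r (v i) (v j)
  | pred k i => v i ∈ P k
  | mem i j => v i ∈ V j
  | not φ => ¬ Sat r P v V φ
  | and φ ψ => Sat r P v V φ ∧ Sat r P v V ψ
  | ex1 i φ => ∃ a : A, Sat r P (Function.update v i a) V φ
  | ex2 j φ => ∃ S : Set A, Sat r P v (Function.update V j S) φ

/-- Quantifier depth of an MSO formula. -/
def qd : MSO n → ℕ
  | lt _ _ => 0
  | pred _ _ => 0
  | mem _ _ => 0
  | not φ => qd φ
  | and φ ψ => max (qd φ) (qd ψ)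
  | ex1 _ φ => qd φ + 1
  | ex2 _ φ => qd φ + 1

/-- Free first-order variables of an MSO formula. -/
def fv1 : MSO n → Finset ℕ
  | lt i j => {i, j}
  | pred _ i => {i}
  | mem i _ => {i}
  | not φ => fv1 φ
  | and φ ψ => fv1 φ ∪ fv1 ψ
  | ex1 i φ => fv1 φ \ {i}
  | ex2 _ φ => fv1 φ

/-- Free second-order variables of an MSO formula. -/
def fv2 : MSO n → Finset ℕ
  | lt _ _ => ∅
  | pred _ _ => ∅
  | mem _ j => {j}
  | not φ => fv2 φ
  | and φ ψ => fv2 φ ∪ fv2 ψ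
  | ex1 _ φ => fv2 φ
  | ex2 j φ => fv2 φ \ {j}

/-- A sentence is a formula with no free variables. -/
def IsSentence (φ : MSO n) : Prop := fv1 φ = ∅ ∧ fv2 φ = ∅

/-- A sentence `φ` is true in the structure `(A, r, P)`. -/
def TrueIn {A : Type} (r : A → A → Prop) (P : Fin n → Set A) (φ : MSO n) : Prop :=
  ∀ (v : ℕ → A) (V : ℕ → Set A), Sat r P v V φ

/-- `Q ⊆ A` is MSO-definable in `(A, r, P)`: there is a formula `φ(x)` whose only
free variable is the first-order variable `0` defining `Q`. -/
def Definable {A : Type} (r : A → A → Prop) (P : Fin n → Set A) (Q : Set A) : Prop :=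
  ∃ φ : MSO n, fv1 φ ⊆ {0} ∧ fv2 φ = ∅ ∧
    ∀ a : A, a ∈ Q ↔ ∀ (v : ℕ → A) (V : ℕ → Set A), Sat r P (Function.update v 0 a) V φ

/-- A Gödel numbering of MSO formulas. -/
def encode : MSO n → ℕ
  | lt i j => Nat.pair 0 (Nat.pair i j)
  | pred k i => Nat.pair 1 (Nat.pair k i)
  | mem i j => Nat.pair 2 (Nat.pair i j)
  | not φ => Nat.pair 3 (encode φ)
  | and φ ψ => Nat.pair 4 (Nat.pair (encode φ) (encode ψ))
  | ex1 i φ => Nat.pair 5 (Nat.pair i (encode φ))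
  | ex2 j φ => Nat.pair 6 (Nat.pair j (encode φ))

/-- The MSO theory of the structure `(A, r, P)`, as a set of Gödel codes of the true
sentences. -/
def TheoryCodes {A : Type} (r : A → A → Prop) (P : Fin n → Set A) : Set ℕ :=
  {c | ∃ φ : MSO n, IsSentence φ ∧ encode φ = c ∧ TrueIn r P φ}

/-- Two structures have the same `k`-type: they satisfy the same MSO sentences of
quantifier depth `≤ k`. -/
def EquivType (k : ℕ) {A B : Type} (r : A → A → Prop) (P : Fin n → Set A)
    (s : B → B → Prop) (Q : Fin n → Set B) : Prop :=
  ∀ φ : MSO n, IsSentence φ → qd φ ≤ k → (TrueIn r P φ ↔ TrueIn s Q φ)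

/-- The `k`-type of a structure, as the set of Gödel codes of the true sentences
of quantifier depth `≤ k`. -/
def TypeSet (k : ℕ) {A : Type} (r : A → A → Prop) (P : Fin n → Set A) : Set ℕ :=
  {c | ∃ φ : MSO n, IsSentence φ ∧ qd φ ≤ k ∧ encode φ = c ∧ TrueIn r P φ}

end MSO

/-- The order relation of the substructure with domain `S`. -/
def subRel {A : Type} (r : A → A → Prop) (S : Set A) : S → S → Prop :=
  fun x y => r x y

/-- The predicates of the substructure with domain `S`. -/
def subPred {A : Type} {n : ℕ} (P : Fin n → Set A) (S : Set A) : Fin n → Set S :=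
  fun k => {x : S | (x : A) ∈ P k}

/-! ## Relative computability -/

/-- Partial recursiveness relative to an oracle `O` (Kleene-style, following
the definition of `Nat.Partrec`, with an extra base case for the oracle). -/
inductive RecursiveIn (O : ℕ →. ℕ) : (ℕ →. ℕ) → Prop
  | zero : RecursiveIn O (pure 0)
  | succ : RecursiveIn O ↑Nat.succ
  | left : RecursiveIn O ↑fun n : ℕ => n.unpair.1
  | right : RecursiveIn O ↑fun n : ℕ => n.unpair.2
  | oracle : RecursiveIn O O
  | pair {f g} : RecursiveIn O f → RecursiveIn O g →
      RecursiveIn O fun n => Nat.pair <$> f n <*> g n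
  | comp {f g} : RecursiveIn O f → RecursiveIn O g →
      RecursiveIn O fun n => g n >>= f
  | prec {f g} : RecursiveIn O f → RecursiveIn O g →
      RecursiveIn O (Nat.unpaired fun a m =>
        m.rec (f a) fun y IH => do let i ← IH; g (Nat.pair a (Nat.pair y i)))
  | rfind {f} : RecursiveIn O f →
      RecursiveIn O fun a => Nat.rfind fun m => (fun x => x = 0) <$> f (Nat.pair a m)

/-- The characteristic (partial) function of a set of naturals. -/
noncomputable def chi (S : Set ℕ) : ℕ →. ℕ :=
  fun m => Part.some (S.indicator (fun _ => 1) m)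

/-- `S` is recursive in (Turing reducible to) `T`. -/
def TuringRed (S T : Set ℕ) : Prop := RecursiveIn (chi T) (chi S)

/-- The (recursive) join of a finite family of sets of naturals. -/
def finJoin {m : ℕ} (P : Fin m → Set ℕ) : Set ℕ :=
  {c | ∃ i : Fin m, ∃ x : ℕ, c = Nat.pair i x ∧ x ∈ P i}

/-- The (recursive) join of two sets of naturals. -/
def setJoin (S T : Set ℕ) : Set ℕ :=
  {c | (∃ a, c = 2 * a ∧ a ∈ S) ∨ (∃ a, c = 2 * a + 1 ∧ a ∈ T)}

/-- A set of naturals is decidable (computable). -/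
def DecidableSet (S : Set ℕ) : Prop := ComputablePred (· ∈ S)

/-! ## Homogeneous sets for labelled orderings of the naturals -/

/-- `H = {h 0 < h 1 < ⋯}` is `k`-homogeneous for `(ℕ, <, P)`:
all substructures `M_{[h i, h j)}`, `i < j`, have the same `k`-type. -/
def KHomogeneous {n : ℕ} (P : Fin n → Set ℕ) (h : ℕ → ℕ) (k : ℕ) : Prop :=
  ∀ i j i' j' : ℕ, i < j → i' < j' →
    MSO.EquivType k
      (subRel (· < ·) (Set.Ico (h i) (h j))) (subPred P (Set.Ico (h i) (h j)))
      (subRel (· < ·) (Set.Ico (h i') (h j'))) (subPred P (Set.Ico (h i') (h j')))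

/-- `H = {h 0 < h 1 < ⋯}` is uniformly homogeneous for `(ℕ, <, P)`:
for each `k`, the set `{h k < h (k+1) < ⋯}` is `k`-homogeneous. -/
def UniformlyHomogeneous {n : ℕ} (P : Fin n → Set ℕ) (h : ℕ → ℕ) : Prop :=
  StrictMono h ∧
  ∀ k : ℕ, KHomogeneous P (fun i => h (k + i)) k

/-! ## ℤ-words -/

/-- The finite word `u` occurs at position `i` in the `ℤ`-word `w`. -/
def OccursAt {σ : Type} (w : ℤ → σ) (u : List σ) (i : ℤ) : Prop :=
  ∀ k : Fin u.length, w (i + (k : ℕ)) = u.get k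

/-- The finite word `u` occurs in the `ℤ`-word `w`. -/
def OccursIn {σ : Type} (w : ℤ → σ) (u : List σ) : Prop :=
  ∃ i : ℤ, OccursAt w u i

/-- `u` occurs in every prefix of `w`. -/
def InEveryPrefix {σ : Type} (w : ℤ → σ) (u : List σ) : Prop :=
  ∀ n : ℤ, ∃ i : ℤ, i + u.length ≤ n ∧ OccursAt w u i

/-- `u` occurs in every suffix of `w`. -/
def InEverySuffix {σ : Type} (w : ℤ → σ) (u : List σ) : Prop :=
  ∀ n : ℤ, ∃ i : ℤ, n ≤ i ∧ OccursAt w u i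

/-- A `ℤ`-word `w` is recurrent: for every regular language `X`, either no element
of `X` occurs in `w`, or every prefix and every suffix of `w` contains an
occurrence of some element of `X`. -/
def Recurrent {σ : Type} (w : ℤ → σ) : Prop :=
  ∀ X : Language σ, X.IsRegular →
    (∀ u ∈ X, ¬ OccursIn w u) ∨
    (∀ n : ℤ, (∃ u ∈ X, ∃ i : ℤ, i + u.length ≤ n ∧ OccursAt w u i) ∧
              (∃ u ∈ X, ∃ i : ℤ, n ≤ i ∧ OccursAt w u i))

/-- The `ℤ`-word `w(M)` over the alphabet `{0,1}ⁿ` associated with the labelled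
linear ordering `M = (ℤ, <, P₁, …, Pₙ)`. -/
def wordOf {n : ℕ} (P : Fin n → Set ℤ) : ℤ → (Fin n → Prop) :=
  fun i k => i ∈ P k

end Paper

namespace Paper

/-! ## Total functions recursive in an oracle -/

/-- A total function recursive in the oracle `O`. -/
def TRec (O : ℕ →. ℕ) (f : ℕ → ℕ) : Prop := RecursiveIn O (fun n => Part.some (f n))

theorem RecursiveIn.of_partrec {O f : ℕ →. ℕ} (h : Nat.Partrec f) : RecursiveIn O f := by
  induction h with
  | zero => exact .zero
  | succ => exact .succ
  | left => exact .left
  | right => exact .right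
  | pair _ _ h1 h2 => exact .pair h1 h2
  | comp _ _ h1 h2 => exact .comp h1 h2
  | prec _ _ h1 h2 => exact .prec h1 h2
  | rfind _ h1 => exact .rfind h1

namespace TRec

variable {O : ℕ →. ℕ} {f g : ℕ → ℕ}

theorem of_primrec (h : Primrec f) : TRec O f :=
  RecursiveIn.of_partrec (Nat.Partrec.of_primrec (Primrec.nat_iff.1 h))

theorem comp (hf : TRec O f) (hg : TRec O g) : TRec O (fun n => f (g n)) := by
  have := RecursiveIn.comp hf hg
  simpa [TRec] using this

theorem pair (hf : TRec O f) (hg : TRec O g) : TRec O (fun n => Nat.pair (f n) (g n)) := by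
  have := RecursiveIn.pair hf hg
  simpa [TRec, Seq.seq] using this

theorem app {h : ℕ → ℕ → ℕ} (hh : Primrec₂ h) (hf : TRec O f) (hg : TRec O g) :
    TRec O (fun n => h (f n) (g n)) := by
  have h1 : Primrec fun m : ℕ => h m.unpair.1 m.unpair.2 :=
    hh.comp (Primrec.fst.comp Primrec.unpair) (Primrec.snd.comp Primrec.unpair)
  simpa using (of_primrec (O := O) h1).comp (hf.pair hg)

theorem nat_rec {F : ℕ → ℕ} {s : ℕ → ℕ → ℕ} (hs : TRec O (fun m => s m.unpair.1 m.unpair.2))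
    (hF : ∀ k, F (k + 1) = s k (F k)) : TRec O F := by
  have h0 : TRec O (fun _ => F 0) := of_primrec (Primrec.const _)
  have h1 : TRec O (fun m => s m.unpair.2.unpair.1 m.unpair.2.unpair.2) :=
    hs.comp (of_primrec (Primrec.snd.comp Primrec.unpair))
  have h2 := RecursiveIn.prec h0 h1
  have h3 : TRec O (fun m => F m.unpair.2) := by
    refine (congrArg (RecursiveIn O) (funext fun m => ?_)).mpr h2
    simp only [Nat.unpaired]
    induction m.unpair.2 with
    | zero => rfl
    | succ k ih =>
      dsimp only
      rw [← ih]
      simp [hF]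
  simpa using h3.comp (g := fun n => Nat.pair 0 n)
    (of_primrec (Primrec₂.natPair.comp (Primrec.const 0) Primrec.id))

theorem exists_search {g : ℕ → ℕ → ℕ} (hg : TRec O (fun m => g m.unpair.1 m.unpair.2))
    (h : ∀ a, ∃ m, g a m = 0) : ∃ f, TRec O f ∧ ∀ a, g a (f a) = 0 := by
  classical
  refine ⟨fun a => Nat.find (h a), ?_, fun a => Nat.find_spec (h a)⟩
  have := RecursiveIn.rfind hg
  refine (congrArg (RecursiveIn O) (funext fun a => ?_)).mpr this
  symm
  rw [Part.eq_some_iff]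
  simp only [Nat.unpair_pair, Part.map_eq_map, Part.map_some]
  refine Nat.mem_rfind.2 ⟨?_, fun {m} hm => ?_⟩
  · simpa using Nat.find_spec (h a)
  · simpa using Nat.find_min (h a) hm

end TRec

namespace MSO

section

variable {n : ℕ}

/-! ## Codes -/

theorem encode_injective : Function.Injective (encode : MSO n → ℕ) := by
  intro φ
  induction φ with
  | lt i j => intro ψ h; cases ψ <;> simp_all [encode, Nat.pair_eq_pair]
  | pred k i => intro ψ h; cases ψ <;> simp_all [encode, Nat.pair_eq_pair, Fin.ext_iff]
  | mem i j => intro ψ h; cases ψ <;> simp_all [encode, Nat.pair_eq_pair]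
  | not φ ih =>
    intro ψ h
    cases ψ <;> simp only [encode, Nat.pair_eq_pair, not.injEq] at h ⊢ <;> try omega
    exact ih h.2
  | and φ ψ ih1 ih2 =>
    intro ψ h
    cases ψ <;> simp only [encode, Nat.pair_eq_pair, and.injEq] at h ⊢ <;> try omega
    exact ⟨ih1 h.2.1, ih2 h.2.2⟩
  | ex1 i φ ih =>
    intro ψ h
    cases ψ <;> simp only [encode, Nat.pair_eq_pair, ex1.injEq] at h ⊢ <;> try omega
    exact ⟨h.2.1, ih h.2.2⟩
  | ex2 i φ ih =>
    intro ψ h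
    cases ψ <;> simp only [encode, Nat.pair_eq_pair, ex2.injEq] at h ⊢ <;> try omega
    exact ⟨h.2.1, ih h.2.2⟩

variable {A : Type} {r : A → A → Prop} {P : Fin n → Set A}

theorem sat_congr (φ : MSO n) : ∀ {v w : ℕ → A} {V W : ℕ → Set A},
    (∀ i ∈ fv1 φ, v i = w i) → (∀ j ∈ fv2 φ, V j = W j) →
    (Sat r P v V φ ↔ Sat r P w W φ) := by
  induction φ with
  | lt i j => intro v w V W h1 h2; simp_all [Sat, fv1]
  | pred k i => intro v w V W h1 h2; simp_all [Sat, fv1]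
  | mem i j => intro v w V W h1 h2; simp_all [Sat, fv1, fv2]
  | not φ ih => intro v w V W h1 h2; exact not_congr (ih h1 h2)
  | and φ ψ ih1 ih2 =>
    intro v w V W h1 h2
    simp only [fv1, fv2, Finset.mem_union] at h1 h2
    exact and_congr (ih1 (fun i hi => h1 i (.inl hi)) fun i hi => h2 i (.inl hi))
      (ih2 (fun i hi => h1 i (.inr hi)) fun i hi => h2 i (.inr hi))
  | ex1 i φ ih =>
    intro v w V W h1 h2
    simp only [fv1, Finset.mem_sdiff, Finset.mem_singleton] at h1
    refine exists_congr fun a => ih (fun j hj => ?_) h2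
    by_cases hji : j = i
    · simp [hji]
    · simp [hji, h1 j ⟨hj, hji⟩]
  | ex2 i φ ih =>
    intro v w V W h1 h2
    simp only [fv2, Finset.mem_sdiff, Finset.mem_singleton] at h2
    refine exists_congr fun a => ih h1 (fun j hj => ?_)
    by_cases hji : j = i
    · simp [hji]
    · simp [hji, h2 j ⟨hj, hji⟩]

/-! ## Eliminating the last predicate in favour of the set variable `0` -/

/-- Replace the last predicate symbol by the set variable `0`, shifting the other set
variables. -/
def elimLast : MSO (n + 1) → MSO n
  | lt i j => lt i j
  | pred k i => if h : (k : ℕ) < n then pred ⟨k, h⟩ i else mem i 0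
  | mem i j => mem i (j + 1)
  | not φ => not (elimLast φ)
  | and φ ψ => and (elimLast φ) (elimLast ψ)
  | ex1 i φ => ex1 i (elimLast φ)
  | ex2 j φ => ex2 (j + 1) (elimLast φ)

theorem sat_elimLast (Q : Set A) (φ : MSO (n + 1)) : ∀ {v : ℕ → A} {V W : ℕ → Set A},
    W 0 = Q → (∀ j, W (j + 1) = V j) →
    (Sat r P v W (elimLast φ) ↔ Sat r (Fin.snoc P Q) v V φ) := by
  induction φ with
  | lt i j => intros; rfl
  | pred k i =>
    intro v V W h0 h1
    by_cases h : (k : ℕ) < n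
    · simp [elimLast, h, Sat, Fin.snoc, Fin.castLT]
    · simp [elimLast, h, Sat, Fin.snoc, h0]
  | mem i j => intro v V W h0 h1; simp [elimLast, Sat, h1]
  | not φ ih => intro v V W h0 h1; exact not_congr (ih h0 h1)
  | and φ ψ ih1 ih2 => intro v V W h0 h1; exact and_congr (ih1 h0 h1) (ih2 h0 h1)
  | ex1 i φ ih => intro v V W h0 h1; exact exists_congr fun a => ih h0 h1
  | ex2 j φ ih =>
    intro v V W h0 h1
    refine exists_congr fun a => ih (by simpa using h0) fun i => ?_
    by_cases hij : i = j
    · simp [hij]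
    · simp [hij, h1]

theorem fv1_elimLast (φ : MSO (n + 1)) : fv1 (elimLast φ) = fv1 φ := by
  induction φ with
  | pred k i => by_cases h : (k : ℕ) < n <;> simp [elimLast, h, fv1]
  | _ => simp_all [elimLast, fv1]

theorem mem_fv2_elimLast (φ : MSO (n + 1)) (j : ℕ) :
    j + 1 ∈ fv2 (elimLast φ) ↔ j ∈ fv2 φ := by
  induction φ with
  | pred k i => by_cases h : (k : ℕ) < n <;> simp [elimLast, h, fv2]
  | _ => simp_all [elimLast, fv2]

theorem fv2_elimLast_subset (φ : MSO (n + 1)) : fv2 (elimLast φ) ⊆ {0} ↔ fv2 φ = ∅ := by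
  constructor
  · intro h
    refine Finset.eq_empty_of_forall_notMem fun j hj => ?_
    simpa using h ((mem_fv2_elimLast φ j).2 hj)
  · intro h j hj
    cases j with
    | zero => simp
    | succ j => rw [mem_fv2_elimLast, h] at hj; simp at hj

/-- Course-of-values step computing the code of `elimLast φ` from the code of `φ`. -/
def elimStep (n : ℕ) (l : List ℕ) : ℕ :=
  let c := l.length
  let t := c.unpair.1
  let b := c.unpair.2
  if t = 0 then c
  else if t = 1 then
    if b.unpair.1 < n then c else if b.unpair.1 = n then Nat.pair 2 (Nat.pair b.unpair.2 0)
    else Nat.pair 7 0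
  else if t = 2 then Nat.pair 2 (Nat.pair b.unpair.1 (b.unpair.2 + 1))
  else if t = 3 then Nat.pair 3 (l.getD b 0)
  else if t = 4 then Nat.pair 4 (Nat.pair (l.getD b.unpair.1 0) (l.getD b.unpair.2 0))
  else if t = 5 then Nat.pair 5 (Nat.pair b.unpair.1 (l.getD b.unpair.2 0))
  else if t = 6 then Nat.pair 6 (Nat.pair (b.unpair.1 + 1) (l.getD b.unpair.2 0))
  else Nat.pair 7 0

/-- The values of `elimCode` below `c`. -/
def elimList (n : ℕ) : ℕ → List ℕ
  | 0 => []
  | c + 1 => elimList n c ++ [elimStep n (elimList n c)]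

/-- The map on codes induced by `elimLast`. -/
def elimCode (n c : ℕ) : ℕ := elimStep n (elimList n c)

theorem length_elimList (n c : ℕ) : (elimList n c).length = c := by
  induction c with
  | zero => rfl
  | succ c ih => simp [elimList, ih]

theorem getD_elimList {n c b : ℕ} (h : b < c) : (elimList n c).getD b 0 = elimCode n b := by
  induction c with
  | zero => omega
  | succ c ih =>
    rcases Nat.lt_succ_iff_lt_or_eq.1 h with h | rfl
    · rw [elimList, List.getD_append _ _ _ _ (by rwa [length_elimList]), ih h]
    · rw [elimList, List.getD_append_right _ _ _ _ (by rw [length_elimList])]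
      simp [length_elimList, elimCode]

theorem primrec_elimStep (n : ℕ) : Primrec (elimStep n) := by
  have hc : Primrec fun l : List ℕ => l.length := Primrec.list_length
  have ht : Primrec fun l : List ℕ => l.length.unpair.1 :=
    Primrec.fst.comp (Primrec.unpair.comp hc)
  have hb : Primrec fun l : List ℕ => l.length.unpair.2 :=
    Primrec.snd.comp (Primrec.unpair.comp hc)
  have hb1 : Primrec fun l : List ℕ => l.length.unpair.2.unpair.1 :=
    Primrec.fst.comp (Primrec.unpair.comp hb)
  have hb2 : Primrec fun l : List ℕ => l.length.unpair.2.unpair.2 :=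
    Primrec.snd.comp (Primrec.unpair.comp hb)
  have hget : ∀ {f : List ℕ → ℕ}, Primrec f → Primrec fun l : List ℕ => l.getD (f l) 0 :=
    fun hf => (Primrec.list_getD 0).comp Primrec.id hf
  have hk : ∀ k : ℕ, Primrec fun _ : List ℕ => k := fun k => Primrec.const k
  have hp : ∀ {f g : List ℕ → ℕ}, Primrec f → Primrec g →
      Primrec fun l : List ℕ => Nat.pair (f l) (g l) := fun hf hg => Primrec₂.natPair.comp hf hg
  have heq : ∀ {f g : List ℕ → ℕ}, Primrec f → Primrec g →
      PrimrecPred fun l : List ℕ => f l = g l := fun hf hg => Primrec.eq.comp hf hg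
  have hlt : ∀ {f g : List ℕ → ℕ}, Primrec f → Primrec g →
      PrimrecPred fun l : List ℕ => f l < g l := fun hf hg => Primrec.nat_lt.comp hf hg
  unfold elimStep
  refine Primrec.ite (heq ht (hk 0)) hc ?_
  refine Primrec.ite (heq ht (hk 1)) (Primrec.ite (hlt hb1 (hk n)) hc
    (Primrec.ite (heq hb1 (hk n)) (hp (hk 2) (hp hb2 (hk 0))) (hk _))) ?_
  refine Primrec.ite (heq ht (hk 2)) (hp (hk 2) (hp hb1 (Primrec.succ.comp hb2))) ?_
  refine Primrec.ite (heq ht (hk 3)) (hp (hk 3) (hget hb)) ?_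
  refine Primrec.ite (heq ht (hk 4)) (hp (hk 4) (hp (hget hb1) (hget hb2))) ?_
  refine Primrec.ite (heq ht (hk 5)) (hp (hk 5) (hp hb1 (hget hb2))) ?_
  exact Primrec.ite (heq ht (hk 6)) (hp (hk 6) (hp (Primrec.succ.comp hb1) (hget hb2))) (hk _)

theorem primrec_elimCode (n : ℕ) : Primrec (elimCode n) := by
  have h1 : Primrec (elimList n) := by
    have : Primrec₂ fun (_ : ℕ) (l : List ℕ) => l ++ [elimStep n l] :=
      Primrec.list_append.comp Primrec.snd
        (Primrec.list_cons.comp ((primrec_elimStep n).comp Primrec.snd) (Primrec.const []))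
    refine (Primrec.nat_rec₁ [] this).of_eq fun c => ?_
    induction c with
    | zero => rfl
    | succ c ih => simp only [elimList, ← ih]
  exact (primrec_elimStep n).comp h1

theorem elimCode_pair (n t b : ℕ) : elimCode n (Nat.pair t b) =
    if t = 0 then Nat.pair t b
    else if t = 1 then
      if b.unpair.1 < n then Nat.pair t b
      else if b.unpair.1 = n then Nat.pair 2 (Nat.pair b.unpair.2 0)
      else Nat.pair 7 0
    else if t = 2 then Nat.pair 2 (Nat.pair b.unpair.1 (b.unpair.2 + 1))
    else if t = 3 then Nat.pair 3 (elimCode n b)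
    else if t = 4 then Nat.pair 4 (Nat.pair (elimCode n b.unpair.1) (elimCode n b.unpair.2))
    else if t = 5 then Nat.pair 5 (Nat.pair b.unpair.1 (elimCode n b.unpair.2))
    else if t = 6 then Nat.pair 6 (Nat.pair (b.unpair.1 + 1) (elimCode n b.unpair.2))
    else Nat.pair 7 0 := by
  have hget : ∀ d, t ≠ 0 → d ≤ b →
      (elimList n (Nat.pair t b)).getD d 0 = elimCode n d := fun d ht hd =>
    getD_elimList (by have := Nat.add_le_pair t b; omega)
  have h1 := Nat.unpair_left_le b
  have h2 := Nat.unpair_right_le b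
  rw [elimCode, elimStep]
  simp only [length_elimList, Nat.unpair_pair]
  by_cases ht : t = 0
  · simp [ht]
  · simp only [hget _ ht h1, hget _ ht h2, hget _ ht le_rfl]

theorem elimCode_encode (φ : MSO (n + 1)) : elimCode n (encode φ) = encode (elimLast φ) := by
  induction φ with
  | pred k i =>
    rw [encode, elimCode_pair]
    by_cases h : (k : ℕ) < n
    · simp [elimLast, h, encode]
    · have : (k : ℕ) = n := by omega
      simp [elimLast, encode, this]
  | _ => simp_all [encode, elimCode_pair, elimLast]

theorem exists_of_elimCode_eq (c : ℕ) : ∀ ψ : MSO n, elimCode n c = encode ψ →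
    ∃ φ : MSO (n + 1), c = encode φ ∧ ψ = elimLast φ := by
  induction c using Nat.strong_induction_on with
  | _ c ih =>
  have key : ∀ c', c' < c → ∀ ψ : MSO n, elimCode n c' = encode ψ →
    ∃ φ : MSO (n + 1), c' = encode φ := fun c' h ψ hψ => by
      obtain ⟨φ, h1, _⟩ := ih c' h ψ hψ
      exact ⟨φ, h1⟩
  suffices H : ∀ ψ : MSO n, elimCode n c = encode ψ → ∃ φ : MSO (n + 1), c = encode φ by
    intro ψ hψ
    obtain ⟨φ, rfl⟩ := H ψ hψ
    rw [elimCode_encode] at hψ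
    exact ⟨φ, rfl, (encode_injective hψ).symm⟩
  intro ψ hψ
  obtain ⟨t, b, rfl⟩ : ∃ t b, c = Nat.pair t b := ⟨_, _, (Nat.pair_unpair c).symm⟩
  have hle := Nat.add_le_pair t b
  have hl := Nat.unpair_left_le b
  have hr := Nat.unpair_right_le b
  have hb := Nat.pair_unpair b
  rw [elimCode_pair] at hψ
  split_ifs at hψ with h0 h1 h2 h3 h4 h5 h6 h7 h8
  · exact ⟨lt b.unpair.1 b.unpair.2, by simp [encode, h0]⟩
  · exact ⟨pred ⟨b.unpair.1, by omega⟩ b.unpair.2, by simp [encode, h1]⟩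
  · exact ⟨pred ⟨b.unpair.1, by omega⟩ b.unpair.2, by simp [encode, h1]⟩
  · cases ψ <;> simp [encode, Nat.pair_eq_pair] at hψ
  · exact ⟨mem b.unpair.1 b.unpair.2, by simp [encode, h4]⟩
  · cases ψ <;> simp only [encode, Nat.pair_eq_pair] at hψ <;> try omega
    obtain ⟨φ, h⟩ := key b (by omega) _ hψ.2
    exact ⟨not φ, by simp [encode, ← h, h5]⟩
  · cases ψ <;> simp only [encode, Nat.pair_eq_pair] at hψ <;> try omega
    obtain ⟨φ, h⟩ := key b.unpair.1 (by omega) _ hψ.2.1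
    obtain ⟨φ', h'⟩ := key b.unpair.2 (by omega) _ hψ.2.2
    exact ⟨and φ φ', by simp [encode, ← h, ← h', h6]⟩
  · cases ψ <;> simp only [encode, Nat.pair_eq_pair] at hψ <;> try omega
    obtain ⟨φ', h'⟩ := key b.unpair.2 (by omega) _ hψ.2.2
    exact ⟨ex1 b.unpair.1 φ', by simp [encode, ← h', h7]⟩
  · cases ψ <;> simp only [encode, Nat.pair_eq_pair] at hψ <;> try omega
    obtain ⟨φ', h'⟩ := key b.unpair.2 (by omega) _ hψ.2.2
    exact ⟨ex2 b.unpair.1 φ', by simp [encode, ← h', h8]⟩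
  · cases ψ <;> simp [encode, Nat.pair_eq_pair] at hψ

end

section

variable {n : ℕ} {A : Type} {r : A → A → Prop} {P : Fin n → Set A}

/-! ## Properties of sets and pointed sets defined by formulas -/

/-- The formula has no free variables other than the set variable `0`. -/
def SetFormula (p : MSO n) : Prop := fv1 p = ∅ ∧ fv2 p ⊆ {0}

/-- The formula has no free variables other than the element variable `0` and the set
variable `0`. -/
def PointFormula (q : MSO n) : Prop := fv1 q ⊆ {0} ∧ fv2 q ⊆ {0}

/-- The property of sets expressed by a formula. -/
def SetProp (r : A → A → Prop) (P : Fin n → Set A) (p : MSO n) (X : Set A) : Prop :=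
  ∀ v V, V 0 = X → Sat r P v V p

/-- The relation between elements and sets expressed by a formula. -/
def PointProp (r : A → A → Prop) (P : Fin n → Set A) (q : MSO n) (a : A) (X : Set A) : Prop :=
  ∀ v V, v 0 = a → V 0 = X → Sat r P v V q

theorem SetFormula.sat_iff {p : MSO n} (h : SetFormula p) (v : ℕ → A) (V : ℕ → Set A) :
    Sat r P v V p ↔ SetProp r P p (V 0) := by
  refine ⟨fun hs w W hW => (sat_congr p (fun i hi => ?_) fun j hj => ?_).1 hs, fun hs => hs v V rfl⟩
  · simp [h.1] at hi
  · rw [Finset.mem_singleton.1 (h.2 hj), hW]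

theorem PointFormula.sat_iff {q : MSO n} (h : PointFormula q) (v : ℕ → A) (V : ℕ → Set A) :
    Sat r P v V q ↔ PointProp r P q (v 0) (V 0) := by
  refine ⟨fun hs w W hw hW => (sat_congr q (fun i hi => ?_) fun j hj => ?_).1 hs,
    fun hs => hs v V rfl rfl⟩
  · rw [Finset.mem_singleton.1 (h.1 hi), hw]
  · rw [Finset.mem_singleton.1 (h.2 hj), hW]

theorem IsSentence.trueIn_iff {φ : MSO n} (h : IsSentence φ) (v : ℕ → A) (V : ℕ → Set A) :
    TrueIn r P φ ↔ Sat r P v V φ := by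
  refine ⟨fun hs => hs v V, fun hs w W => (sat_congr φ (fun i hi => ?_) fun j hj => ?_).1 hs⟩
  · simp [h.1] at hi
  · simp [h.2] at hj

theorem encode_mem_theoryCodes {φ : MSO n} :
    encode φ ∈ TheoryCodes r P ↔ IsSentence φ ∧ TrueIn r P φ := by
  constructor
  · rintro ⟨ψ, h1, h2, h3⟩
    rw [encode_injective h2] at h1 h3
    exact ⟨h1, h3⟩
  · rintro ⟨h1, h2⟩
    exact ⟨φ, h1, rfl, h2⟩

/-! ## Formula contexts -/

/-- The formula stating that two element variables are equal. -/
def eqElem (i j : ℕ) : MSO n := not (ex2 0 (and (mem i 0) (not (mem j 0))))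

/-- The formula stating that two set variables are equal. -/
def eqSet (j k : ℕ) : MSO n :=
  not (ex1 0 (not (and (not (and (mem 0 j) (not (mem 0 k)))) (not (and (mem 0 k) (not (mem 0 j)))))))

theorem sat_eqElem {i j : ℕ} {v : ℕ → A} {V : ℕ → Set A} :
    Sat r P v V (eqElem i j) ↔ v i = v j := by
  simp only [eqElem, Sat, Function.update_self, not_exists, not_and, not_not]
  exact ⟨fun h => (h {v i} rfl).symm, fun h S hS => h ▸ hS⟩

theorem sat_eqSet {i j : ℕ} {v : ℕ → A} {V : ℕ → Set A} :
    Sat r P v V (eqSet i j) ↔ V i = V j := by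
  simp only [eqSet, Sat, Function.update_self, not_exists, not_and, not_not, Set.ext_iff]
  exact forall_congr' fun a => by tauto

/-- Instantiate the element variable `0` with the value of the variable `i`. -/
def instElem (i : ℕ) (φ : MSO n) : MSO n :=
  ex1 (i + 1) (and (eqElem (i + 1) i) (ex1 0 (and (eqElem 0 (i + 1)) φ)))

/-- Instantiate the set variable `0` with the value of the variable `j`. -/
def instSet (j : ℕ) (φ : MSO n) : MSO n :=
  ex2 (j + 1) (and (eqSet (j + 1) j) (ex2 0 (and (eqSet 0 (j + 1)) φ)))

theorem sat_instElem {i : ℕ} {φ : MSO n} {v : ℕ → A} {V : ℕ → Set A} :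
    Sat r P v V (instElem i φ) ↔
      Sat r P (Function.update (Function.update v (i + 1) (v i)) 0 (v i)) V φ := by
  simp [instElem, Sat, sat_eqElem]

theorem sat_instSet {i : ℕ} {φ : MSO n} {v : ℕ → A} {V : ℕ → Set A} :
    Sat r P v V (instSet i φ) ↔
      Sat r P v (Function.update (Function.update V (i + 1) (V i)) 0 (V i)) φ := by
  simp [instSet, Sat, sat_eqSet]

/-- Formulas with a hole for a property of sets and a hole for a relation between elements
and sets. -/
inductive Ctx (n : ℕ) : Type
  | lt (i j : ℕ) : Ctx n
  | pred (k : Fin n) (i : ℕ) : Ctx n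
  | mem (i j : ℕ) : Ctx n
  | setHole (j : ℕ) : Ctx n
  | pointHole (i j : ℕ) : Ctx n
  | not (φ : Ctx n) : Ctx n
  | and (φ ψ : Ctx n) : Ctx n
  | ex1 (i : ℕ) (φ : Ctx n) : Ctx n
  | ex2 (j : ℕ) (φ : Ctx n) : Ctx n

/-- Plug formulas into the holes of a context. -/
def Ctx.fill (p q : MSO n) : Ctx n → MSO n
  | lt i j => .lt i j
  | pred k i => .pred k i
  | mem i j => .mem i j
  | setHole j => instSet j p
  | pointHole i j => instElem i (instSet j q)
  | not φ => .not (φ.fill p q)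
  | and φ ψ => .and (φ.fill p q) (ψ.fill p q)
  | ex1 i φ => .ex1 i (φ.fill p q)
  | ex2 i φ => .ex2 i (φ.fill p q)

theorem Ctx.exists_primrec (E : Ctx n) : ∃ w : ℕ → ℕ → ℕ, Primrec₂ w ∧
    ∀ p q : MSO n, encode (E.fill p q) = w (encode p) (encode q) := by
  have hk : ∀ k : ℕ, Primrec₂ fun _ _ : ℕ => k := fun k => Primrec₂.const k
  have hp : ∀ {f g : ℕ → ℕ → ℕ}, Primrec₂ f → Primrec₂ g →
      Primrec₂ fun a b => Nat.pair (f a b) (g a b) := fun hf hg => Primrec₂.natPair.comp₂ hf hg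
  have inst2 : ∀ (j : ℕ) {f : ℕ → ℕ → ℕ}, Primrec₂ f → Primrec₂ fun a b =>
      Nat.pair 6 (Nat.pair (j + 1) (Nat.pair 4 (Nat.pair (encode (eqSet (n := n) (j + 1) j))
        (Nat.pair 6 (Nat.pair 0 (Nat.pair 4 (Nat.pair (encode (eqSet (n := n) 0 (j + 1)))
          (f a b)))))))) := fun j f hf =>
    hp (hk _) (hp (hk _) (hp (hk _) (hp (hk _) (hp (hk _) (hp (hk _) (hp (hk _) (hp (hk _) hf)))))))
  have inst1 : ∀ (j : ℕ) {f : ℕ → ℕ → ℕ}, Primrec₂ f → Primrec₂ fun a b =>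
      Nat.pair 5 (Nat.pair (j + 1) (Nat.pair 4 (Nat.pair (encode (eqElem (n := n) (j + 1) j))
        (Nat.pair 5 (Nat.pair 0 (Nat.pair 4 (Nat.pair (encode (eqElem (n := n) 0 (j + 1)))
          (f a b)))))))) := fun j f hf =>
    hp (hk _) (hp (hk _) (hp (hk _) (hp (hk _) (hp (hk _) (hp (hk _) (hp (hk _) (hp (hk _) hf)))))))
  induction E with
  | lt i j => exact ⟨_, hk _, fun p q => rfl⟩
  | pred k i => exact ⟨_, hk _, fun p q => rfl⟩
  | mem i j => exact ⟨_, hk _, fun p q => rfl⟩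
  | setHole j => exact ⟨_, inst2 j Primrec₂.left, fun p q => rfl⟩
  | pointHole i j => exact ⟨_, inst1 i (inst2 j Primrec₂.right), fun p q => rfl⟩
  | not φ ih =>
    obtain ⟨w, h1, h2⟩ := ih
    exact ⟨_, hp (hk 3) h1, fun p q => by rw [← h2]; rfl⟩
  | and φ ψ ih ih' =>
    obtain ⟨w, h1, h2⟩ := ih
    obtain ⟨w', h1', h2'⟩ := ih'
    exact ⟨_, hp (hk 4) (hp h1 h1'), fun p q => by rw [← h2, ← h2']; rfl⟩
  | ex1 i φ ih =>
    obtain ⟨w, h1, h2⟩ := ih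
    exact ⟨_, hp (hk 5) (hp (hk i) h1), fun p q => by rw [← h2]; rfl⟩
  | ex2 i φ ih =>
    obtain ⟨w, h1, h2⟩ := ih
    exact ⟨_, hp (hk 6) (hp (hk i) h1), fun p q => by rw [← h2]; rfl⟩

theorem Ctx.exists_bound (E : Ctx n) : ∃ N : ℕ, ∀ p q : MSO n, SetFormula p → PointFormula q →
    fv1 (E.fill p q) ⊆ Finset.range N ∧ fv2 (E.fill p q) ⊆ Finset.range N := by
  induction E with
  | lt i j =>
    refine ⟨i + j + 1, fun p q _ _ => ⟨fun x hx => ?_, fun x hx => ?_⟩⟩ <;>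
      simp [fill, fv1, fv2] at hx ⊢ <;> omega
  | pred k i =>
    refine ⟨i + 1, fun p q _ _ => ⟨fun x hx => ?_, fun x hx => ?_⟩⟩ <;>
      simp [fill, fv1, fv2] at hx ⊢ <;> omega
  | mem i j =>
    refine ⟨i + j + 1, fun p q _ _ => ⟨fun x hx => ?_, fun x hx => ?_⟩⟩ <;>
      simp [fill, fv1, fv2] at hx ⊢ <;> omega
  | setHole j =>
    refine ⟨j + 1, fun p q hp _ => ⟨fun x hx => ?_, fun x hx => ?_⟩⟩
    · simp [fill, fv1, hp.1, instSet, eqSet] at hx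
    · have := @hp.2 x
      simp [fill, fv2, instSet, eqSet] at hx this ⊢
      have : x = j := by tauto
      omega
  | pointHole i j =>
    refine ⟨i + j + 1, fun p q _ hq => ⟨fun x hx => ?_, fun x hx => ?_⟩⟩
    · have := @hq.1 x
      simp [fill, fv1, instElem, instSet, eqElem, eqSet] at hx this ⊢
      have : x = i := by tauto
      omega
    · have := @hq.2 x
      simp [fill, fv2, instElem, instSet, eqElem, eqSet] at hx this ⊢
      have : x = j := by tauto
      omega
  | not φ ih => exact ih
  | and φ ψ ih ih' =>
    obtain ⟨N, h⟩ := ih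
    obtain ⟨N', h'⟩ := ih'
    refine ⟨max N N', fun p q hp hq => ⟨Finset.union_subset ?_ ?_, Finset.union_subset ?_ ?_⟩⟩
    · exact (h p q hp hq).1.trans (Finset.range_mono (le_max_left _ _))
    · exact (h' p q hp hq).1.trans (Finset.range_mono (le_max_right _ _))
    · exact (h p q hp hq).2.trans (Finset.range_mono (le_max_left _ _))
    · exact (h' p q hp hq).2.trans (Finset.range_mono (le_max_right _ _))
  | ex1 i φ ih =>
    obtain ⟨N, h⟩ := ih
    exact ⟨N, fun p q hp hq => ⟨Finset.sdiff_subset.trans (h p q hp hq).1, (h p q hp hq).2⟩⟩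
  | ex2 i φ ih =>
    obtain ⟨N, h⟩ := ih
    exact ⟨N, fun p q hp hq => ⟨(h p q hp hq).1, Finset.sdiff_subset.trans (h p q hp hq).2⟩⟩

/-! ## The reduction -/

/-- The sequence of formulas generated from `p₀` by a context and a sequence of formulas. -/
def genSeq (E : Ctx n) (p₀ : MSO n) (τ : ℕ → MSO n) : ℕ → MSO n
  | 0 => p₀
  | k + 1 => E.fill (genSeq E p₀ τ k) (τ k)

theorem exists_pointFormula_iff [Nonempty A] (k : ℕ) :
    (∃ σ : MSO n, PointFormula σ ∧ encode σ = k) ↔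
      Nat.pair 5 (Nat.pair 0 (Nat.pair 6 (Nat.pair 0 k))) ∈ TheoryCodes r P ∨
      Nat.pair 5 (Nat.pair 0 (Nat.pair 6 (Nat.pair 0 (Nat.pair 3 k)))) ∈ TheoryCodes r P := by
  constructor
  · rintro ⟨σ, hσ, rfl⟩
    have hs : IsSentence (ex1 0 (ex2 0 σ)) := by
      simpa only [IsSentence, PointFormula, SetFormula, fv1, fv2,
        Finset.sdiff_eq_empty_iff_subset] using hσ
    have hs' : IsSentence (ex1 0 (ex2 0 (not σ))) := hs
    change encode (ex1 0 (ex2 0 σ)) ∈ _ ∨ encode (ex1 0 (ex2 0 (not σ))) ∈ _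
    rw [encode_mem_theoryCodes, encode_mem_theoryCodes]
    obtain ⟨a⟩ := ‹Nonempty A›
    rw [hs.trueIn_iff (fun _ => a) (fun _ => ∅), hs'.trueIn_iff (fun _ => a) (fun _ => ∅)]
    by_cases h : Sat r P (Function.update (fun _ => a) 0 a) (Function.update (fun _ => ∅) 0 ∅) σ
    · exact .inl ⟨hs, a, ∅, h⟩
    · exact .inr ⟨hs', a, ∅, h⟩
  · have key : ∀ c, Nat.pair 5 (Nat.pair 0 (Nat.pair 6 (Nat.pair 0 c))) ∈ TheoryCodes r P →
        ∃ σ : MSO n, PointFormula σ ∧ encode σ = c := by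
      rintro c ⟨φ, h1, h2, -⟩
      cases φ <;> simp only [encode, Nat.pair_eq_pair] at h2 <;> try omega
      rename_i i φ
      cases φ <;> simp only [encode, Nat.pair_eq_pair] at h2 <;> try omega
      rename_i j φ
      obtain ⟨-, rfl, -, rfl, h⟩ := h2
      exact ⟨φ, by simpa only [IsSentence, PointFormula, SetFormula, fv1, fv2,
        Finset.sdiff_eq_empty_iff_subset] using h1, h⟩
    rintro (h | h)
    · exact key _ h
    · obtain ⟨σ, hσ, h⟩ := key _ h
      cases σ <;> simp only [encode, Nat.pair_eq_pair] at h <;> try omega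
      rename_i σ
      exact ⟨σ, hσ, h.2⟩

theorem exists_setFormula_iff [Nonempty A] (k : ℕ) :
    (∃ σ : MSO n, SetFormula σ ∧ encode σ = k) ↔
      Nat.pair 6 (Nat.pair 0 k) ∈ TheoryCodes r P ∨
      Nat.pair 6 (Nat.pair 0 (Nat.pair 3 k)) ∈ TheoryCodes r P := by
  constructor
  · rintro ⟨σ, hσ, rfl⟩
    have hs : IsSentence (ex2 0 σ) := by
      simpa only [IsSentence, PointFormula, SetFormula, fv1, fv2,
        Finset.sdiff_eq_empty_iff_subset] using hσ
    have hs' : IsSentence (ex2 0 (not σ)) := hs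
    change encode (ex2 0 σ) ∈ _ ∨ encode (ex2 0 (not σ)) ∈ _
    rw [encode_mem_theoryCodes, encode_mem_theoryCodes]
    obtain ⟨a⟩ := ‹Nonempty A›
    rw [hs.trueIn_iff (fun _ => a) (fun _ => ∅), hs'.trueIn_iff (fun _ => a) (fun _ => ∅)]
    by_cases h : Sat r P (fun _ => a) (Function.update (fun _ => ∅) 0 ∅) σ
    · exact .inl ⟨hs, ∅, h⟩
    · exact .inr ⟨hs', ∅, h⟩
  · have key : ∀ c, Nat.pair 6 (Nat.pair 0 c) ∈ TheoryCodes r P →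
        ∃ σ : MSO n, SetFormula σ ∧ encode σ = c := by
      rintro c ⟨φ, h1, h2, -⟩
      cases φ <;> simp only [encode, Nat.pair_eq_pair] at h2 <;> try omega
      rename_i j φ
      obtain ⟨-, rfl, h⟩ := h2
      exact ⟨φ, by simpa only [IsSentence, PointFormula, SetFormula, fv1, fv2,
        Finset.sdiff_eq_empty_iff_subset] using h1, h⟩
    rintro (h | h)
    · exact key _ h
    · obtain ⟨σ, hσ, h⟩ := key _ h
      cases σ <;> simp only [encode, Nat.pair_eq_pair] at h <;> try omega
      rename_i σ
      exact ⟨σ, hσ, h.2⟩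

/-- The code of the sentence stating that every set with the first property has the second. -/
def implCode (a b : ℕ) : ℕ :=
  Nat.pair 3 (Nat.pair 6 (Nat.pair 0 (Nat.pair 4 (Nat.pair a (Nat.pair 3 b)))))

theorem implCode_mem_iff [Nonempty A] {p φ : MSO n} (hp : SetFormula p) (hφ : SetFormula φ) :
    implCode (encode p) (encode φ) ∈ TheoryCodes r P ↔
      ∀ X, SetProp r P p X → SetProp r P φ X := by
  change encode (not (ex2 0 (and p (not φ)))) ∈ _ ↔ _
  have hs : IsSentence (not (ex2 0 (and p (not φ)))) := by
    simp [IsSentence, fv1, fv2, hp.1, hφ.1, Finset.sdiff_eq_empty_iff_subset,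
      Finset.union_subset hp.2 hφ.2]
  obtain ⟨a⟩ := ‹Nonempty A›
  rw [encode_mem_theoryCodes, hs.trueIn_iff (fun _ => a) (fun _ => ∅)]
  simp [hs, Sat, hp.sat_iff, hφ.sat_iff]

theorem exists_of_implCode_mem {a b : ℕ} (h : implCode a b ∈ TheoryCodes r P) :
    ∃ φ : MSO n, SetFormula φ ∧ encode φ = b := by
  obtain ⟨φ, h1, h2, -⟩ := h
  unfold implCode at h2
  cases φ <;> simp only [encode, Nat.pair_eq_pair] at h2 <;> try omega
  rename_i φ
  cases φ <;> simp only [encode, Nat.pair_eq_pair] at h2 <;> try omega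
  rename_i j φ
  cases φ <;> simp only [encode, Nat.pair_eq_pair] at h2 <;> try omega
  rename_i p φ
  cases φ <;> simp only [encode, Nat.pair_eq_pair] at h2 <;> try omega
  rename_i φ
  obtain ⟨-, -, rfl, -, -, -, h⟩ := h2
  simp only [IsSentence, fv1, fv2, Finset.sdiff_eq_empty_iff_subset, Finset.union_eq_empty] at h1
  exact ⟨φ, ⟨h1.1.2, Finset.union_subset_right h1.2⟩, h⟩

theorem exists_undefinable_of_genSeq [Nonempty A] {p₀ : MSO n} (hp₀ : SetFormula p₀) {E : Ctx n}
    (hE : ∀ p q, SetFormula p → PointFormula q → SetFormula (E.fill p q))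
    (H : ∀ τ : ℕ → MSO n, (∀ k, PointFormula (τ k)) → (∀ σ, PointFormula σ → ∃ k, τ k = σ) →
      ∃ Q, (∀ k, SetProp r P (genSeq E p₀ τ k) Q) ∧
        (∀ k, ∃ X, X ≠ Q ∧ SetProp r P (genSeq E p₀ τ k) X) ∧
        ∀ φ, SetFormula φ → ∃ k, (∀ X, SetProp r P (genSeq E p₀ τ k) X → SetProp r P φ X) ∨
          ∀ X, SetProp r P (genSeq E p₀ τ k) X → ¬ SetProp r P φ X) :
    ∃ Q, ¬ Definable r P Q ∧
      TuringRed (TheoryCodes r (Fin.snoc P Q)) (TheoryCodes r P) := by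
  classical
  let τ₀ : MSO n := lt 0 0
  have hτ₀ : PointFormula τ₀ := by simp [τ₀, PointFormula, fv1, fv2]
  let τ : ℕ → MSO n := fun k =>
    if h : ∃ σ : MSO n, PointFormula σ ∧ encode σ = k then h.choose else τ₀
  have hτ : ∀ k, PointFormula (τ k) := fun k => by
    by_cases h : ∃ σ : MSO n, PointFormula σ ∧ encode σ = k
    · simpa only [τ, dif_pos h] using h.choose_spec.1
    · simpa only [τ, dif_neg h] using hτ₀
  have hsurj : ∀ σ, PointFormula σ → ∃ k, τ k = σ := fun σ hσ => by
    have h : ∃ σ' : MSO n, PointFormula σ' ∧ encode σ' = encode σ := ⟨σ, hσ, rfl⟩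
    refine ⟨encode σ, ?_⟩
    simp only [τ, dif_pos h]
    exact encode_injective h.choose_spec.2
  obtain ⟨Q, hQ, hne, hdec⟩ := H τ hτ hsurj
  set F := genSeq E p₀ τ with hFdef
  have hF : ∀ k, SetFormula (F k) := fun k => by
    induction k with
    | zero => exact hp₀
    | succ k ih => exact hE _ _ ih (hτ k)
  refine ⟨Q, ?_, ?_⟩
  · rintro ⟨ψ, h1, h2, h3⟩
    let φ : MSO n := not (ex1 0 (not (and (not (and (mem 0 0) (not ψ)))
      (not (and ψ (not (mem 0 0)))))))
    have hφ : SetFormula φ := by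
      constructor
      · simp only [φ, fv1, Finset.sdiff_eq_empty_iff_subset, Finset.union_subset_iff, h1,
          Finset.Subset.refl, and_self]
      · simp [φ, fv2, h2]
    have hψ : PointFormula ψ := ⟨h1, by simp [h2]⟩
    have hφX : ∀ X, SetProp r P φ X ↔ X = Q := fun X => by
      obtain ⟨a⟩ := ‹Nonempty A›
      rw [show SetProp r P φ X ↔ Sat r P (fun _ => a) (fun _ => X) φ from
        (hφ.sat_iff (fun _ => a) (fun _ => X)).symm]
      simp only [φ, Sat, hψ.sat_iff, Function.update_self, not_exists, not_and, not_not,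
        Set.ext_iff, h3]
      refine forall_congr' fun b => ?_
      have : (∀ (v : ℕ → A) (V : ℕ → Set A), PointProp r P ψ b (V 0)) ↔ PointProp r P ψ b X := by
        refine ⟨fun h => h (fun _ => a) fun _ => X, fun h v V w W hw _ => ?_⟩
        refine (sat_congr ψ (fun i hi => ?_) fun j hj => ?_).1 (h w (fun _ => X) hw rfl)
        · rfl
        · simp [h2] at hj
      rw [this]
      tauto
    obtain ⟨k, hk | hk⟩ := hdec φ hφ
    · obtain ⟨X, hX, hXk⟩ := hne k
      exact hX ((hφX X).1 (hk X hXk))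
    · exact hk Q (hQ k) ((hφX Q).2 rfl)
  · obtain ⟨w, hw, hwE⟩ := E.exists_primrec
    set T := TheoryCodes r P with hT
    let ind : ℕ → ℕ := T.indicator fun _ => 1
    have hind : TRec (chi T) ind := RecursiveIn.oracle
    have ind1 : ∀ c, c ∈ T → ind c = 1 := fun c h => by simp [ind, h]
    have ind0 : ∀ c, c ∉ T → ind c = 0 := fun c h => by simp [ind, h]
    have pk : ∀ (k : ℕ) {f : ℕ → ℕ}, TRec (chi T) f → TRec (chi T) fun c => Nat.pair k (f c) :=
      fun k f hf => (TRec.of_primrec (Primrec.const k)).pair hf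
    have hid : TRec (chi T) fun c => c := TRec.of_primrec Primrec.id
    have hval : ∀ c, (0 < ind (Nat.pair 5 (Nat.pair 0 (Nat.pair 6 (Nat.pair 0 c)))) +
        ind (Nat.pair 5 (Nat.pair 0 (Nat.pair 6 (Nat.pair 0 (Nat.pair 3 c)))))) ↔
        ∃ σ : MSO n, PointFormula σ ∧ encode σ = c := fun c => by
      rw [exists_pointFormula_iff (r := r) (P := P), ← hT]
      by_cases h1 : Nat.pair 5 (Nat.pair 0 (Nat.pair 6 (Nat.pair 0 c))) ∈ T <;>
      by_cases h2 : Nat.pair 5 (Nat.pair 0 (Nat.pair 6 (Nat.pair 0 (Nat.pair 3 c)))) ∈ T <;>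
      simp [h1, h2, ind]
    have hval' : ∀ c, (0 < ind (Nat.pair 6 (Nat.pair 0 c)) +
        ind (Nat.pair 6 (Nat.pair 0 (Nat.pair 3 c)))) ↔
        ∃ σ : MSO n, SetFormula σ ∧ encode σ = c := fun c => by
      rw [exists_setFormula_iff (r := r) (P := P), ← hT]
      by_cases h1 : Nat.pair 6 (Nat.pair 0 c) ∈ T <;>
      by_cases h2 : Nat.pair 6 (Nat.pair 0 (Nat.pair 3 c)) ∈ T <;>
      simp [h1, h2, ind]
    have hτrec : TRec (chi T) fun k => encode (τ k) := by
      have h1 : TRec (chi T) fun c => ind (Nat.pair 5 (Nat.pair 0 (Nat.pair 6 (Nat.pair 0 c)))) +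
        ind (Nat.pair 5 (Nat.pair 0 (Nat.pair 6 (Nat.pair 0 (Nat.pair 3 c))))) :=
        TRec.app Primrec.nat_add (hind.comp (pk 5 (pk 0 (pk 6 (pk 0 hid)))))
          (hind.comp (pk 5 (pk 0 (pk 6 (pk 0 (pk 3 hid))))))
      have h2 : Primrec₂ fun a k : ℕ => if 0 < a then k else encode τ₀ :=
        Primrec.ite (Primrec.nat_lt.comp (Primrec.const 0) Primrec.fst) Primrec.snd
          (Primrec.const _)
      refine (congrArg (TRec (chi T)) (funext fun k => ?_)).mpr (TRec.app h2 h1 hid)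
      by_cases h : ∃ σ : MSO n, PointFormula σ ∧ encode σ = k
      · rw [if_pos ((hval k).2 h)]
        simp only [τ, dif_pos h]
        exact h.choose_spec.2
      · rw [if_neg fun h' => h ((hval k).1 h')]
        simp only [τ, dif_neg h]
    have hleft : TRec (chi T) fun m => m.unpair.1 :=
      TRec.of_primrec (Primrec.fst.comp Primrec.unpair)
    have hright : TRec (chi T) fun m => m.unpair.2 :=
      TRec.of_primrec (Primrec.snd.comp Primrec.unpair)
    have hFrec : TRec (chi T) fun k => encode (F k) := by
      refine TRec.nat_rec (s := fun k c => w c (encode (τ k))) ?_ fun k => ?_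
      · exact TRec.app hw hright (hτrec.comp hleft)
      · exact hwE _ _
    have himp : Primrec₂ implCode := by
      have hk : ∀ k : ℕ, Primrec₂ fun _ _ : ℕ => k := fun k => Primrec₂.const k
      have hp : ∀ {f g : ℕ → ℕ → ℕ}, Primrec₂ f → Primrec₂ g →
          Primrec₂ fun a b => Nat.pair (f a b) (g a b) :=
        fun hf hg => Primrec₂.natPair.comp₂ hf hg
      exact hp (hk _) (hp (hk _) (hp (hk _) (hp (hk _) (hp Primrec₂.left
        (hp (hk _) Primrec₂.right)))))
    have htc : TRec (chi T) (elimCode n) := TRec.of_primrec (primrec_elimCode n)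
    let x₁ : ℕ → ℕ → ℕ := fun c k => ind (implCode (encode (F k)) (elimCode n c))
    let x₂ : ℕ → ℕ → ℕ := fun c k => ind (implCode (encode (F k)) (Nat.pair 3 (elimCode n c)))
    let y : ℕ → ℕ := fun c => ind (Nat.pair 6 (Nat.pair 0 (elimCode n c))) +
      ind (Nat.pair 6 (Nat.pair 0 (Nat.pair 3 (elimCode n c))))
    have hx₁ : TRec (chi T) fun m => x₁ m.unpair.1 m.unpair.2 :=
      hind.comp (TRec.app himp (hFrec.comp hright) (htc.comp hleft))
    have hx₂ : TRec (chi T) fun m => x₂ m.unpair.1 m.unpair.2 :=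
      hind.comp (TRec.app himp (hFrec.comp hright) (pk 3 (htc.comp hleft)))
    have hy : TRec (chi T) fun m => y m.unpair.1 :=
      TRec.app Primrec.nat_add (hind.comp (pk 6 (pk 0 (htc.comp hleft))))
        (hind.comp (pk 6 (pk 0 (pk 3 (htc.comp hleft)))))
    let g : ℕ → ℕ → ℕ := fun c k => y c * (1 - (x₁ c k + x₂ c k))
    have hg : TRec (chi T) fun m => g m.unpair.1 m.unpair.2 :=
      TRec.app (h := fun a b => a * b) Primrec.nat_mul hy (TRec.app (h := fun a b => 1 - (a + b))
        (Primrec.nat_sub.comp₂ (Primrec₂.const 1) Primrec.nat_add) hx₁ hx₂)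
    have hx₁iff : ∀ k (φ : MSO (n + 1)), SetFormula (elimLast φ) → (x₁ (encode φ) k = 1 ↔
        ∀ X, SetProp r P (F k) X → SetProp r P (elimLast φ) X) := fun k φ hφ => by
      rw [← implCode_mem_iff (hF k) hφ, ← hT]
      simp [x₁, ind, elimCode_encode, Set.indicator_apply]
    have hx₂iff : ∀ k (φ : MSO (n + 1)), SetFormula (elimLast φ) → (x₂ (encode φ) k = 1 ↔
        ∀ X, SetProp r P (F k) X → ¬ SetProp r P (elimLast φ) X) := fun k φ hφ => by
      have hφ' : SetFormula (not (elimLast φ)) := hφ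
      have : ∀ X, SetProp r P (not (elimLast φ)) X ↔ ¬ SetProp r P (elimLast φ) X := fun X => by
        obtain ⟨a⟩ := ‹Nonempty A›
        exact (hφ'.sat_iff (fun _ => a) (fun _ => X)).symm.trans
          (not_congr (hφ.sat_iff (fun _ => a) (fun _ => X)))
      simp only [← this]
      rw [← implCode_mem_iff (hF k) hφ', ← hT]
      simp [x₂, ind, elimCode_encode, encode, Set.indicator_apply]
    have hcode : ∀ c, (∃ σ : MSO n, SetFormula σ ∧ encode σ = elimCode n c) →
        ∃ φ : MSO (n + 1), c = encode φ ∧ SetFormula (elimLast φ) := by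
      rintro c ⟨σ, hσ, hc⟩
      obtain ⟨φ, h1, rfl⟩ := exists_of_elimCode_eq c σ hc.symm
      exact ⟨φ, h1, hσ⟩
    have hzero : ∀ c, ∃ k, g c k = 0 := fun c => by
      by_cases hc : 0 < y c
      · obtain ⟨φ, rfl, hφ⟩ := hcode c ((hval' _).1 hc)
        obtain ⟨k, hk | hk⟩ := hdec _ hφ
        · exact ⟨k, by simp [g, (hx₁iff k φ hφ).2 hk]⟩
        · exact ⟨k, by simp [g, (hx₂iff k φ hφ).2 hk]⟩
      · exact ⟨0, by simp [g, Nat.eq_zero_of_not_pos hc]⟩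
    obtain ⟨f, hf, hf0⟩ := TRec.exists_search hg hzero
    have hout : TRec (chi T) fun c => x₁ c (f c) := by
      simpa using hx₁.comp (hid.pair hf)
    unfold TuringRed
    refine (congrArg (RecursiveIn (chi T)) (funext fun c => ?_)).mpr hout
    simp only [chi]
    congr 1
    by_cases hc : ∃ φ : MSO (n + 1), c = encode φ ∧ SetFormula (elimLast φ)
    · obtain ⟨φ, rfl, hφ⟩ := hc
      have hsent : IsSentence φ := ⟨by rw [← fv1_elimLast]; exact hφ.1,
        (fv2_elimLast_subset φ).1 hφ.2⟩
      have hiff : encode φ ∈ TheoryCodes r (Fin.snoc P Q) ↔ SetProp r P (elimLast φ) Q := by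
        obtain ⟨a⟩ := ‹Nonempty A›
        rw [encode_mem_theoryCodes, hsent.trueIn_iff (fun _ => a) (fun _ => ∅),
          ← sat_elimLast Q φ (W := Function.update (fun _ => ∅) 0 Q) (by simp) (by simp),
          hφ.sat_iff]
        simp [hsent]
      have hy0 : 0 < y (encode φ) := (hval' _).2 ⟨elimLast φ, hφ, (elimCode_encode φ).symm⟩
      have := hf0 (encode φ)
      have h01 : x₁ (encode φ) (f (encode φ)) = 0 ∨ x₁ (encode φ) (f (encode φ)) = 1 := by
        simp only [x₁, ind, Set.indicator_apply]
        split_ifs <;> simp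
      have h02 : x₂ (encode φ) (f (encode φ)) = 0 ∨ x₂ (encode φ) (f (encode φ)) = 1 := by
        simp only [x₂, ind, Set.indicator_apply]
        split_ifs <;> simp
      rcases h01 with h | h
      · have h2 : x₂ (encode φ) (f (encode φ)) = 1 := by
          rcases h02 with h' | h'
          · simp [g, h, h', hy0.ne'] at this
          · exact h'
        rw [h, Set.indicator_of_notMem]
        rw [hiff]
        exact (hx₂iff _ φ hφ).1 h2 Q (hQ _)
      · rw [h, Set.indicator_of_mem]
        rw [hiff]
        exact (hx₁iff _ φ hφ).1 h Q (hQ _)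
    · rw [Set.indicator_of_notMem]
      · refine (ind0 _ fun h => hc (hcode c (exists_of_implCode_mem h))).symm
      · rintro ⟨φ, h1, rfl, -⟩
        exact hc ⟨φ, rfl, by rw [fv1_elimLast]; exact h1.1, (fv2_elimLast_subset φ).2 h1.2⟩

end

section

variable {n : ℕ} {A : Type} {r : A → A → Prop} {P : Fin n → Set A}

/-! ## Definable relations -/

/-- An environment interprets the holes of contexts and the variables. -/
structure Env (A : Type) where
  /-- The property of sets interpreting the first hole. -/
  p : Set A → Prop
  /-- The relation interpreting the second hole. -/
  t : A → Set A → Prop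
  /-- The values of the element variables. -/
  v : ℕ → A
  /-- The values of the set variables. -/
  V : ℕ → Set A

namespace Env

/-- Change the value of an element variable. -/
def setv (ρ : Env A) (i : ℕ) (a : A) : Env A := ⟨ρ.p, ρ.t, Function.update ρ.v i a, ρ.V⟩

/-- Change the value of a set variable. -/
def setV (ρ : Env A) (j : ℕ) (S : Set A) : Env A := ⟨ρ.p, ρ.t, ρ.v, Function.update ρ.V j S⟩

/-- Rename the variables. -/
def ren (ρ : Env A) (f g : ℕ → ℕ) : Env A := ⟨ρ.p, ρ.t, ρ.v ∘ f, ρ.V ∘ g⟩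

@[simp] theorem setv_v_self (ρ : Env A) (i : ℕ) (a : A) : (ρ.setv i a).v i = a := by simp [setv]

@[simp] theorem setV_V_self (ρ : Env A) (i : ℕ) (a : Set A) : (ρ.setV i a).V i = a := by
  simp [setV]

theorem setv_v_ne (ρ : Env A) {i j : ℕ} (a : A) (h : j ≠ i) : (ρ.setv i a).v j = ρ.v j := by
  simp [setv, h]

theorem setV_V_ne (ρ : Env A) {i j : ℕ} (a : Set A) (h : j ≠ i) :
    (ρ.setV i a).V j = ρ.V j := by
  simp [setV, h]

end Env

/-- Semantics of contexts. -/
def Ctx.Holds (r : A → A → Prop) (P : Fin n → Set A) : Ctx n → Env A → Prop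
  | lt i j, ρ => r (ρ.v i) (ρ.v j)
  | pred k i, ρ => ρ.v i ∈ P k
  | mem i j, ρ => ρ.v i ∈ ρ.V j
  | setHole j, ρ => ρ.p (ρ.V j)
  | pointHole i j, ρ => ρ.t (ρ.v i) (ρ.V j)
  | not φ, ρ => ¬ φ.Holds r P ρ
  | and φ ψ, ρ => φ.Holds r P ρ ∧ ψ.Holds r P ρ
  | ex1 i φ, ρ => ∃ a, φ.Holds r P (ρ.setv i a)
  | ex2 j φ, ρ => ∃ S, φ.Holds r P (ρ.setV j S)

theorem Ctx.sat_fill {p q : MSO n} (hp : SetFormula p) (hq : PointFormula q) (E : Ctx n) :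
    ∀ {v : ℕ → A} {V : ℕ → Set A}, Sat r P v V (E.fill p q) ↔
      E.Holds r P ⟨SetProp r P p, PointProp r P q, v, V⟩ := by
  induction E with
  | lt i j => intros; rfl
  | pred k i => intros; rfl
  | mem i j => intros; rfl
  | setHole j => intro v V; rw [fill, sat_instSet, hp.sat_iff]; simp [Holds]
  | pointHole i j =>
    intro v V; rw [fill, sat_instElem, sat_instSet, hq.sat_iff]; simp [Holds]
  | not φ ih => intro v V; exact not_congr ih
  | and φ ψ ih ih' => intro v V; exact and_congr ih ih'
  | ex1 i φ ih => intro v V; exact exists_congr fun a => ih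
  | ex2 i φ ih => intro v V; exact exists_congr fun a => ih

theorem Ctx.exists_holds_congr (E : Ctx n) : ∃ N : ℕ, ∀ ρ σ : Env A, ρ.p = σ.p → ρ.t = σ.t →
    (∀ i < N, ρ.v i = σ.v i) → (∀ i < N, ρ.V i = σ.V i) →
    (E.Holds r P ρ ↔ E.Holds r P σ) := by
  induction E with
  | lt i j =>
    refine ⟨i + j + 1, fun ρ σ _ _ h _ => ?_⟩
    simp only [Holds]; rw [h i (by omega), h j (by omega)]
  | pred k i =>
    refine ⟨i + 1, fun ρ σ _ _ h _ => ?_⟩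
    simp only [Holds]; rw [h i (by omega)]
  | mem i j =>
    refine ⟨i + j + 1, fun ρ σ _ _ h h' => ?_⟩
    simp only [Holds]; rw [h i (by omega), h' j (by omega)]
  | setHole j =>
    refine ⟨j + 1, fun ρ σ hp _ h h' => ?_⟩
    simp only [Holds]; rw [hp, h' j (by omega)]
  | pointHole i j =>
    refine ⟨i + j + 1, fun ρ σ _ ht h h' => ?_⟩
    simp only [Holds]; rw [ht, h i (by omega), h' j (by omega)]
  | not φ ih =>
    obtain ⟨N, h⟩ := ih
    exact ⟨N, fun ρ σ h1 h2 h3 h4 => not_congr (h ρ σ h1 h2 h3 h4)⟩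
  | and φ ψ ih ih' =>
    obtain ⟨N, h⟩ := ih
    obtain ⟨N', h'⟩ := ih'
    exact ⟨max N N', fun ρ σ h1 h2 h3 h4 => and_congr
      (h ρ σ h1 h2 (fun i hi => h3 i (hi.trans_le (le_max_left _ _)))
        fun i hi => h4 i (hi.trans_le (le_max_left _ _)))
      (h' ρ σ h1 h2 (fun i hi => h3 i (hi.trans_le (le_max_right _ _)))
        fun i hi => h4 i (hi.trans_le (le_max_right _ _)))⟩
  | ex1 j φ ih =>
    obtain ⟨N, h⟩ := ih
    refine ⟨N, fun ρ σ h1 h2 h3 h4 => exists_congr fun a => h _ _ h1 h2 (fun i hi => ?_) h4⟩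
    by_cases hij : i = j
    · simp [hij]
    · rw [Env.setv_v_ne _ _ hij, Env.setv_v_ne _ _ hij, h3 i hi]
  | ex2 j φ ih =>
    obtain ⟨N, h⟩ := ih
    refine ⟨N, fun ρ σ h1 h2 h3 h4 => exists_congr fun a => h _ _ h1 h2 h3 (fun i hi => ?_)⟩
    by_cases hij : i = j
    · simp [hij]
    · rw [Env.setV_V_ne _ _ hij, Env.setV_V_ne _ _ hij, h4 i hi]

theorem exists_fresh (f : ℕ → ℕ) (N : ℕ) : ∃ m, ∀ i < N, f i ≠ m := by
  obtain ⟨m, hm⟩ := Infinite.exists_notMem_finset ((Finset.range N).image f)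
  exact ⟨m, fun i hi h => hm (Finset.mem_image.2 ⟨i, Finset.mem_range.2 hi, h⟩)⟩

theorem Ctx.exists_ren (E : Ctx n) : ∀ f g : ℕ → ℕ, ∃ E' : Ctx n, ∀ ρ : Env A,
    E'.Holds r P ρ ↔ E.Holds r P (ρ.ren f g) := by
  induction E with
  | lt i j => exact fun f g => ⟨lt (f i) (f j), fun ρ => Iff.rfl⟩
  | pred k i => exact fun f g => ⟨pred k (f i), fun ρ => Iff.rfl⟩
  | mem i j => exact fun f g => ⟨mem (f i) (g j), fun ρ => Iff.rfl⟩
  | setHole j => exact fun f g => ⟨setHole (g j), fun ρ => Iff.rfl⟩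
  | pointHole i j => exact fun f g => ⟨pointHole (f i) (g j), fun ρ => Iff.rfl⟩
  | not φ ih =>
    intro f g
    obtain ⟨E, hE⟩ := ih f g
    exact ⟨not E, fun ρ => not_congr (hE ρ)⟩
  | and φ ψ ih ih' =>
    intro f g
    obtain ⟨E, hE⟩ := ih f g
    obtain ⟨E', hE'⟩ := ih' f g
    exact ⟨and E E', fun ρ => and_congr (hE ρ) (hE' ρ)⟩
  | ex1 i φ ih =>
    intro f g
    obtain ⟨N, hN⟩ := φ.exists_holds_congr (r := r) (P := P)
    obtain ⟨m, hm⟩ := exists_fresh f N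
    obtain ⟨E, hE⟩ := ih (Function.update f i m) g
    refine ⟨ex1 m E, fun ρ => exists_congr fun a => (hE _).trans (hN _ _ rfl rfl ?_ fun j _ => rfl)⟩
    intro j hj
    by_cases hij : j = i
    · simp [hij, Env.ren, Env.setv]
    · simp [hij, Env.ren, Env.setv, hm j hj]
  | ex2 i φ ih =>
    intro f g
    obtain ⟨N, hN⟩ := φ.exists_holds_congr (r := r) (P := P)
    obtain ⟨m, hm⟩ := exists_fresh g N
    obtain ⟨E, hE⟩ := ih f (Function.update g i m)
    refine ⟨ex2 m E, fun ρ => exists_congr fun a => (hE _).trans (hN _ _ rfl rfl (fun j _ => rfl) ?_)⟩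
    intro j hj
    by_cases hij : j = i
    · simp [hij, Env.ren, Env.setV]
    · simp [hij, Env.ren, Env.setV, hm j hj]

/-- Relations on environments expressed by contexts. -/
def Dfn (r : A → A → Prop) (P : Fin n → Set A) (R : Env A → Prop) : Prop :=
  ∃ E : Ctx n, ∀ ρ, E.Holds r P ρ ↔ R ρ

namespace Dfn

variable {R S : Env A → Prop}

theorem congr (h : Dfn r P R) (hRS : ∀ ρ, R ρ ↔ S ρ) : Dfn r P S := by
  obtain ⟨E, hE⟩ := h
  exact ⟨E, fun ρ => (hE ρ).trans (hRS ρ)⟩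

theorem rel (i j : ℕ) : Dfn r P fun ρ => r (ρ.v i) (ρ.v j) := ⟨.lt i j, fun _ => Iff.rfl⟩

theorem pred (k : Fin n) (i : ℕ) : Dfn r P fun ρ => ρ.v i ∈ P k := ⟨.pred k i, fun _ => Iff.rfl⟩

theorem mem (i j : ℕ) : Dfn r P fun ρ => ρ.v i ∈ ρ.V j := ⟨.mem i j, fun _ => Iff.rfl⟩

theorem setHole (j : ℕ) : Dfn r P fun ρ => ρ.p (ρ.V j) := ⟨.setHole j, fun _ => Iff.rfl⟩

theorem pointHole (i j : ℕ) : Dfn r P fun ρ => ρ.t (ρ.v i) (ρ.V j) :=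
  ⟨.pointHole i j, fun _ => Iff.rfl⟩

theorem not (h : Dfn r P R) : Dfn r P fun ρ => ¬ R ρ := by
  obtain ⟨E, hE⟩ := h
  exact ⟨.not E, fun ρ => not_congr (hE ρ)⟩

theorem and (h : Dfn r P R) (h' : Dfn r P S) : Dfn r P fun ρ => R ρ ∧ S ρ := by
  obtain ⟨E, hE⟩ := h
  obtain ⟨E', hE'⟩ := h'
  exact ⟨.and E E', fun ρ => and_congr (hE ρ) (hE' ρ)⟩

theorem or (h : Dfn r P R) (h' : Dfn r P S) : Dfn r P fun ρ => R ρ ∨ S ρ :=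
  (h.not.and h'.not).not.congr fun ρ => by tauto

theorem imp (h : Dfn r P R) (h' : Dfn r P S) : Dfn r P fun ρ => R ρ → S ρ :=
  (h.and h'.not).not.congr fun ρ => by tauto

theorem iff (h : Dfn r P R) (h' : Dfn r P S) : Dfn r P fun ρ => R ρ ↔ S ρ :=
  ((h.imp h').and (h'.imp h)).congr fun ρ => by tauto

theorem const (c : Prop) : Dfn r P fun _ : Env A => c := by
  by_cases hc : c
  · exact ((mem 0 0).imp (mem 0 0)).congr fun ρ => by tauto
  · exact ((mem 0 0).and (mem 0 0).not).congr fun ρ => by tauto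

theorem ren (f g : ℕ → ℕ) (h : Dfn r P R) : Dfn r P fun ρ => R (ρ.ren f g) := by
  obtain ⟨E, hE⟩ := h
  obtain ⟨E', hE'⟩ := E.exists_ren (r := r) (P := P) f g
  exact ⟨E', fun ρ => (hE' ρ).trans (hE _)⟩

theorem ex1 (i : ℕ) {R : A → Env A → Prop} (h : Dfn r P fun ρ => R (ρ.v i) ρ)
    (hi : ∀ a b ρ, R a (ρ.setv i b) ↔ R a ρ) : Dfn r P fun ρ => ∃ a, R a ρ := by
  obtain ⟨E, hE⟩ := h
  refine ⟨.ex1 i E, fun ρ => exists_congr fun a => (hE _).trans ?_⟩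
  dsimp only
  rw [Env.setv_v_self]
  exact hi a a ρ

theorem ex2 (j : ℕ) {R : Set A → Env A → Prop} (h : Dfn r P fun ρ => R (ρ.V j) ρ)
    (hi : ∀ a b ρ, R a (ρ.setV j b) ↔ R a ρ) : Dfn r P fun ρ => ∃ a, R a ρ := by
  obtain ⟨E, hE⟩ := h
  refine ⟨.ex2 j E, fun ρ => exists_congr fun a => (hE _).trans ?_⟩
  dsimp only
  rw [Env.setV_V_self]
  exact hi a a ρ

theorem all1 (i : ℕ) {R : A → Env A → Prop} (h : Dfn r P fun ρ => R (ρ.v i) ρ)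
    (hi : ∀ a b ρ, R a (ρ.setv i b) ↔ R a ρ) : Dfn r P fun ρ => ∀ a, R a ρ :=
  (ex1 i (R := fun a ρ => ¬ R a ρ) h.not fun a b ρ => not_congr (hi a b ρ)).not.congr
    fun ρ => by simp

theorem all2 (j : ℕ) {R : Set A → Env A → Prop} (h : Dfn r P fun ρ => R (ρ.V j) ρ)
    (hi : ∀ a b ρ, R a (ρ.setV j b) ↔ R a ρ) : Dfn r P fun ρ => ∀ a, R a ρ :=
  (ex2 j (R := fun a ρ => ¬ R a ρ) h.not fun a b ρ => not_congr (hi a b ρ)).not.congr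
    fun ρ => by simp

theorem exists_finite {ι : Type*} [Finite ι] {R : ι → Env A → Prop} (h : ∀ i, Dfn r P (R i)) :
    Dfn r P fun ρ => ∃ i, R i ρ := by
  classical
  have := Fintype.ofFinite ι
  have key : ∀ s : Finset ι, Dfn r P fun ρ => ∃ i ∈ s, R i ρ := fun s => by
    induction s using Finset.induction_on with
    | empty => exact (const False).congr fun ρ => by simp
    | insert a s _ ih => exact ((h a).or ih).congr fun ρ => by simp
  exact (key Finset.univ).congr fun ρ => by simp

theorem forall_finite {ι : Type*} [Finite ι] {R : ι → Env A → Prop} (h : ∀ i, Dfn r P (R i)) :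
    Dfn r P fun ρ => ∀ i, R i ρ :=
  (exists_finite fun i => (h i).not).not.congr fun ρ => by simp

theorem eq (i j : ℕ) : Dfn r P fun ρ => ρ.v i = ρ.v j := by
  refine (all2 (R := fun S ρ => ρ.v i ∈ S → ρ.v j ∈ S) 0 ((mem i 0).imp (mem j 0))
    fun _ _ _ => Iff.rfl).congr fun ρ => ?_
  exact ⟨fun h => (h {ρ.v i} rfl).symm, fun h S hS => h ▸ hS⟩

/-- Two variables of a binary relation may be renamed. -/
theorem rel_ren {R : A → A → Prop} (h : Dfn r P fun ρ => R (ρ.v 0) (ρ.v 1)) (i j : ℕ) :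
    Dfn r P fun ρ => R (ρ.v i) (ρ.v j) :=
  h.ren (fun k => if k = 0 then i else j) id

theorem setProp_ren {R : Set A → Prop} (h : Dfn r P fun ρ => R (ρ.V 0)) (j : ℕ) :
    Dfn r P fun ρ => R (ρ.V j) :=
  h.ren id (fun _ => j)

theorem elemProp_ren {R : A → Prop} (h : Dfn r P fun ρ => R (ρ.v 0)) (j : ℕ) :
    Dfn r P fun ρ => R (ρ.v j) :=
  h.ren (fun _ => j) id

end Dfn

/-! ## Closing contexts -/

/-- Quantify existentially over lists of variables. -/
def Ctx.exList (l₁ l₂ : List ℕ) (E : Ctx n) : Ctx n :=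
  l₁.foldr Ctx.ex1 (l₂.foldr Ctx.ex2 E)

theorem Ctx.fv_exList (p q : MSO n) (l₁ l₂ : List ℕ) (E : Ctx n) :
    fv1 ((E.exList l₁ l₂).fill p q) = fv1 (E.fill p q) \ l₁.toFinset ∧
    fv2 ((E.exList l₁ l₂).fill p q) = fv2 (E.fill p q) \ l₂.toFinset := by
  have h2 : fv1 ((l₂.foldr Ctx.ex2 E).fill p q) = fv1 (E.fill p q) ∧
      fv2 ((l₂.foldr Ctx.ex2 E).fill p q) = fv2 (E.fill p q) \ l₂.toFinset := by
    induction l₂ with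
    | nil => simp
    | cons a l ih =>
      refine ⟨ih.1, ?_⟩
      simp only [List.foldr_cons, fill, fv2, ih.2]
      ext x; simp; tauto
  induction l₁ with
  | nil => simpa [exList] using h2
  | cons a l ih =>
    refine ⟨?_, ih.2⟩
    simp only [exList] at ih
    simp only [exList, List.foldr_cons, fill, fv1, ih.1]
    ext x; simp; tauto

theorem Ctx.holds_exList [Nonempty A] {R : Env A → Prop} (l₁ l₂ : List ℕ) {E : Ctx n}
    (hE : ∀ ρ, E.Holds r P ρ ↔ R ρ) (h₁ : ∀ i ∈ l₁, ∀ ρ a, R (ρ.setv i a) ↔ R ρ)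
    (h₂ : ∀ i ∈ l₂, ∀ ρ a, R (ρ.setV i a) ↔ R ρ) (ρ : Env A) :
    (E.exList l₁ l₂).Holds r P ρ ↔ R ρ := by
  have h2 : ∀ ρ, (l₂.foldr Ctx.ex2 E).Holds r P ρ ↔ R ρ := by
    induction l₂ with
    | nil => exact hE
    | cons a l ih =>
      intro ρ
      have ih := ih fun i hi => h₂ i (List.mem_cons_of_mem _ hi)
      simp [Holds, ih, h₂ a List.mem_cons_self]
  induction l₁ generalizing ρ with
  | nil => exact h2 ρ
  | cons a l ih =>
    have ih := ih fun i hi => h₁ i (List.mem_cons_of_mem _ hi)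
    simp only [exList] at ih
    simp [exList, Holds, ih, h₁ a List.mem_cons_self]

theorem Dfn.exists_ctx [Nonempty A] {R : (Set A → Prop) → (A → Set A → Prop) → Set A → Prop}
    (h : Dfn r P fun ρ => R ρ.p ρ.t (ρ.V 0)) :
    ∃ E : Ctx n, ∀ p q, SetFormula p → PointFormula q → SetFormula (E.fill p q) ∧
      ∀ X, SetProp r P (E.fill p q) X ↔ R (SetProp r P p) (PointProp r P q) X := by
  obtain ⟨E, hE⟩ := h
  obtain ⟨N, hN⟩ := E.exists_bound
  let l₂ := (List.range N).filter (· ≠ 0)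
  refine ⟨E.exList (List.range N) l₂, fun p q hp hq => ?_⟩
  have hg : SetFormula ((E.exList (List.range N) l₂).fill p q) := by
    obtain ⟨h1, h2⟩ := Ctx.fv_exList p q (List.range N) l₂ E
    obtain ⟨b1, b2⟩ := hN p q hp hq
    constructor
    · rw [h1, Finset.sdiff_eq_empty_iff_subset]
      intro x hx
      simpa using b1 hx
    · rw [h2]
      intro x hx
      have := @b2 x
      simp [l₂] at hx this ⊢
      tauto
  refine ⟨hg, fun X => ?_⟩
  obtain ⟨a⟩ := ‹Nonempty A›
  have := hg.sat_iff (r := r) (P := P) (fun _ => a) (fun _ => X)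
  rw [← this, Ctx.sat_fill hp hq, Ctx.holds_exList _ _ hE]
  · exact fun _ _ _ _ => Iff.rfl
  · intro i hi ρ S
    have : 0 ≠ i := by simp [l₂] at hi; tauto
    rw [Env.setV_V_ne _ _ this]
    rfl

theorem Dfn.exists_setFormula [Nonempty A] {R : Set A → Prop} (h : Dfn r P fun ρ => R (ρ.V 0)) :
    ∃ p, SetFormula p ∧ ∀ X, SetProp r P p X ↔ R X := by
  obtain ⟨E, hE⟩ := Dfn.exists_ctx (R := fun _ _ X => R X) h
  have hp : SetFormula (n := n) (.ex1 0 (.lt 0 0)) := by simp [SetFormula, fv1, fv2]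
  have hq : PointFormula (n := n) (.lt 0 0) := by simp [PointFormula, fv1, fv2]
  exact ⟨_, hE _ _ hp hq⟩

theorem Dfn.exists_pointFormula [Nonempty A] {R : A → Set A → Prop}
    (h : Dfn r P fun ρ => R (ρ.v 0) (ρ.V 0)) :
    ∃ q, PointFormula q ∧ ∀ a X, PointProp r P q a X ↔ R a X := by
  have hp : SetFormula (n := n) (.ex1 0 (.lt 0 0)) := by simp [SetFormula, fv1, fv2]
  have hq : PointFormula (n := n) (.lt 0 0) := by simp [PointFormula, fv1, fv2]
  obtain ⟨E, hE⟩ := h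
  obtain ⟨N, hN⟩ := E.exists_bound
  obtain ⟨b1, b2⟩ := hN _ _ hp hq
  let l := (List.range N).filter (· ≠ 0)
  obtain ⟨h1, h2⟩ := Ctx.fv_exList (.ex1 0 (.lt 0 0)) (.lt 0 0) l l E
  have hg : PointFormula ((E.exList l l).fill (.ex1 0 (.lt 0 0)) (.lt 0 0)) := by
    constructor
    · rw [h1]
      intro x hx
      have := @b1 x
      simp [l] at hx this ⊢
      tauto
    · rw [h2]
      intro x hx
      have := @b2 x
      simp [l] at hx this ⊢
      tauto
  refine ⟨_, hg, fun a X => ?_⟩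
  have := hg.sat_iff (r := r) (P := P) (fun _ => a) (fun _ => X)
  rw [← this, Ctx.sat_fill hp hq, Ctx.holds_exList _ _ hE]
  · intro i hi ρ S
    have : 0 ≠ i := by simp [l] at hi; tauto
    rw [Env.setv_v_ne _ _ this]
    rfl
  · intro i hi ρ S
    have : 0 ≠ i := by simp [l] at hi; tauto
    rw [Env.setV_V_ne _ _ this]
    rfl

end

section

/-! ## Finite types of labelled orders -/

/-- Type of the `k`-types of structures with predicates indexed by `ι`. -/
def Ty : ℕ → Type → Type
  | 0, ι => (ι → ι → Prop) × (ι → ι → Prop)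
  | k + 1, ι => ((ι → ι → Prop) × (ι → ι → Prop)) × Set (Ty k (Option ι))

instance Ty.finite : ∀ (k : ℕ) (ι : Type) [Finite ι], Finite (Ty k ι)
  | 0, ι, _ => inferInstanceAs (Finite ((ι → ι → Prop) × (ι → ι → Prop)))
  | k + 1, ι, _ =>
    have := Ty.finite k (Option ι)
    inferInstanceAs (Finite (((ι → ι → Prop) × (ι → ι → Prop)) × Set (Ty k (Option ι))))

/-- The quantifier-free part of a type. -/
def Ty.atom : ∀ {k : ℕ} {ι : Type}, Ty k ι → (ι → ι → Prop) × (ι → ι → Prop)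
  | 0, _, t => t
  | _ + 1, _, t => t.1

variable {A A' : Type} {r : A → A → Prop} {r' : A' → A' → Prop} {ι : Type}

/-- Extend a family of sets by one set. -/
def ext (W : ι → Set A) (U : Set A) : Option ι → Set A := fun o => o.elim U W

@[simp] theorem ext_none (W : ι → Set A) (U : Set A) : ext W U none = U := rfl

@[simp] theorem ext_some (W : ι → Set A) (U : Set A) (i : ι) : ext W U (some i) = W i := rfl

theorem ext_congr {W : ι → Set A} {U U' B : Set A} (h : ∀ x ∈ B, x ∈ U ↔ x ∈ U') :
    ∀ i, ∀ x ∈ B, x ∈ ext W U i ↔ x ∈ ext W U' i := by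
  rintro (_ | i) x hx
  · exact h x hx
  · rfl

/-- The quantifier-free information about the family `W` restricted to `B`. -/
def atp (r : A → A → Prop) (B : Set A) (W : ι → Set A) : (ι → ι → Prop) × (ι → ι → Prop) :=
  (fun i j => ∃ x ∈ B, x ∈ W i ∧ x ∈ W j,
    fun i j => ∃ x ∈ B, ∃ y ∈ B, x ∈ W i ∧ y ∈ W j ∧ r x y)

/-- The `k`-type of the structure with domain `B` and predicates `W`. -/
def tp (r : A → A → Prop) : ∀ (k : ℕ) {ι : Type}, Set A → (ι → Set A) → Ty k ι
  | 0, _, B, W => atp r B W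
  | k + 1, _, B, W => (atp r B W, Set.range fun U => tp r k B (ext W U))

theorem atom_tp (k : ℕ) (B : Set A) (W : ι → Set A) : (tp r k B W).atom = atp r B W := by
  cases k <;> rfl

theorem tp_succ_eq_iff {k : ℕ} {B : Set A} {W : ι → Set A} {B' : Set A'} {W' : ι → Set A'} :
    tp r (k + 1) B W = tp r' (k + 1) B' W' ↔ atp r B W = atp r' B' W' ∧
      (∀ U, ∃ U', tp r k B (ext W U) = tp r' k B' (ext W' U')) ∧
      (∀ U', ∃ U, tp r k B (ext W U) = tp r' k B' (ext W' U')) := by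
  constructor
  · intro h
    obtain ⟨h1, h2⟩ := Prod.ext_iff.1 h
    refine ⟨h1, fun U => ?_, fun U' => ?_⟩
    · have : tp r k B (ext W U) ∈ (tp r' (k + 1) B' W').2 := h2 ▸ ⟨U, rfl⟩
      obtain ⟨U', h⟩ := this
      exact ⟨U', h.symm⟩
    · have : tp r' k B' (ext W' U') ∈ (tp r (k + 1) B W).2 := h2 ▸ ⟨U', rfl⟩
      exact this
  · rintro ⟨h1, h2, h3⟩
    refine Prod.ext h1 (Set.ext fun t => ⟨?_, ?_⟩)
    · rintro ⟨U, rfl⟩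
      obtain ⟨U', h⟩ := h2 U
      exact ⟨U', h.symm⟩
    · rintro ⟨U', rfl⟩
      exact h3 U'

theorem tp_congr (k : ℕ) : ∀ {ι : Type} {B : Set A} {W W' : ι → Set A},
    (∀ i, ∀ x ∈ B, x ∈ W i ↔ x ∈ W' i) → tp r k B W = tp r k B W' := by
  have hat : ∀ {ι : Type} {B : Set A} {W W' : ι → Set A},
      (∀ i, ∀ x ∈ B, x ∈ W i ↔ x ∈ W' i) → atp r B W = atp r B W' := by
    intro ι B W W' h
    refine Prod.ext ?_ ?_
    · funext i j
      refine propext (exists_congr fun x => and_congr_right fun hx => ?_)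
      rw [h i x hx, h j x hx]
    · funext i j
      refine propext (exists_congr fun x => and_congr_right fun hx => exists_congr fun y =>
        and_congr_right fun hy => ?_)
      rw [h i x hx, h j y hy]
  induction k with
  | zero => exact hat
  | succ k ih =>
    intro ι B W W' h
    refine tp_succ_eq_iff.2 ⟨hat h, fun U => ⟨U, ih ?_⟩, fun U => ⟨U, ih ?_⟩⟩ <;>
    · rintro (_ | i) x hx
      · rfl
      · exact h i x hx

/-- The type of a sum of structures is determined by the types of the summands. -/
theorem tp_iUnion {I : Type*} (k : ℕ) {B : I → Set A} {B' : I → Set A'}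
    (hB : ∀ i j x, x ∈ B i → x ∈ B j → i = j) (hB' : ∀ i j x, x ∈ B' i → x ∈ B' j → i = j)
    (hr : ∀ i j, i ≠ j → ∀ x ∈ B i, ∀ y ∈ B j, ∀ x' ∈ B' i, ∀ y' ∈ B' j, r x y ↔ r' x' y') :
    ∀ {ι : Type} {W : ι → Set A} {W' : ι → Set A'},
    (∀ i, tp r k (B i) W = tp r' k (B' i) W') →
    tp r k (⋃ i, B i) W = tp r' k (⋃ i, B' i) W' := by
  have hat : ∀ {ι : Type} {W : ι → Set A} {W' : ι → Set A'},
      (∀ i, atp r (B i) W = atp r' (B' i) W') →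
      atp r (⋃ i, B i) W = atp r' (⋃ i, B' i) W' := by
    intro ι W W' h
    have h1 : ∀ i a b, (∃ x ∈ B i, x ∈ W a ∧ x ∈ W b) ↔ ∃ x ∈ B' i, x ∈ W' a ∧ x ∈ W' b :=
      fun i a b => iff_of_eq (congrFun (congrFun (Prod.ext_iff.1 (h i)).1 a) b)
    have h2 : ∀ i a b, (∃ x ∈ B i, ∃ y ∈ B i, x ∈ W a ∧ y ∈ W b ∧ r x y) ↔
        ∃ x ∈ B' i, ∃ y ∈ B' i, x ∈ W' a ∧ y ∈ W' b ∧ r' x y :=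
      fun i a b => iff_of_eq (congrFun (congrFun (Prod.ext_iff.1 (h i)).2 a) b)
    refine Prod.ext (funext fun a => funext fun b => propext ⟨?_, ?_⟩)
      (funext fun a => funext fun b => propext ⟨?_, ?_⟩)
    · rintro ⟨x, hx, hxa, hxb⟩
      obtain ⟨i, hi⟩ := Set.mem_iUnion.1 hx
      obtain ⟨x', hi', hxa', hxb'⟩ := (h1 i a b).1 ⟨x, hi, hxa, hxb⟩
      exact ⟨x', Set.mem_iUnion.2 ⟨i, hi'⟩, hxa', hxb'⟩
    · rintro ⟨x, hx, hxa, hxb⟩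
      obtain ⟨i, hi⟩ := Set.mem_iUnion.1 hx
      obtain ⟨x', hi', hxa', hxb'⟩ := (h1 i a b).2 ⟨x, hi, hxa, hxb⟩
      exact ⟨x', Set.mem_iUnion.2 ⟨i, hi'⟩, hxa', hxb'⟩
    · rintro ⟨x, hx, y, hy, hxa, hyb, hxy⟩
      obtain ⟨i, hi⟩ := Set.mem_iUnion.1 hx
      obtain ⟨j, hj⟩ := Set.mem_iUnion.1 hy
      by_cases hij : i = j
      · subst hij
        obtain ⟨x', hx', y', hy', h⟩ := (h2 i a b).1 ⟨x, hi, y, hj, hxa, hyb, hxy⟩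
        exact ⟨x', Set.mem_iUnion.2 ⟨i, hx'⟩, y', Set.mem_iUnion.2 ⟨i, hy'⟩, h⟩
      · obtain ⟨x', hx', hxa', -⟩ := (h1 i a a).1 ⟨x, hi, hxa, hxa⟩
        obtain ⟨y', hy', hyb', -⟩ := (h1 j b b).1 ⟨y, hj, hyb, hyb⟩
        exact ⟨x', Set.mem_iUnion.2 ⟨i, hx'⟩, y', Set.mem_iUnion.2 ⟨j, hy'⟩, hxa', hyb',
          (hr i j hij x hi y hj x' hx' y' hy').1 hxy⟩
    · rintro ⟨x, hx, y, hy, hxa, hyb, hxy⟩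
      obtain ⟨i, hi⟩ := Set.mem_iUnion.1 hx
      obtain ⟨j, hj⟩ := Set.mem_iUnion.1 hy
      by_cases hij : i = j
      · subst hij
        obtain ⟨x', hx', y', hy', h⟩ := (h2 i a b).2 ⟨x, hi, y, hj, hxa, hyb, hxy⟩
        exact ⟨x', Set.mem_iUnion.2 ⟨i, hx'⟩, y', Set.mem_iUnion.2 ⟨i, hy'⟩, h⟩
      · obtain ⟨x', hx', hxa', -⟩ := (h1 i a a).2 ⟨x, hi, hxa, hxa⟩
        obtain ⟨y', hy', hyb', -⟩ := (h1 j b b).2 ⟨y, hj, hyb, hyb⟩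
        exact ⟨x', Set.mem_iUnion.2 ⟨i, hx'⟩, y', Set.mem_iUnion.2 ⟨j, hy'⟩, hxa', hyb',
          (hr i j hij x' hx' y' hy' x hi y hj).2 hxy⟩
  induction k with
  | zero => exact hat
  | succ k ih =>
    intro ι W W' h
    have h' := fun i => tp_succ_eq_iff.1 (h i)
    refine tp_succ_eq_iff.2 ⟨hat fun i => (h' i).1, fun U => ?_, fun U => ?_⟩
    · choose U' hU' using fun i => (h' i).2.1 U
      refine ⟨{x | ∃ i, x ∈ B' i ∧ x ∈ U' i}, ih fun i => (hU' i).trans (tp_congr k ?_)⟩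
      rintro (_ | j) x hx
      · exact ⟨fun hxU => ⟨i, hx, hxU⟩, fun ⟨j, hj, hxU⟩ => hB' i j x hx hj ▸ hxU⟩
      · rfl
    · choose U' hU' using fun i => (h' i).2.2 U
      refine ⟨{x | ∃ i, x ∈ B i ∧ x ∈ U' i}, ih fun i => Eq.trans (tp_congr k ?_) (hU' i)⟩
      rintro (_ | j) x hx
      · exact ⟨fun ⟨j, hj, hxU⟩ => hB i j x hx hj ▸ hxU, fun hxU => ⟨i, hx, hxU⟩⟩
      · rfl

/-! ### The semigroup of types -/

/-- Concatenation of types. -/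
def Ty.conc : ∀ {k : ℕ} {ι : Type}, Ty k ι → Ty k ι → Ty k ι
  | 0, _, s, t => (fun i j => s.1 i j ∨ t.1 i j,
      fun i j => s.2 i j ∨ t.2 i j ∨ (s.1 i i ∧ t.1 j j))
  | k + 1, _, s, t => ((fun i j => s.1.1 i j ∨ t.1.1 i j,
      fun i j => s.1.2 i j ∨ t.1.2 i j ∨ (s.1.1 i i ∧ t.1.1 j j)),
      Set.image2 (Ty.conc (k := k)) s.2 t.2)

theorem Ty.conc_assoc : ∀ {k : ℕ} {ι : Type} (s t u : Ty k ι),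
    (s.conc t).conc u = s.conc (t.conc u)
  | 0, _, s, t, u => by
    refine Prod.ext ?_ ?_ <;>
    · funext i j
      simp only [conc, eq_iff_iff]
      tauto
  | k + 1, _, s, t, u => by
    refine Prod.ext (Prod.ext ?_ ?_) ?_
    · funext i j
      simp only [conc, eq_iff_iff]
      tauto
    · funext i j
      simp only [conc, eq_iff_iff]
      tauto
    · exact Set.image2_assoc fun a b c => Ty.conc_assoc a b c

instance {k : ℕ} {ι : Type} : Semigroup (Ty k ι) where
  mul := Ty.conc
  mul_assoc := Ty.conc_assoc

theorem tp_union {B₁ B₂ : Set A} (h12 : ∀ x ∈ B₁, ∀ y ∈ B₂, r x y)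
    (h21 : ∀ x ∈ B₁, ∀ y ∈ B₂, ¬ r y x) (hd : Disjoint B₁ B₂) (k : ℕ) :
    ∀ {ι : Type} (W : ι → Set A), tp r k (B₁ ∪ B₂) W = tp r k B₁ W * tp r k B₂ W := by
  have h1 : ∀ {ι : Type} (W : ι → Set A) (i j : ι), (atp r (B₁ ∪ B₂) W).1 i j ↔
      (atp r B₁ W).1 i j ∨ (atp r B₂ W).1 i j := by
    intro ι W i j
    simp only [atp, Set.mem_union, or_and_right, exists_or]
  have h2 : ∀ {ι : Type} (W : ι → Set A) (i j : ι), (atp r (B₁ ∪ B₂) W).2 i j ↔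
      (atp r B₁ W).2 i j ∨ (atp r B₂ W).2 i j ∨ ((atp r B₁ W).1 i i ∧ (atp r B₂ W).1 j j) := by
    intro ι W i j
    simp only [atp, Set.mem_union]
    constructor
    · rintro ⟨x, hx | hx, y, hy | hy, hi, hj, hxy⟩
      · exact .inl ⟨x, hx, y, hy, hi, hj, hxy⟩
      · exact .inr (.inr ⟨⟨x, hx, hi, hi⟩, y, hy, hj, hj⟩)
      · exact absurd hxy (h21 y hy x hx)
      · exact .inr (.inl ⟨x, hx, y, hy, hi, hj, hxy⟩)
    · rintro (⟨x, hx, y, hy, h⟩ | ⟨x, hx, y, hy, h⟩ | ⟨⟨x, hx, hi, -⟩, y, hy, hj, -⟩)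
      · exact ⟨x, .inl hx, y, .inl hy, h⟩
      · exact ⟨x, .inr hx, y, .inr hy, h⟩
      · exact ⟨x, .inl hx, y, .inr hy, hi, hj, h12 x hx y hy⟩
  induction k with
  | zero =>
    intro ι W
    exact Prod.ext (funext fun i => funext fun j => propext (h1 W i j))
      (funext fun i => funext fun j => propext (h2 W i j))
  | succ k ih =>
    intro ι W
    refine Prod.ext (Prod.ext (funext fun i => funext fun j => propext (h1 W i j))
      (funext fun i => funext fun j => propext (h2 W i j))) (Set.ext fun t => ⟨?_, ?_⟩)
    · rintro ⟨U, rfl⟩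
      exact ⟨_, ⟨U, rfl⟩, _, ⟨U, rfl⟩, (ih _).symm⟩
    · rintro ⟨_, ⟨U₁, rfl⟩, _, ⟨U₂, rfl⟩, rfl⟩
      refine ⟨(U₁ ∩ B₁) ∪ (U₂ ∩ B₂), (ih _).trans (congrArg₂ Ty.conc ?_ ?_)⟩
      · refine tp_congr k ?_
        rintro (_ | j) x hx
        · have : x ∉ B₂ := Set.disjoint_left.1 hd hx
          simp [hx, this]
        · rfl
      · refine tp_congr k ?_
        rintro (_ | j) x hx
        · have : x ∉ B₁ := Set.disjoint_right.1 hd hx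
          simp [hx, this]
        · rfl

/-! ### Types determine truth -/

variable {n : ℕ} {P : Fin n → Set A}

theorem sat_iff_of_tp_eq (hirr : ∀ x, ¬ r x x) (htri : ∀ x y, r x y ∨ x = y ∨ r y x)
    (φ : MSO n) : ∀ {k : ℕ} {ι : Type} {W W' : ι → Set A} (e₀ : Fin n → ι) (e₁ e₂ : ℕ → ι)
    {v v' : ℕ → A} {V V' : ℕ → Set A}, qd φ ≤ k →
    (∀ i, W (e₀ i) = P i) → (∀ i, W' (e₀ i) = P i) →
    (∀ i, W (e₁ i) = {v i}) → (∀ i, W' (e₁ i) = {v' i}) →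
    (∀ i, W (e₂ i) = V i) → (∀ i, W' (e₂ i) = V' i) →
    tp r k Set.univ W = tp r k Set.univ W' → (Sat r P v V φ ↔ Sat r P v' V' φ) := by
  induction φ with
  | lt i j =>
    intro k ι W W' e₀ e₁ e₂ v v' V V' _ _ _ h1 h1' _ _ ht
    have := congrArg Ty.atom ht
    rw [atom_tp, atom_tp] at this
    have := congrFun (congrFun (Prod.ext_iff.1 this).2 (e₁ i)) (e₁ j)
    simpa [atp, h1, h1', Sat] using this
  | pred p i =>
    intro k ι W W' e₀ e₁ e₂ v v' V V' _ h0 h0' h1 h1' _ _ ht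
    have := congrArg Ty.atom ht
    rw [atom_tp, atom_tp] at this
    have := congrFun (congrFun (Prod.ext_iff.1 this).1 (e₁ i)) (e₀ p)
    simpa [atp, h1, h1', h0, h0', Sat] using this
  | mem i j =>
    intro k ι W W' e₀ e₁ e₂ v v' V V' _ _ _ h1 h1' h2 h2' ht
    have := congrArg Ty.atom ht
    rw [atom_tp, atom_tp] at this
    have := congrFun (congrFun (Prod.ext_iff.1 this).1 (e₁ i)) (e₂ j)
    simpa [atp, h1, h1', h2, h2', Sat] using this
  | not φ ih =>
    intro k ι W W' e₀ e₁ e₂ v v' V V' hk h0 h0' h1 h1' h2 h2' ht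
    exact not_congr (ih e₀ e₁ e₂ hk h0 h0' h1 h1' h2 h2' ht)
  | and φ ψ ih ih' =>
    intro k ι W W' e₀ e₁ e₂ v v' V V' hk h0 h0' h1 h1' h2 h2' ht
    exact and_congr (ih e₀ e₁ e₂ ((le_max_left _ _).trans hk) h0 h0' h1 h1' h2 h2' ht)
      (ih' e₀ e₁ e₂ ((le_max_right _ _).trans hk) h0 h0' h1 h1' h2 h2' ht)
  | ex1 m φ ih =>
    have key : ∀ {k : ℕ} {ι : Type} {W W' : ι → Set A} (e₀ : Fin n → ι) (e₁ e₂ : ℕ → ι)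
        {v v' : ℕ → A} {V V' : ℕ → Set A}, qd φ + 1 ≤ k →
        (∀ i, W (e₀ i) = P i) → (∀ i, W' (e₀ i) = P i) →
        (∀ i, W (e₁ i) = {v i}) → (∀ i, W' (e₁ i) = {v' i}) →
        (∀ i, W (e₂ i) = V i) → (∀ i, W' (e₂ i) = V' i) →
        tp r k Set.univ W = tp r k Set.univ W' →
        (∃ a, Sat r P (Function.update v m a) V φ) →
        ∃ a, Sat r P (Function.update v' m a) V' φ := by
      rintro k ι W W' e₀ e₁ e₂ v v' V V' hk h0 h0' h1 h1' h2 h2' ht ⟨a, ha⟩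
      obtain ⟨k, rfl⟩ : ∃ l, k = l + 1 := ⟨k - 1, by omega⟩
      obtain ⟨U, hU⟩ := (tp_succ_eq_iff.1 ht).2.1 {a}
      have hat := congrArg Ty.atom hU
      rw [atom_tp, atom_tp] at hat
      have hn := congrFun (congrFun (Prod.ext_iff.1 hat).1 none) none
      have hl := congrFun (congrFun (Prod.ext_iff.1 hat).2 none) none
      simp only [atp, ext_none, Set.mem_univ, true_and, Set.mem_singleton_iff, eq_iff_iff] at hn hl
      obtain ⟨b, hb, -⟩ := hn.1 ⟨a, rfl, rfl⟩
      have hUb : U = {b} := by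
        refine Set.eq_singleton_iff_unique_mem.2 ⟨hb, fun c hc => ?_⟩
        by_contra hcb
        have hlt : ∃ x y, x ∈ U ∧ y ∈ U ∧ r x y := by
          rcases htri b c with h | h | h
          · exact ⟨b, c, hb, hc, h⟩
          · exact absurd h.symm hcb
          · exact ⟨c, b, hc, hb, h⟩
        obtain ⟨x, y, rfl, rfl, hxy⟩ := hl.2 hlt
        exact hirr _ hxy
      subst hUb
      refine ⟨b, (ih (k := k) (W := ext W {a}) (W' := ext W' {b}) (some ∘ e₀)
        (Function.update (some ∘ e₁) m none) (some ∘ e₂) (by omega) h0 h0' (fun i => ?_)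
        (fun i => ?_) h2 h2' hU).1 ha⟩
      · by_cases him : i = m
        · simp [him]
        · simp [him, h1]
      · by_cases him : i = m
        · simp [him]
        · simp [him, h1']
    intro k ι W W' e₀ e₁ e₂ v v' V V' hk h0 h0' h1 h1' h2 h2' ht
    exact ⟨key e₀ e₁ e₂ hk h0 h0' h1 h1' h2 h2' ht,
      key e₀ e₁ e₂ hk h0' h0 h1' h1 h2' h2 ht.symm⟩
  | ex2 m φ ih =>
    have key : ∀ {k : ℕ} {ι : Type} {W W' : ι → Set A} (e₀ : Fin n → ι) (e₁ e₂ : ℕ → ι)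
        {v v' : ℕ → A} {V V' : ℕ → Set A}, qd φ + 1 ≤ k →
        (∀ i, W (e₀ i) = P i) → (∀ i, W' (e₀ i) = P i) →
        (∀ i, W (e₁ i) = {v i}) → (∀ i, W' (e₁ i) = {v' i}) →
        (∀ i, W (e₂ i) = V i) → (∀ i, W' (e₂ i) = V' i) →
        tp r k Set.univ W = tp r k Set.univ W' →
        (∃ a, Sat r P v (Function.update V m a) φ) →
        ∃ a, Sat r P v' (Function.update V' m a) φ := by
      rintro k ι W W' e₀ e₁ e₂ v v' V V' hk h0 h0' h1 h1' h2 h2' ht ⟨U, ha⟩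
      obtain ⟨k, rfl⟩ : ∃ l, k = l + 1 := ⟨k - 1, by omega⟩
      obtain ⟨U', hU⟩ := (tp_succ_eq_iff.1 ht).2.1 U
      refine ⟨U', (ih (k := k) (W := ext W U) (W' := ext W' U') (some ∘ e₀) (some ∘ e₁)
        (Function.update (some ∘ e₂) m none) (by omega) h0 h0' h1 h1' (fun i => ?_)
        (fun i => ?_) hU).1 ha⟩
      · by_cases him : i = m
        · simp [him]
        · simp [him, h2]
      · by_cases him : i = m
        · simp [him]
        · simp [him, h2']
    intro k ι W W' e₀ e₁ e₂ v v' V V' hk h0 h0' h1 h1' h2 h2' ht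
    exact ⟨key e₀ e₁ e₂ hk h0 h0' h1 h1' h2 h2' ht,
      key e₀ e₁ e₂ hk h0' h0 h1' h1 h2' h2 ht.symm⟩

theorem setProp_iff_of_tp_eq [Nonempty A] (hirr : ∀ x, ¬ r x x)
    (htri : ∀ x y, r x y ∨ x = y ∨ r y x) {φ : MSO n} (hφ : SetFormula φ) {X X' : Set A}
    (h : tp r (qd φ + 2) Set.univ (ext P X) = tp r (qd φ + 2) Set.univ (ext P X')) :
    SetProp r P φ X ↔ SetProp r P φ X' := by
  obtain ⟨a⟩ := ‹Nonempty A›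
  let e₂ : ℕ → Option (Option (Option (Fin n))) := fun _ => some (some none)
  obtain ⟨U, hU⟩ := (tp_succ_eq_iff.1 h).2.1 ∅
  obtain ⟨T, hT⟩ := (tp_succ_eq_iff.1 hU).2.1 {a}
  have hat := congrArg Ty.atom hT
  rw [atom_tp, atom_tp] at hat
  have hn := congrFun (congrFun (Prod.ext_iff.1 hat).1 none) none
  have hl := congrFun (congrFun (Prod.ext_iff.1 hat).2 none) none
  simp only [atp, ext_none, Set.mem_univ, true_and, Set.mem_singleton_iff, eq_iff_iff] at hn hl
  obtain ⟨b, hb, -⟩ := hn.1 ⟨a, rfl, rfl⟩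
  have hTb : T = {b} := by
    refine Set.eq_singleton_iff_unique_mem.2 ⟨hb, fun c hc => ?_⟩
    by_contra hcb
    have hlt : ∃ x y, x ∈ T ∧ y ∈ T ∧ r x y := by
      rcases htri b c with h | h | h
      · exact ⟨b, c, hb, hc, h⟩
      · exact absurd h.symm hcb
      · exact ⟨c, b, hc, hb, h⟩
    obtain ⟨x, y, rfl, rfl, hxy⟩ := hl.2 hlt
    exact hirr _ hxy
  subst hTb
  have := sat_iff_of_tp_eq (P := P) hirr htri φ (fun i => some (some (some i)))
    (fun _ => none) e₂ (v := fun _ => a) (v' := fun _ => b) (V := fun _ => X) (V' := fun _ => X')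
    le_rfl (fun _ => rfl) (fun _ => rfl) (fun _ => rfl) (fun _ => rfl) (fun _ => rfl)
    (fun _ => rfl) hT
  rwa [hφ.sat_iff, hφ.sat_iff] at this

/-! ### Definability of types -/

/-- The value of a predicate symbol or of a set variable. -/
def val (P : Fin n → Set A) (ρ : Env A) : Fin n ⊕ ℕ → Set A := Sum.elim P ρ.V

theorem Dfn.mem_val (i : ℕ) (s : Fin n ⊕ ℕ) : Dfn r P fun ρ => ρ.v i ∈ val P ρ s := by
  cases s with
  | inl k => exact Dfn.pred k i
  | inr j => exact Dfn.mem i j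

theorem Dfn.tp_eq (k b : ℕ) : ∀ {ι : Type} [Finite ι] (e : ι → Fin n ⊕ ℕ) (t : Ty k ι),
    Dfn r P fun ρ => tp r k (ρ.V b) (fun i => val P ρ (e i)) = t := by
  have hat : ∀ {ι : Type} [Finite ι] (e : ι → Fin n ⊕ ℕ) (t : (ι → ι → Prop) × (ι → ι → Prop)),
      Dfn r P fun ρ => atp r (ρ.V b) (fun i => val P ρ (e i)) = t := by
    intro ι _ e t
    have h1 : ∀ i j, Dfn r P fun ρ =>
        (∃ x, x ∈ ρ.V b ∧ x ∈ val P ρ (e i) ∧ x ∈ val P ρ (e j)) ↔ t.1 i j := fun i j =>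
      (Dfn.ex1 (R := fun x ρ => x ∈ ρ.V b ∧ x ∈ val P ρ (e i) ∧ x ∈ val P ρ (e j)) 0
        ((Dfn.mem 0 b).and ((Dfn.mem_val 0 _).and (Dfn.mem_val 0 _)))
        fun _ _ _ => Iff.rfl).iff (Dfn.const _)
    have h2 : ∀ i j, Dfn r P fun ρ =>
        (∃ x, x ∈ ρ.V b ∧ ∃ y, y ∈ ρ.V b ∧ x ∈ val P ρ (e i) ∧ y ∈ val P ρ (e j) ∧ r x y) ↔
          t.2 i j := fun i j => by
      refine Dfn.iff (Dfn.ex1 0 ((Dfn.mem 0 b).and (Dfn.ex1 (R := fun y ρ => y ∈ ρ.V b ∧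
        ρ.v 0 ∈ val P ρ (e i) ∧ y ∈ val P ρ (e j) ∧ r (ρ.v 0) y) 1 ((Dfn.mem 1 b).and
          ((Dfn.mem_val 0 _).and ((Dfn.mem_val 1 _).and (Dfn.rel 0 1)))) ?_)) ?_) (Dfn.const _)
      · exact fun _ _ _ => Iff.rfl
      · exact fun _ _ _ => Iff.rfl
    refine ((Dfn.forall_finite fun i => Dfn.forall_finite fun j => h1 i j).and
      (Dfn.forall_finite fun i => Dfn.forall_finite fun j => h2 i j)).congr fun ρ => ?_
    simp only [Prod.ext_iff, funext_iff, eq_iff_iff]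
    rfl
  induction k with
  | zero => exact hat
  | succ k ih =>
    intro ι _ e t
    have := Fintype.ofFinite ι
    classical
    obtain ⟨m, hm⟩ := Infinite.exists_notMem_finset
      (insert b ((Finset.univ : Finset ι).image fun i => (e i).elim (fun _ => 0) id))
    simp only [Finset.mem_insert, Finset.mem_image, Finset.mem_univ, true_and, not_or,
      not_exists] at hm
    have hval : ∀ i ρ S, val P (Env.setV ρ m S) (e i) = val P ρ (e i) := fun i ρ S => by
      have := hm.2 i
      cases hei : e i with
      | inl k => rfl
      | inr j =>
        rw [hei] at this
        exact Env.setV_V_ne _ _ this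
    have h2 : ∀ s : Ty k (Option ι), Dfn r P fun ρ =>
        ((∃ U, tp r k (ρ.V b) (ext (fun i => val P ρ (e i)) U) = s) ↔ s ∈ t.2) := fun s => by
      refine Dfn.iff (Dfn.ex2 m ?_ ?_) (Dfn.const _)
      · refine (ih (fun o => o.elim (Sum.inr m) e) s).congr fun ρ => ?_
        have : (fun i : Option ι => val P ρ (i.elim (Sum.inr m) e)) =
            ext (fun i => val P ρ (e i)) (ρ.V m) := by
          funext o; cases o <;> rfl
        rw [this]
      · intro U S ρ
        simp only [hval, Env.setV_V_ne ρ S (Ne.symm hm.1)]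
    refine ((hat e t.1).and (Dfn.forall_finite h2)).congr fun ρ => ?_
    exact ⟨fun h => Prod.ext h.1 (Set.ext h.2), fun h => ⟨congrArg Prod.fst h,
      fun s => Set.ext_iff.1 (congrArg Prod.snd h) s⟩⟩

/-- A property of types of definable structures is definable. -/
theorem Dfn.of_eq₂ {τ τ' : Type*} [Finite τ] [Finite τ'] {T : Env A → τ} {T' : Env A → τ'}
    (h : ∀ t, Dfn r P fun ρ => T ρ = t) (h' : ∀ t, Dfn r P fun ρ => T' ρ = t)
    (Φ : τ → τ' → Prop) : Dfn r P fun ρ => Φ (T ρ) (T' ρ) :=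
  (Dfn.exists_finite fun t => Dfn.exists_finite fun t' =>
    ((h t).and (h' t')).and (Dfn.const (Φ t t'))).congr fun ρ => by simp

end

section

variable {n : ℕ} {A : Type} [LinearOrder A] {r : A → A → Prop} {P : Fin n → Set A}

/-! ## Definability over linear orders -/

/-- The relation `r` is the strict order or its converse. -/
def Compat (r : A → A → Prop) : Prop := (∀ x y, r x y ↔ x < y) ∨ ∀ x y, r x y ↔ y < x

theorem Compat.irrefl (hr : Compat r) (x : A) : ¬ r x x := by
  rcases hr with h | h <;> simp [h]

theorem Compat.trichotomy (hr : Compat r) (x y : A) : r x y ∨ x = y ∨ r y x := by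
  rcases hr with h | h <;> simp only [h]
  · exact lt_trichotomy x y
  · rcases lt_trichotomy x y with h | h | h <;> simp [h]

theorem Compat.dual (hr : Compat r) : Compat (A := Aᵒᵈ) r := hr.symm

namespace Dfn

theorem lt (hr : Compat r) (i j : ℕ) : Dfn r P fun ρ => ρ.v i < ρ.v j := by
  rcases hr with h | h
  · exact (rel i j).congr fun ρ => h _ _
  · exact (rel j i).congr fun ρ => h _ _

theorem le (hr : Compat r) (i j : ℕ) : Dfn r P fun ρ => ρ.v i ≤ ρ.v j :=
  (lt hr j i).not.congr fun _ => not_lt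

end Dfn

theorem finite_iff_min_max (S : Set A) : S.Finite ↔ ∀ T : Set A, (∀ x, x ∈ T → x ∈ S) →
    (∃ x, x ∈ T) → (∃ x, x ∈ T ∧ ∀ y, y ∈ T → x ≤ y) ∧ (∃ x, x ∈ T ∧ ∀ y, y ∈ T → y ≤ x) := by
  constructor
  · intro hS T hT hne
    have hf : T.Finite := hS.subset hT
    exact ⟨Set.exists_min_image T id hf hne, Set.exists_max_image T id hf hne⟩
  · intro h
    have hw : WellFoundedLT S := by
      refine ⟨WellFounded.wellFounded_iff_has_min.2 fun T hT => ?_⟩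
      obtain ⟨⟨x, hx, hmin⟩, -⟩ := h (Subtype.val '' T) (by rintro _ ⟨x, -, rfl⟩; exact x.2)
        (by obtain ⟨x, hx⟩ := hT; exact ⟨x, x, hx, rfl⟩)
      obtain ⟨x, hx, rfl⟩ := hx
      exact ⟨x, hx, fun y hy => not_lt.2 (hmin y ⟨y, hy, rfl⟩)⟩
    have hg : WellFoundedGT S := by
      refine ⟨WellFounded.wellFounded_iff_has_min.2 fun T hT => ?_⟩
      obtain ⟨-, ⟨x, hx, hmin⟩⟩ := h (Subtype.val '' T) (by rintro _ ⟨x, -, rfl⟩; exact x.2)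
        (by obtain ⟨x, hx⟩ := hT; exact ⟨x, x, hx, rfl⟩)
      obtain ⟨x, hx, rfl⟩ := hx
      exact ⟨x, hx, fun y hy => not_lt.2 (hmin y ⟨y, hy, rfl⟩)⟩
    have := Finite.of_wellFoundedLT_wellFoundedGT S
    exact S.toFinite

theorem Dfn.finite (hr : Compat r) (j : ℕ) : Dfn r P fun ρ => (ρ.V j).Finite := by
  have : Dfn r P fun ρ => (ρ.V 0).Finite := by
    refine Dfn.congr (R := _) ?_ fun ρ => (finite_iff_min_max (ρ.V 0)).symm
    refine Dfn.all2 1 ?_ fun _ _ _ => Iff.rfl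
    refine Dfn.imp (Dfn.all1 0 ((mem 0 1).imp (mem 0 0)) fun _ _ _ => Iff.rfl) ?_
    refine Dfn.imp (Dfn.ex1 0 (mem 0 1) fun _ _ _ => Iff.rfl) ?_
    refine Dfn.and (Dfn.ex1 0 ((mem 0 1).and ?_) fun _ _ _ => Iff.rfl)
      (Dfn.ex1 0 ((mem 0 1).and ?_) fun _ _ _ => Iff.rfl)
    · exact Dfn.all1 1 ((mem 1 1).imp (le hr 0 1)) fun _ _ _ => Iff.rfl
    · exact Dfn.all1 1 ((mem 1 1).imp (le hr 1 0)) fun _ _ _ => Iff.rfl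
  exact this.setProp_ren j

/-- Definability of a property of a definable set. -/
theorem Dfn.of_set {A : Type} {r : A → A → Prop} {P : Fin n → Set A}
    {R : Set A → Prop} {S : Env A → Set A} (i j : ℕ)
    (hR : Dfn r P fun ρ => R (ρ.V 0)) (hS : Dfn r P fun ρ => ρ.v i ∈ S ρ)
    (hi : ∀ ρ b, S (ρ.setv i b) = S ρ) (hj : ∀ ρ b, S (ρ.setV j b) = S ρ) :
    Dfn r P fun ρ => R (S ρ) := by
  refine Dfn.congr (R := fun ρ => ∃ U : Set A, (∀ x, x ∈ U ↔ x ∈ S ρ) ∧ R U) ?_ fun ρ => ?_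
  · refine Dfn.ex2 j (Dfn.and (Dfn.all1 i ((mem i j).iff hS) fun a b ρ => ?_) (hR.setProp_ren j))
      fun a b ρ => ?_
    · rw [hi]; rfl
    · rw [hj]
  · constructor
    · rintro ⟨U, hU, h⟩
      rwa [← Set.ext hU]
    · exact fun h => ⟨_, fun _ => Iff.rfl, h⟩

theorem Dfn.icc_finite (hr : Compat r) (i j : ℕ) :
    Dfn r P fun ρ => (Set.Icc (ρ.v i) (ρ.v j)).Finite := by
  refine Dfn.rel_ren (R := fun x y => (Set.Icc x y).Finite) ?_ i j
  exact Dfn.of_set (S := fun ρ => Set.Icc (ρ.v 0) (ρ.v 1)) 2 0 (Dfn.finite hr 0)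
    ((Dfn.le hr 0 2).and (Dfn.le hr 2 1)) (fun _ _ => rfl) fun _ _ => rfl

/-! ## Finite distance classes -/

/-- Two elements are near if there are finitely many elements between them. -/
def Near (x y : A) : Prop := (Set.Icc x y).Finite ∧ (Set.Icc y x).Finite

theorem Dfn.near (hr : Compat r) (i j : ℕ) : Dfn r P fun ρ => Near (ρ.v i) (ρ.v j) :=
  (Dfn.icc_finite hr i j).and (Dfn.icc_finite hr j i)

theorem Near.refl (x : A) : Near x x := by simp [Near]

theorem Near.symm {x y : A} (h : Near x y) : Near y x := ⟨h.2, h.1⟩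

theorem Near.trans {x y z : A} (h : Near x y) (h' : Near y z) : Near x z := by
  have key : ∀ {x y z : A}, Near x y → Near y z → (Set.Icc x z).Finite := by
    intro x y z h h'
    refine (h.1.union h'.1).subset fun w hw => ?_
    rcases le_total w y with h | h
    · exact .inl ⟨hw.1, h⟩
    · exact .inr ⟨h, hw.2⟩
  exact ⟨key h h', key h'.symm h.symm⟩

theorem near_of_le {x y : A} (hxy : x ≤ y) : Near x y ↔ (Set.Icc x y).Finite := by
  refine ⟨And.left, fun h => ⟨h, ?_⟩⟩
  exact (Set.finite_singleton x).subset fun w hw => le_antisymm (hw.2) (hxy.trans hw.1)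

theorem Near.mid {x y z : A} (h : Near x z) (hxy : x ≤ y) (hyz : y ≤ z) : Near x y :=
  (near_of_le hxy).2 (h.1.subset (Set.Icc_subset_Icc_right hyz))

theorem near_dual {x y : A} : Near (A := Aᵒᵈ) (OrderDual.toDual x) (OrderDual.toDual y) ↔
    Near x y := by
  have : ∀ x y : A, (Set.Icc (OrderDual.toDual x) (OrderDual.toDual y)).Finite ↔
      (Set.Icc y x).Finite := fun x y => by
    have : Set.Icc (OrderDual.toDual x) (OrderDual.toDual y) =
      (Set.Icc y x : Set A) := by ext z; exact and_comm
    rw [this]; rfl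
  unfold Near
  rw [this, this]
  exact and_comm

theorem exists_infinite_class [Infinite A] (hscat : IsEmpty (ℚ ↪o A)) :
    ∃ x : A, {y | Near x y}.Infinite := by
  by_contra! hfin
  let M : Set A := {x | ∀ y, Near x y → x ≤ y}
  have hmin : ∀ x : A, ∃ m ∈ M, Near x m ∧ m ≤ x := fun x => by
    obtain ⟨m, hm, h⟩ := Set.exists_min_image _ id (hfin x) ⟨x, Near.refl x⟩
    exact ⟨m, fun y hy => h y (Near.trans hm hy), hm, h x (Near.refl x)⟩
  have hne : ∀ x y : A, ∃ z, ¬ Near x z ∧ ¬ Near y z := fun x y => by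
    by_contra! h
    exact Set.infinite_univ (((hfin x).union (hfin y)).subset fun z _ =>
      or_iff_not_imp_left.2 (h z))
  have hdense : DenselyOrdered M := by
    refine ⟨fun x y hxy => ?_⟩
    have hxy' : (x : A) < y := hxy
    have hn : ¬ Near (x : A) y := fun h => absurd (y.2 x h.symm) (not_le.2 hxy')
    have hinf : (Set.Icc (x : A) y).Infinite := fun h => hn ((near_of_le hxy'.le).2 h)
    obtain ⟨z, hz, hz'⟩ := (hinf.sdiff ((hfin x).union (hfin y))).nonempty
    simp only [Set.mem_union, Set.mem_ofPred_eq, not_or] at hz'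
    obtain ⟨m, hm, hzm, hmz⟩ := hmin z
    have hxm : (x : A) < m := by
      by_contra! hmx
      exact hz'.1 ((hzm.symm.mid hmx hz.1).symm.trans hzm.symm)
    have hzy : z < y := lt_of_le_of_ne hz.2 fun h => hz'.2 (h ▸ Near.refl _)
    exact ⟨⟨m, hm⟩, hxm, show m < (y : A) from lt_of_le_of_lt hmz hzy⟩
  have hnt : Nontrivial M := by
    obtain ⟨x⟩ : Nonempty A := inferInstance
    obtain ⟨z, hz, -⟩ := hne x x
    obtain ⟨a, ha, hxa, -⟩ := hmin x
    obtain ⟨b, hb, hzb, -⟩ := hmin z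
    refine ⟨⟨⟨a, ha⟩, ⟨b, hb⟩, fun h => hz ?_⟩⟩
    rw [Subtype.mk.injEq] at h
    exact hxa.trans (h ▸ hzb.symm)
  obtain ⟨f⟩ := Order.embedding_from_countable_to_dense ℚ M
  exact hscat.false (f.trans (OrderEmbedding.subtype _))

end

section

/-! ## Iterated definable conditions -/

/-- The conditions obtained by iterating `W` from `Φ` along the requirements `t`. -/
def condSeq {A : Type} (W : (Set A → Prop) → (A → Set A → Prop) → Set A → Prop) (Φ : Set A → Prop)
    (t : ℕ → A → Set A → Prop) : ℕ → Set A → Prop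
  | 0 => Φ
  | k + 1 => W (condSeq W Φ t k) (t k)

theorem exists_undefinable_of_condSeq {n : ℕ} {A : Type} {r : A → A → Prop} {P : Fin n → Set A}
    [Nonempty A] (hirr : ∀ x, ¬ r x x) (htri : ∀ x y, r x y ∨ x = y ∨ r y x)
    {W : (Set A → Prop) → (A → Set A → Prop) → Set A → Prop} {Φ : Set A → Prop}
    (hΦ : Dfn r P fun ρ => Φ (ρ.V 0)) (hW : Dfn r P fun ρ => W ρ.p ρ.t (ρ.V 0))
    (H : ∀ t : ℕ → A → Set A → Prop,
      (∀ R : A → Set A → Prop, (Dfn r P fun ρ => R (ρ.v 0) (ρ.V 0)) → ∃ k, t k = R) →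
      ∃ Q, (∀ k, condSeq W Φ t k Q) ∧ (∀ k, ∃ X, X ≠ Q ∧ condSeq W Φ t k X) ∧
        ∀ K, ∃ k, ∀ X X', condSeq W Φ t k X → condSeq W Φ t k X' →
          tp r K Set.univ (ext P X) = tp r K Set.univ (ext P X')) :
    ∃ Q, ¬ Definable r P Q ∧ TuringRed (TheoryCodes r (Fin.snoc P Q)) (TheoryCodes r P) := by
  obtain ⟨p₀, hp₀, hp₀'⟩ := hΦ.exists_setFormula
  obtain ⟨E, hE⟩ := hW.exists_ctx
  refine exists_undefinable_of_genSeq hp₀ (fun p q hp hq => (hE p q hp hq).1)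
    fun τ hτ hτ' => ?_
  have key : ∀ k, SetFormula (genSeq E p₀ τ k) ∧ SetProp r P (genSeq E p₀ τ k) =
      condSeq W Φ (fun k => PointProp r P (τ k)) k := fun k => by
    induction k with
    | zero => exact ⟨hp₀, funext fun X => propext (hp₀' X)⟩
    | succ k ih =>
      obtain ⟨h1, h2⟩ := hE _ _ ih.1 (hτ k)
      refine ⟨h1, funext fun X => propext ?_⟩
      rw [condSeq, ← ih.2]
      exact h2 X
  obtain ⟨Q, h1, h2, h3⟩ := H (fun k => PointProp r P (τ k)) fun R hR => by
    obtain ⟨q, hq, hq'⟩ := hR.exists_pointFormula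
    obtain ⟨k, hk⟩ := hτ' q hq
    exact ⟨k, funext fun a => funext fun X => propext (hk ▸ hq' a X)⟩
  refine ⟨Q, fun k => ?_, fun k => ?_, fun φ hφ => ?_⟩
  · rw [(key k).2]; exact h1 k
  · rw [(key k).2]; exact h2 k
  · obtain ⟨k, hk⟩ := h3 (qd φ + 2)
    refine ⟨k, ?_⟩
    rw [(key k).2]
    by_cases hQ : SetProp r P φ Q
    · exact .inl fun X hX => (setProp_iff_of_tp_eq hirr htri hφ (hk X Q hX (h1 k))).2 hQ
    · exact .inr fun X hX hX' => hQ ((setProp_iff_of_tp_eq hirr htri hφ (hk X Q hX (h1 k))).1 hX')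

/-! ## Combinatorial tools -/

/-- Ramsey's theorem for pairs. -/
theorem exists_homogeneous {κ : Type*} [Finite κ] (c : ℕ → ℕ → κ) :
    ∃ g : ℕ → ℕ, StrictMono g ∧ ∃ a, ∀ i j, i < j → c (g i) (g j) = a := by
  let U : Ultrafilter ℕ := Filter.hyperfilter ℕ
  have hpig : ∀ d : ℕ → κ, ∃ a, ∀ᶠ j in (U : Filter ℕ), d j = a := fun d =>
    U.eventually_exists_iff.1 (.of_forall fun j => ⟨d j, rfl⟩)
  choose d hd using fun i => hpig (c i)
  obtain ⟨a, ha⟩ := hpig d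
  have hgt : ∀ i, ∀ᶠ j in (U : Filter ℕ), i < j := fun i =>
    (Nat.hyperfilter_le_atTop) (Filter.eventually_gt_atTop i)
  obtain ⟨g, hg, hg'⟩ := exists_seq_of_forall_finset_exists (fun i => d i = a)
    (fun x y => x < y ∧ c x y = a) fun s hs => by
      have : ∀ᶠ j in (U : Filter ℕ), ∀ x ∈ s, x < j ∧ c x j = a :=
        (Filter.eventually_all_finset s).2 fun x hx => (hgt x).and (hs x hx ▸ hd x)
      exact (ha.and this).exists
  exact ⟨g, fun i j hij => (hg' i j hij).1, a, fun i j hij => (hg' i j hij).2⟩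

variable {A : Type} [LinearOrder A]

theorem exists_least_of_finite_le {Z : Set A} (hne : Z.Nonempty)
    (hfin : ∀ x ∈ Z, {y | y ∈ Z ∧ y ≤ x}.Finite) : ∃ z ∈ Z, ∀ y ∈ Z, z ≤ y := by
  obtain ⟨x, hx⟩ := hne
  obtain ⟨z, hz, h⟩ := Set.exists_min_image _ id (hfin x hx) ⟨x, hx, le_rfl⟩
  refine ⟨z, hz.1, fun y hy => ?_⟩
  rcases le_total y x with hyx | hyx
  · exact h y ⟨hy, hyx⟩
  · exact hz.2.trans hyx

/-- A set of order type `ω` can be enumerated from any of its elements. -/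
theorem exists_enum {Z : Set A} {s : A} (hs : s ∈ Z) (hunb : ∀ x ∈ Z, ∃ y ∈ Z, x < y)
    (hfin : ∀ x ∈ Z, {y | y ∈ Z ∧ y ≤ x}.Finite) :
    ∃ f : ℕ → A, f 0 = s ∧ StrictMono f ∧ (∀ i, f i ∈ Z) ∧
      ∀ i, ∀ y ∈ Z, f i ≤ y → y < f (i + 1) → y = f i := by
  have hnext : ∀ x : Z, ∃ y : Z, x < y ∧ ∀ z ∈ Z, (x : A) < z → y ≤ z := fun ⟨x, hx⟩ => by
    obtain ⟨y, hy, h⟩ := exists_least_of_finite_le (Z := {y | y ∈ Z ∧ x < y})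
      (hunb x hx) fun y hy => (hfin y hy.1).subset fun z hz => ⟨hz.1.1, hz.2⟩
    exact ⟨⟨y, hy.1⟩, hy.2, fun z hz hxz => h z ⟨hz, hxz⟩⟩
  choose next hlt hle using hnext
  let f : ℕ → Z := fun i => next^[i] ⟨s, hs⟩
  have hf : ∀ i, f (i + 1) = next (f i) := fun i => Function.iterate_succ_apply' _ _ _
  refine ⟨fun i => f i, rfl, strictMono_nat_of_lt_succ fun i => ?_, fun i => (f i).2,
    fun i y hy h1 h2 => ?_⟩
  · rw [hf]; exact hlt _
  · by_contra hne
    dsimp only at h2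
    rw [hf] at h2
    exact absurd (hle (f i) y hy (lt_of_le_of_ne h1 (Ne.symm hne))) (not_le.2 h2)

end

section

variable {A : Type} [LinearOrder A]

/-! ## Unions of classes of order type `ω` -/

/-- A partial equivalence relation whose classes are convex of order type `ω`. -/
structure OmegaRel (cr : A → A → Prop) : Prop where
  symm : ∀ {x y}, cr x y → cr y x
  trans : ∀ {x y z}, cr x y → cr y z → cr x z
  finite : ∀ x, {y | cr x y ∧ y ≤ x}.Finite
  unbounded : ∀ x, cr x x → ∃ y, cr x y ∧ x < y
  convex : ∀ {x y z}, cr x z → x ≤ y → y ≤ z → cr x y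

/-- A set is cofinal if it is unbounded in every class. -/
def Cof (cr : A → A → Prop) (X : Set A) : Prop := ∀ x, cr x x → ∃ y, y ∈ X ∧ cr x y ∧ x < y

/-- The elements of a set which are minimal in their class. -/
def mins (cr : A → A → Prop) (T : Set A) : Set A := {x | x ∈ T ∧ ∀ y, y ∈ T → cr x y → x ≤ y}

/-- The intersection of the sets satisfying a condition. -/
def core (p : Set A → Prop) : Set A := {x | ∀ X, p X → x ∈ X}

/-- The elements which belong to some but not to all sets satisfying a condition. -/
def rest (p : Set A → Prop) : Set A := {x | (∃ X, p X ∧ x ∈ X) ∧ ¬ ∀ X, p X → x ∈ X}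

/-- The sets between `S` and `S ∪ T` which are cofinal. -/
def Between (cr : A → A → Prop) (S T X : Set A) : Prop :=
  (∀ x, x ∈ S → x ∈ X) ∧ (∀ x, x ∈ X → x ∈ S ∨ x ∈ T) ∧ Cof cr X

/-- The requirement `t` provides a cofinal subset of `T` without the minimal elements. -/
def Thins (cr : A → A → Prop) (t : A → Set A → Prop) (T : Set A) : Prop :=
  (∀ x, t x T → x ∈ T ∧ x ∉ mins cr T) ∧ Cof cr {x | t x T}

/-- Fix the minimal free elements and shrink the set of free elements. -/
def omegaStep (cr : A → A → Prop) (p : Set A → Prop) (t : A → Set A → Prop) (X : Set A) : Prop :=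
  p X ∧ (∀ x, x ∈ mins cr (rest p) → x ∈ X) ∧
    (Thins cr t (rest p) → ∀ x, x ∈ X → x ∈ core p ∨ x ∈ mins cr (rest p) ∨ t x (rest p))

/-- The fixed and the free elements after `k` steps. -/
noncomputable def omegaState (cr : A → A → Prop) (t : ℕ → A → Set A → Prop) : ℕ → Set A × Set A
  | 0 => (∅, {x | cr x x})
  | k + 1 =>
    let S := (omegaState cr t k).1
    let T := (omegaState cr t k).2
    open Classical in
    (S ∪ mins cr T, if Thins cr (t k) T then {x | t k x T} else T \ mins cr T)

/-- The properties of the fixed elements `S` and the free elements `T`. -/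
structure OmegaInv (cr : A → A → Prop) (S T : Set A) : Prop where
  left_mem : ∀ x ∈ S, cr x x
  right_mem : ∀ x ∈ T, cr x x
  lt : ∀ x ∈ S, ∀ y ∈ T, cr x y → x < y
  cof : Cof cr T

section

variable {cr : A → A → Prop}

theorem OmegaRel.left (h : OmegaRel cr) {x y : A} (hxy : cr x y) : cr x x :=
  h.trans hxy (h.symm hxy)

theorem OmegaRel.right (h : OmegaRel cr) {x y : A} (hxy : cr x y) : cr y y :=
  h.trans (h.symm hxy) hxy

theorem Cof.exists_two (h : OmegaRel cr) {X : Set A} (hX : Cof cr X) {x : A} (hx : cr x x) :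
    ∃ y z, y ∈ X ∧ z ∈ X ∧ cr x y ∧ cr x z ∧ x < y ∧ y < z := by
  obtain ⟨y, hy, hxy, hlt⟩ := hX x hx
  obtain ⟨z, hz, hyz, hlt'⟩ := hX y (h.right hxy)
  exact ⟨y, z, hy, hz, hxy, h.trans hxy hyz, hlt, hlt'⟩

theorem Cof.diff_singleton (h : OmegaRel cr) {X : Set A} (hX : Cof cr X) (a : A) :
    Cof cr (X \ {a}) := fun x hx => by
  obtain ⟨y, z, hy, hz, hxy, hxz, h1, h2⟩ := hX.exists_two h hx
  by_cases hya : y = a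
  · exact ⟨z, ⟨hz, fun hza => absurd (hya.trans (Eq.symm hza)) h2.ne⟩, hxz, h1.trans h2⟩
  · exact ⟨y, ⟨hy, hya⟩, hxy, h1⟩

theorem Cof.diff_mins (h : OmegaRel cr) {X : Set A} (hX : Cof cr X) :
    Cof cr (X \ mins cr X) := fun x hx => by
  obtain ⟨y, z, hy, hz, hxy, hxz, h1, h2⟩ := hX.exists_two h hx
  exact ⟨z, ⟨hz, fun hm => absurd (hm.2 y hy (h.trans (h.symm hxz) hxy)) (not_le.2 h2)⟩, hxz,
    h1.trans h2⟩

theorem Cof.mono {X Y : Set A} (hX : Cof cr X) (hXY : X ⊆ Y) : Cof cr Y := fun x hx => by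
  obtain ⟨y, hy, h⟩ := hX x hx
  exact ⟨y, hXY hy, h⟩

theorem Cof.exists_mins (h : OmegaRel cr) {X : Set A} (hX : Cof cr X) {x : A} (hx : cr x x) :
    ∃ y ∈ mins cr X, cr x y := by
  obtain ⟨z, hz, hmin⟩ := exists_least_of_finite_le (Z := {y | y ∈ X ∧ cr x y})
    (by obtain ⟨y, hy, hxy, -⟩ := hX x hx; exact ⟨y, hy, hxy⟩)
    fun y hy => (h.finite y).subset fun w hw => ⟨h.trans (h.symm hy.2) hw.1.2, hw.2⟩
  exact ⟨z, ⟨hz.1, fun y hy hzy => hmin y ⟨hy, h.trans hz.2 hzy⟩⟩, hz.2⟩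

theorem mins_eq (h : OmegaRel cr) {T : Set A} {x y : A} (hx : x ∈ mins cr T) (hy : y ∈ mins cr T)
    (hxy : cr x y) : x = y :=
  le_antisymm (hx.2 y hy.1 hxy) (hy.2 x hx.1 (h.symm hxy))

theorem OmegaInv.between_union {S T : Set A} (hI : OmegaInv cr S T) : Between cr S T (S ∪ T) :=
  ⟨fun _ => .inl, fun _ => id, hI.cof.mono Set.subset_union_right⟩

theorem OmegaInv.between_diff (h : OmegaRel cr) {S T : Set A} (hI : OmegaInv cr S T) {a : A}
    (ha : a ∉ S) : Between cr S T ((S ∪ T) \ {a}) :=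
  ⟨fun x hx => ⟨.inl hx, fun hxa => ha (by rw [← show x = a from hxa]; exact hx)⟩,
    fun _ hx => hx.1, (hI.cof.mono Set.subset_union_right).diff_singleton h a⟩

theorem OmegaInv.notMem {S T : Set A} (hI : OmegaInv cr S T) {x : A} (hx : x ∈ T) : x ∉ S :=
  fun hS => lt_irrefl x (hI.lt x hS x hx (hI.left_mem x hS))

theorem OmegaInv.core_eq (h : OmegaRel cr) {S T : Set A} (hI : OmegaInv cr S T) :
    core (Between cr S T) = S := by
  ext x
  refine ⟨fun hx => ?_, fun hx X hX => hX.1 x hx⟩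
  by_contra hxS
  exact (hx _ (hI.between_diff h hxS)).2 rfl

theorem OmegaInv.rest_eq (h : OmegaRel cr) {S T : Set A} (hI : OmegaInv cr S T) :
    rest (Between cr S T) = T := by
  ext x
  constructor
  · rintro ⟨⟨X, hX, hx⟩, hn⟩
    refine (hX.2.1 x hx).resolve_left fun hS => hn fun Y hY => hY.1 x hS
  · intro hx
    refine ⟨⟨_, hI.between_union, .inr hx⟩, fun hn => ?_⟩
    have : x ∈ core (Between cr S T) := hn
    rw [hI.core_eq h] at this
    exact hI.notMem hx this

theorem OmegaInv.step {S T T' : Set A} (hI : OmegaInv cr S T)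
    (hT : ∀ x ∈ T', x ∈ T ∧ x ∉ mins cr T) (hc : Cof cr T') :
    OmegaInv cr (S ∪ mins cr T) T' where
  left_mem := by
    rintro x (hx | hx)
    · exact hI.left_mem x hx
    · exact hI.right_mem x hx.1
  right_mem x hx := hI.right_mem x (hT x hx).1
  lt := by
    rintro x (hx | hx) y hy hxy
    · exact hI.lt x hx y (hT y hy).1 hxy
    · exact lt_of_le_of_ne (hx.2 y (hT y hy).1 hxy) fun he => (hT y hy).2 (he ▸ hx)
  cof := hc

theorem omegaState_succ (t : ℕ → A → Set A → Prop) (k : ℕ) :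
    (omegaState cr t (k + 1)).1 = (omegaState cr t k).1 ∪ mins cr (omegaState cr t k).2 := rfl

theorem omegaState_inv (h : OmegaRel cr) (t : ℕ → A → Set A → Prop) (k : ℕ) :
    OmegaInv cr (omegaState cr t k).1 (omegaState cr t k).2 := by
  induction k with
  | zero =>
    refine ⟨by simp [omegaState], fun x hx => hx, by simp [omegaState], fun x hx => ?_⟩
    obtain ⟨y, hxy, hlt⟩ := h.unbounded x hx
    exact ⟨y, h.right hxy, hxy, hlt⟩
  | succ k ih =>
    refine ih.step ?_ ?_
    · intro x hx
      simp only [omegaState] at hx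
      split_ifs at hx with hth
      · exact hth.1 x hx
      · exact hx
    · simp only [omegaState]
      split_ifs with hth
      · exact hth.2
      · exact ih.cof.diff_mins h

theorem condSeq_omegaStep (h : OmegaRel cr) (t : ℕ → A → Set A → Prop) (k : ℕ) :
    condSeq (omegaStep cr) (fun X => (∀ x, x ∈ X → cr x x) ∧ Cof cr X) t k =
      Between cr (omegaState cr t k).1 (omegaState cr t k).2 := by
  induction k with
  | zero =>
    funext X
    simp [condSeq, Between, omegaState]
  | succ k ih =>
    have hI := omegaState_inv h t k
    funext X
    rw [condSeq, ih, omegaStep, hI.core_eq h, hI.rest_eq h, Between, Between, omegaState_succ]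
    simp only [omegaState]
    by_cases hth : Thins cr (t k) (omegaState cr t k).2
    · simp only [forall_const, hth]
      refine propext ⟨?_, ?_⟩
      · rintro ⟨⟨h1, h2, h3⟩, h4, h5⟩
        refine ⟨fun x hx => hx.elim (h1 x) (h4 x), fun x hx => ?_, h3⟩
        rcases h5 x hx with h | h | h
        · exact .inl (.inl h)
        · exact .inl (.inr h)
        · exact .inr h
      · rintro ⟨h1, h2, h3⟩
        refine ⟨⟨fun x hx => h1 x (.inl hx), fun x hx => ?_, h3⟩, fun x hx => h1 x (.inr hx),
          fun x hx => ?_⟩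
        · rcases h2 x hx with (h | h) | h
          · exact .inl h
          · exact .inr h.1
          · exact .inr (hth.1 x h).1
        · rcases h2 x hx with (h | h) | h
          · exact .inl h
          · exact .inr (.inl h)
          · exact .inr (.inr h)
    · simp only [hth, false_imp_iff, and_true]
      refine propext ⟨?_, ?_⟩
      · rintro ⟨⟨h1, h2, h3⟩, h4⟩
        refine ⟨fun x hx => hx.elim (h1 x) (h4 x), fun x hx => ?_, h3⟩
        by_cases hm : x ∈ mins cr (omegaState cr t k).2
        · exact .inl (.inr hm)
        · exact (h2 x hx).imp .inl fun h => ⟨h, hm⟩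
      · rintro ⟨h1, h2, h3⟩
        refine ⟨⟨fun x hx => h1 x (.inl hx), fun x hx => ?_, h3⟩, fun x hx => h1 x (.inr hx)⟩
        rcases h2 x hx with (h | h) | h
        · exact .inl h
        · exact .inr h.1
        · exact .inr h.1

/-- The set of all elements fixed at some step. -/
def omegaLimit (cr : A → A → Prop) (t : ℕ → A → Set A → Prop) : Set A :=
  ⋃ k, (omegaState cr t k).1

theorem omegaState_mono (t : ℕ → A → Set A → Prop) :
    Monotone fun k => (omegaState cr t k).1 :=
  monotone_nat_of_le_succ fun _ => Set.subset_union_left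

theorem omegaState_anti (h : OmegaRel cr) (t : ℕ → A → Set A → Prop) :
    Antitone fun k => (omegaState cr t k).1 ∪ (omegaState cr t k).2 := by
  refine antitone_nat_of_succ_le fun k x hx => ?_
  have hI := omegaState_inv h t k
  rcases hx with (hx | hx) | hx
  · exact .inl hx
  · exact .inr hx.1
  · simp only [omegaState] at hx
    split_ifs at hx with hth
    · exact .inr (hth.1 x hx).1
    · exact .inr hx.1

theorem between_omegaLimit (h : OmegaRel cr) (t : ℕ → A → Set A → Prop) (k : ℕ) :
    Between cr (omegaState cr t k).1 (omegaState cr t k).2 (omegaLimit cr t) := by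
  refine ⟨fun x hx => Set.mem_iUnion.2 ⟨k, hx⟩, fun x hx => ?_, fun x hx => ?_⟩
  · obtain ⟨j, hj⟩ := Set.mem_iUnion.1 hx
    rcases le_total j k with hjk | hjk
    · exact .inl (omegaState_mono t hjk hj)
    · exact omegaState_anti h t hjk (.inl hj)
  · by_contra! hn
    choose z hz hxz using fun k => (omegaState_inv h t k).cof.exists_mins h hx
    have hzS : ∀ k, z k ∈ (omegaState cr t (k + 1)).1 := fun k => .inr (hz k)
    have hlt : StrictMono z := fun i j hij => (omegaState_inv h t j).lt _
      (omegaState_mono t (Nat.succ_le_of_lt hij) (hzS i)) _ (hz j).1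
      (h.trans (h.symm (hxz i)) (hxz j))
    refine Set.infinite_of_injective_forall_mem hlt.injective (fun k => ?_) (h.finite x)
    exact ⟨hxz k, hn _ (Set.mem_iUnion.2 ⟨_, hzS k⟩) (hxz k)⟩

theorem exists_between_ne (h : OmegaRel cr) (hne : ∃ x, cr x x) {S T : Set A}
    (hI : OmegaInv cr S T) (Q : Set A) : ∃ X, X ≠ Q ∧ Between cr S T X := by
  obtain ⟨x, hx⟩ := hne
  obtain ⟨y, hy, -⟩ := hI.cof x hx
  by_cases hQ : y ∈ Q
  · refine ⟨_, fun he => ?_, hI.between_diff h (hI.notMem hy)⟩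
    rw [← he] at hQ
    exact hQ.2 rfl
  · refine ⟨_, fun he => hQ ?_, hI.between_union⟩
    rw [← he]
    exact .inr hy

end

end

section

variable {A : Type} [LinearOrder A] {cr : A → A → Prop} {κ : Type*}

/-! ### Homogeneous sets -/

/-- A cofinal set of non-minimal elements of `T` homogeneous for the colouring `col`. -/
def Hom (cr : A → A → Prop) (col : A → A → κ) (T X : Set A) : Prop :=
  (∀ x, x ∈ X → x ∈ T ∧ x ∉ mins cr T) ∧ Cof cr X ∧
  (∀ i, i ∈ X → ∀ j, j ∈ X → ∀ i', i' ∈ X → ∀ j', j' ∈ X → cr i j → cr i i' → cr i j' →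
    i < j → i' < j' → col i j = col i' j') ∧
  (∀ s, s ∈ mins cr T → ∀ j, j ∈ X → ∀ j', j' ∈ X → cr s j → cr s j' → col s j = col s j')

theorem OmegaRel.exists_lt_of_strictMono (h : OmegaRel cr) {f : ℕ → A} (hf : StrictMono f) {x : A}
    (hx : ∀ i, cr x (f i)) : ∃ i, x < f i := by
  by_contra! hn
  refine Set.infinite_of_injective_forall_mem hf.injective (fun i => ?_) (h.finite x)
  exact ⟨hx i, hn i⟩

theorem exists_hom [Finite κ] (h : OmegaRel cr) (col : A → A → κ) {T : Set A}
    (hT : ∀ x ∈ T, cr x x) (hc : Cof cr T) : ∃ X, Hom cr col T X := by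
  have key : ∀ s : mins cr T, ∃ f : ℕ → A, StrictMono f ∧
      (∀ i, cr s (f i) ∧ f i ∈ T ∧ f i ∉ mins cr T) ∧ (∃ a, ∀ i j, i < j → col (f i) (f j) = a) ∧
      ∃ b, ∀ i, col s (f i) = b := by
    rintro ⟨s, hs⟩
    have hss := hT s hs.1
    obtain ⟨f, hf0, hf, hfZ, -⟩ := exists_enum (Z := {y | y ∈ T ∧ cr s y}) (s := s) ⟨hs.1, hss⟩
      (fun x hx => by
        obtain ⟨y, hy, hxy, hlt⟩ := hc x (h.right hx.2)
        exact ⟨y, ⟨hy, h.trans hx.2 hxy⟩, hlt⟩)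
      fun x hx => (h.finite x).subset fun y hy => ⟨h.trans (h.symm hx.2) hy.1.2, hy.2⟩
    obtain ⟨g, hg, ⟨a, b⟩, hab⟩ := exists_homogeneous fun i j =>
      (col (f (i + 1)) (f (j + 1)), col s (f (i + 1)))
    refine ⟨fun i => f (g i + 1), fun i j hij => hf (Nat.succ_lt_succ (hg hij)), fun i => ?_,
      ⟨a, fun i j hij => congrArg Prod.fst (hab i j hij)⟩,
      ⟨b, fun i => congrArg Prod.snd (hab i (i + 1) i.lt_succ_self)⟩⟩
    refine ⟨(hfZ _).2, (hfZ _).1, fun hm => ?_⟩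
    have := mins_eq h hs hm (hfZ _).2
    exact absurd (hf0.trans this) (hf (Nat.succ_pos _)).ne
  choose f hf hfT hcol hcol' using key
  have hs : ∀ s s' : mins cr T, ∀ {x y : A}, cr s x → cr s' y → cr x y → s = s' :=
    fun s s' x y h1 h2 h3 => Subtype.ext (mins_eq h s.2 s'.2 (h.trans (h.trans h1 h3) (h.symm h2)))
  refine ⟨{x | ∃ s i, x = f s i}, ?_, fun x hx => ?_, ?_, ?_⟩
  · rintro _ ⟨s, i, rfl⟩
    exact (hfT s i).2
  · obtain ⟨s, hs, hxs⟩ := hc.exists_mins h hx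
    have hxf : ∀ i, cr x (f ⟨s, hs⟩ i) := fun i => h.trans hxs (hfT ⟨s, hs⟩ i).1
    obtain ⟨i, hi⟩ := h.exists_lt_of_strictMono (hf ⟨s, hs⟩) hxf
    exact ⟨_, ⟨_, i, rfl⟩, hxf i, hi⟩
  · rintro _ ⟨s, i, rfl⟩ _ ⟨s₁, j, rfl⟩ _ ⟨s₂, i', rfl⟩ _ ⟨s₃, j', rfl⟩ h1 h2 h3 hlt hlt'
    obtain rfl := hs s s₁ (hfT s i).1 (hfT s₁ j).1 h1
    obtain rfl := hs s s₂ (hfT s i).1 (hfT s₂ i').1 h2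
    obtain rfl := hs s s₃ (hfT s i).1 (hfT s₃ j').1 h3
    obtain ⟨a, ha⟩ := hcol s
    rw [ha _ _ ((hf s).lt_iff_lt.1 hlt), ha _ _ ((hf s).lt_iff_lt.1 hlt')]
  · rintro s₀ hs₀ _ ⟨s, i, rfl⟩ _ ⟨s₁, j, rfl⟩ h1 h2
    have hss := hT s₀ hs₀.1
    obtain rfl := hs ⟨s₀, hs₀⟩ s hss (hfT s i).1 h1
    obtain rfl := hs ⟨s₀, hs₀⟩ s₁ hss (hfT s₁ j).1 h2
    obtain ⟨a, ha⟩ := hcol' ⟨s₀, hs₀⟩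
    rw [ha, ha]

/-! ### The greedy set -/

/-- The set containing an element whenever some set satisfying `Φ` permits it. -/
def Greedy (cr : A → A → Prop) (Φ : Set A → Prop) (G : Set A) : Prop :=
  ∀ x, x ∈ G ↔ ∃ X, Φ X ∧ x ∈ X ∧ ∀ y, cr x y → y < x → (y ∈ X ↔ y ∈ G)

theorem OmegaRel.wellFounded (h : OmegaRel cr) : WellFounded fun y x => cr x y ∧ y < x := by
  refine WellFounded.wellFounded_iff_has_min.2 fun s ⟨x, hx⟩ => ?_
  by_cases hxx : cr x x
  · obtain ⟨m, hm, hmin⟩ := Set.exists_min_image _ id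
      ((h.finite x).inter_of_left s) ⟨x, ⟨hxx, le_rfl⟩, hx⟩
    refine ⟨m, hm.2, fun y hy hym => ?_⟩
    exact absurd (hmin y ⟨⟨h.trans hm.1.1 hym.1, hym.2.le.trans hm.1.2⟩, hy⟩) (not_le.2 hym.2)
  · exact ⟨x, hx, fun y _ hyx => hxx (h.left hyx.1)⟩

theorem exists_greedy (h : OmegaRel cr) (Φ : Set A → Prop) : ∃ G, Greedy cr Φ G := by
  let F : ∀ x, (∀ y, cr x y ∧ y < x → Prop) → Prop := fun x ih =>
    ∃ X, Φ X ∧ x ∈ X ∧ ∀ y (h1 : cr x y) (h2 : y < x), (y ∈ X ↔ ih y ⟨h1, h2⟩)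
  refine ⟨{x | h.wellFounded.fix F x}, fun x => ?_⟩
  change h.wellFounded.fix F x ↔ _
  rw [h.wellFounded.fix_eq]
  rfl

theorem Greedy.unique (h : OmegaRel cr) {Φ : Set A → Prop} {G G' : Set A} (hG : Greedy cr Φ G)
    (hG' : Greedy cr Φ G') : G = G' := by
  ext x
  induction x using h.wellFounded.induction with
  | _ x ih =>
    rw [hG x, hG' x]
    refine exists_congr fun X => and_congr_right fun _ => and_congr_right fun _ =>
      forall_congr' fun y => forall_congr' fun h1 => forall_congr' fun h2 => ?_
    rw [ih y ⟨h1, h2⟩]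

theorem Greedy.exists_agree (h : OmegaRel cr) {Φ : Set A → Prop} {G : Set A}
    (hG : Greedy cr Φ G) (hΦ : ∃ X, Φ X) (x : A) :
    ∃ X, Φ X ∧ ∀ y, cr x y → y ≤ x → (y ∈ X ↔ y ∈ G) := by
  induction x using h.wellFounded.induction with
  | _ x ih =>
    obtain ⟨X, hX, hXG⟩ : ∃ X, Φ X ∧ ∀ y, cr x y → y < x → (y ∈ X ↔ y ∈ G) := by
      by_cases hlt : ∃ y, cr x y ∧ y < x
      · obtain ⟨y, ⟨hxy, hyx⟩, hmax⟩ := Set.exists_max_image {y | cr x y ∧ y < x} id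
          ((h.finite x).subset fun y hy => ⟨hy.1, hy.2.le⟩) hlt
        obtain ⟨X, hX, hXG⟩ := ih y ⟨hxy, hyx⟩
        exact ⟨X, hX, fun z hxz hzx => hXG z (h.trans (h.symm hxy) hxz) (hmax z ⟨hxz, hzx⟩)⟩
      · obtain ⟨X, hX⟩ := hΦ
        exact ⟨X, hX, fun y hxy hyx => absurd ⟨y, hxy, hyx⟩ hlt⟩
    by_cases hx : x ∈ G
    · obtain ⟨Y, hY, hxY, hYG⟩ := (hG x).1 hx
      refine ⟨Y, hY, fun y hxy hyx => ?_⟩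
      rcases hyx.eq_or_lt with rfl | hlt
      · exact iff_of_true hxY hx
      · exact hYG y hxy hlt
    · refine ⟨X, hX, fun y hxy hyx => ?_⟩
      rcases hyx.eq_or_lt with rfl | hlt
      · exact iff_of_false (fun hyX => hx ((hG _).2 ⟨X, hX, hyX, hXG⟩)) hx
      · exact hXG y hxy hlt

theorem Greedy.hom (h : OmegaRel cr) {col : A → A → κ} {T G : Set A}
    (hex : ∃ X, Hom cr col T X) (hG : Greedy cr (Hom cr col T) G) : Hom cr col T G := by
  have hmem : ∀ x, x ∈ G → x ∈ T ∧ x ∉ mins cr T := fun x hx => by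
    obtain ⟨X, hX, hxX, -⟩ := (hG x).1 hx
    exact hX.1 x hxX
  refine ⟨hmem, fun x hx => ?_, ?_, ?_⟩
  · obtain ⟨X, hX, hXG⟩ := hG.exists_agree h hex x
    obtain ⟨y, hy, hmin⟩ := exists_least_of_finite_le (Z := {y | y ∈ X ∧ cr x y ∧ x < y})
      (hX.2.1 x hx)
      fun y hy => (h.finite y).subset fun w hw => ⟨h.trans (h.symm hy.2.1) hw.1.2.1, hw.2⟩
    by_contra! hn
    refine absurd (hn y ((hG y).2 ⟨X, hX, hy.1, fun z hyz hzy => ?_⟩) hy.2.1) (not_le.2 hy.2.2)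
    have hxz := h.trans hy.2.1 hyz
    rcases le_or_gt z x with hzx | hzx
    · exact hXG z hxz hzx
    · exact iff_of_false (fun hz => absurd (hmin z ⟨hz, hxz, hzx⟩) (not_le.2 hzy))
        fun hz => absurd (hn z hz hxz) (not_le.2 hzx)
  · intro i hi j hj i' hi' j' hj' h1 h2 h3 hlt hlt'
    rcases le_total j j' with hjj | hjj
    · obtain ⟨X, hX, hXG⟩ := hG.exists_agree h hex j'
      have h3' := h.symm h3
      exact hX.2.2.1 i ((hXG _ h3' (hlt.le.trans hjj)).2 hi) j ((hXG _ (h.trans h3' h1) hjj).2 hj)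
        i' ((hXG _ (h.trans h3' h2) hlt'.le).2 hi') j' ((hXG _ (h.right h3) le_rfl).2 hj')
        h1 h2 h3 hlt hlt'
    · obtain ⟨X, hX, hXG⟩ := hG.exists_agree h hex j
      have h1' := h.symm h1
      exact hX.2.2.1 i ((hXG _ h1' hlt.le).2 hi) j ((hXG _ (h.right h1) le_rfl).2 hj)
        i' ((hXG _ (h.trans h1' h2) (hlt'.le.trans hjj)).2 hi') j'
        ((hXG _ (h.trans h1' h3) hjj).2 hj') h1 h2 h3 hlt hlt'
  · have key : ∀ s, s ∈ mins cr T → ∀ j, j ∈ G → ∀ j', j' ∈ G → cr s j → cr s j' → j ≤ j' →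
        col s j = col s j' := fun s hs j hj j' hj' h1 h2 hjj => by
      obtain ⟨X, hX, hXG⟩ := hG.exists_agree h hex j'
      exact hX.2.2.2 s hs j ((hXG _ (h.trans (h.symm h2) h1) hjj).2 hj) j'
        ((hXG _ (h.right h2) le_rfl).2 hj') h1 h2
    intro s hs j hj j' hj' h1 h2
    rcases le_total j j' with hjj | hjj
    · exact key s hs j hj j' hj' h1 h2 hjj
    · exact (key s hs j' hj' j hj h2 h1 hjj).symm

end

/-! ### Homogeneity determines types -/

section

variable {n : ℕ} {A : Type} [LinearOrder A] {r : A → A → Prop} {P : Fin n → Set A}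
  {cr : A → A → Prop}

/-- The type of a half open interval with its left end marked. -/
noncomputable def icoType (r : A → A → Prop) (P : Fin n → Set A) (k : ℕ) (x y : A) :
    Ty k (Option (Fin n)) := tp r k (Set.Ico x y) (ext P {x})

theorem Compat.iff_of_lt_iff (hr : Compat r) {x y x' y' : A} (h1 : x < y ↔ x' < y')
    (h2 : y < x ↔ y' < x') : r x y ↔ r x' y' := by
  rcases hr with h | h <;> simp [h, h1, h2]

/-- The type of a structure cut into an `ω`-sequence of intervals. -/
theorem tp_eq_of_seq (hr : Compat r) {k : ℕ} {ι : Type} {W W' : ι → Set A} {B : Set A}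
    {f f' : ℕ → A} (hf : StrictMono f) (hf' : StrictMono f')
    (hB : B = ⋃ i, Set.Ico (f i) (f (i + 1))) (hB' : B = ⋃ i, Set.Ico (f' i) (f' (i + 1)))
    (h : ∀ i, tp r k (Set.Ico (f i) (f (i + 1))) W = tp r k (Set.Ico (f' i) (f' (i + 1))) W') :
    tp r k B W = tp r k B W' := by
  have hlt : ∀ {f : ℕ → A}, StrictMono f → ∀ {i j}, i < j → ∀ {x y},
      x ∈ Set.Ico (f i) (f (i + 1)) → y ∈ Set.Ico (f j) (f (j + 1)) → x < y :=
    fun hf _ _ hij _ _ hx hy => hx.2.trans_le ((hf.monotone hij).trans hy.1)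
  have hd : ∀ {f : ℕ → A}, StrictMono f → ∀ i j x, x ∈ Set.Ico (f i) (f (i + 1)) →
      x ∈ Set.Ico (f j) (f (j + 1)) → i = j := fun hf i j x hi hj => by
    rcases lt_trichotomy i j with hij | hij | hij
    · exact absurd (hlt hf hij hi hj) (lt_irrefl _)
    · exact hij
    · exact absurd (hlt hf hij hj hi) (lt_irrefl _)
  have := tp_iUnion (r := r) (r' := r) k (hd hf) (hd hf') (fun i j hij x hx y hy x' hx' y' hy' => by
    rcases hij.lt_or_gt with hij | hij
    · have h1 := hlt hf hij hx hy
      have h2 := hlt hf' hij hx' hy'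
      exact hr.iff_of_lt_iff (iff_of_true h1 h2) (iff_of_false h1.not_gt h2.not_gt)
    · have h1 := hlt hf hij hy hx
      have h2 := hlt hf' hij hy' hx'
      exact hr.iff_of_lt_iff (iff_of_false h1.not_gt h2.not_gt) (iff_of_true h1 h2)) h
  rwa [← hB, ← hB'] at this

/-- The type of a structure cut into convex pieces. -/
theorem tp_eq_of_convex (hr : Compat r) {I : Type*} {k : ℕ} {ι : Type} {W W' : ι → Set A}
    {C : I → Set A} (hd : ∀ i j x, x ∈ C i → x ∈ C j → i = j)
    (hc : ∀ i, (C i).OrdConnected) (h : ∀ i, tp r k (C i) W = tp r k (C i) W') :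
    tp r k (⋃ i, C i) W = tp r k (⋃ i, C i) W' := by
  have key : ∀ {i j}, i ≠ j → ∀ {x y x' y'}, x ∈ C i → y ∈ C j → x' ∈ C i → y' ∈ C j →
      x < y → x' < y' := by
    intro i j hij x y x' y' hx hy hx' hy' hlt
    by_contra! hle
    rcases le_total x y' with h1 | h1
    · exact hij (hd i j y' ((hc i).out hx hx' ⟨h1, hle⟩) hy')
    · exact hij (hd i j x hx ((hc j).out hy' hy ⟨h1, hlt.le⟩))
  refine tp_iUnion k hd hd (fun i j hij x hx y hy x' hx' y' hy' => hr.iff_of_lt_iff ?_ ?_) h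
  · exact ⟨key hij hx hy hx' hy', key hij hx' hy' hx hy⟩
  · exact ⟨key hij.symm hy hx hy' hx', key hij.symm hy' hx' hy hx⟩

end

section

variable {n : ℕ} {A : Type} [LinearOrder A] {r : A → A → Prop} {P : Fin n → Set A}
  {cr : A → A → Prop}

/-- Cut the upper part of a class at the elements of `X`. -/
theorem exists_cut (h : OmegaRel cr) {K : ℕ} {S T G X : Set A}
    (hI : OmegaInv cr S T) (hX : Between cr (S ∪ mins cr T) G X) {s : A} (hs : s ∈ mins cr T) :
    ∃ f : ℕ → A, f 0 = s ∧ StrictMono f ∧ (∀ i, f (i + 1) ∈ G ∧ cr s (f (i + 1))) ∧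
      {y | cr s y ∧ s ≤ y} = ⋃ i, Set.Ico (f i) (f (i + 1)) ∧
      ∀ i, tp r K (Set.Ico (f i) (f (i + 1))) (ext P X) = icoType r P K (f i) (f (i + 1)) := by
  have hss := hI.right_mem s hs.1
  obtain ⟨f, hf0, hf, hfZ, hbet⟩ := exists_enum (Z := {y | y ∈ X ∧ cr s y ∧ s ≤ y}) (s := s)
    ⟨hX.1 s (.inr hs), hss, le_rfl⟩
    (fun x hx => by
      obtain ⟨y, hy, hxy, hlt⟩ := hX.2.2 x (h.right hx.2.1)
      exact ⟨y, ⟨hy, h.trans hx.2.1 hxy, hx.2.2.trans hlt.le⟩, hlt⟩)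
    fun x hx => (h.finite x).subset fun y hy => ⟨h.trans (h.symm hx.2.1) hy.1.2.1, hy.2⟩
  have hsub : ∀ i y, y ∈ Set.Ico (f i) (f (i + 1)) → cr s y ∧ s ≤ y := fun i y hy =>
    have hsy := (hfZ i).2.2.trans hy.1
    ⟨h.convex (hfZ (i + 1)).2.1 hsy hy.2.le, hsy⟩
  refine ⟨f, hf0, hf, fun i => ⟨?_, (hfZ _).2.1⟩, ?_, fun i => ?_⟩
  · have hlt : s < f (i + 1) := hf0 ▸ hf (Nat.succ_pos i)
    rcases hX.2.1 _ (hfZ (i + 1)).1 with (h1 | h1) | h1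
    · exact absurd (hI.lt _ h1 s hs.1 (h.symm (hfZ (i + 1)).2.1)) hlt.not_gt
    · exact absurd (mins_eq h hs h1 (hfZ (i + 1)).2.1) hlt.ne
    · exact h1
  · ext y
    refine ⟨fun hy => ?_, fun hy => ?_⟩
    · have hex : ∃ i, y < f i :=
        h.exists_lt_of_strictMono hf fun i => h.trans (h.symm hy.1) (hfZ i).2.1
      classical
      rcases hi : Nat.find hex with _ | i
      · have := Nat.find_spec hex
        rw [hi, hf0] at this
        exact absurd hy.2 (not_le.2 this)
      · refine Set.mem_iUnion.2 ⟨i, not_lt.1 fun hlt => ?_, hi ▸ Nat.find_spec hex⟩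
        exact absurd (Nat.find_min' hex hlt) (by omega)
    · obtain ⟨i, hi⟩ := Set.mem_iUnion.1 hy
      exact hsub i y hi
  · refine tp_congr K (ext_congr fun x hx => ⟨fun hxX => ?_, ?_⟩)
    · exact hbet i x ⟨hxX, hsub i x hx⟩ hx.1 hx.2
    · rintro rfl
      exact (hfZ i).1

theorem tp_class_eq (hr : Compat r) (h : OmegaRel cr) {K : ℕ} {S T G X X' : Set A}
    (hI : OmegaInv cr S T) (hG : Hom cr (icoType r P K) T G)
    (hX : Between cr (S ∪ mins cr T) G X) (hX' : Between cr (S ∪ mins cr T) G X') {x : A}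
    (hx : cr x x) : tp r K {y | cr x y} (ext P X) = tp r K {y | cr x y} (ext P X') := by
  obtain ⟨s, hs, hxs⟩ := hI.cof.exists_mins h hx
  have hss := h.right hxs
  have hG' : ∀ y ∈ G, cr s y → s < y := fun y hy hsy =>
    lt_of_le_of_ne (hs.2 y (hG.1 y hy).1 hsy) fun he => (hG.1 y hy).2 (he ▸ hs)
  have hpre : ∀ X, Between cr (S ∪ mins cr T) G X → ∀ y ∈ {y | cr s y ∧ y < s},
      (y ∈ X ↔ y ∈ S) := by
    rintro X hX y ⟨hsy, hys⟩
    refine ⟨fun hyX => ?_, fun hyS => hX.1 y (.inl hyS)⟩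
    rcases hX.2.1 y hyX with (h1 | h1) | h1
    · exact h1
    · exact absurd (mins_eq h hs h1 hsy) hys.ne'
    · exact absurd (hG' y h1 hsy) hys.not_gt
  have hun : {y | cr x y} = ⋃ b : Bool, cond b {y | cr s y ∧ y < s} {y | cr s y ∧ s ≤ y} := by
    ext y
    simp only [Set.mem_iUnion, Bool.exists_bool, cond_true, cond_false]
    have hiff : cr x y ↔ cr s y := ⟨fun h' => h.trans (h.symm hxs) h', fun h' => h.trans hxs h'⟩
    refine hiff.trans ⟨fun hsy => ?_, fun h' => h'.elim And.left And.left⟩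
    exact (le_or_gt s y).imp (fun h' => ⟨hsy, h'⟩) fun h' => ⟨hsy, h'⟩
  rw [hun]
  refine tp_eq_of_convex hr ?_ ?_ ?_
  · rintro (_ | _) (_ | _) y h1 h2
    · rfl
    · exact absurd h2.2 (not_lt.2 h1.2)
    · exact absurd h1.2 (not_lt.2 h2.2)
    · rfl
  · rintro (_ | _)
    · refine ⟨fun y hy z hz w hw => ⟨?_, hy.2.trans hw.1⟩⟩
      exact h.convex hz.1 (hy.2.trans hw.1) hw.2
    · refine ⟨fun y hy z hz w hw => ⟨?_, hw.2.trans_lt hz.2⟩⟩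
      exact h.trans hy.1 (h.convex (h.trans (h.symm hy.1) hz.1) hw.1 hw.2)
  · rintro (_ | _)
    · obtain ⟨f, hf0, hf, hfG, hfB, hft⟩ := exists_cut (r := r) (P := P) (K := K) h hI hX hs
      obtain ⟨f', hf0', hf', hfG', hfB', hft'⟩ := exists_cut (r := r) (P := P) (K := K) h hI hX' hs
      refine tp_eq_of_seq hr hf hf' hfB hfB' fun i => ?_
      rw [hft, hft']
      rcases i with _ | i
      · rw [hf0, hf0']
        exact hG.2.2.2 s hs _ (hfG 0).1 _ (hfG' 0).1 (hfG 0).2 (hfG' 0).2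
      · have hc : ∀ {y}, cr s y → cr (f (i + 1)) y := fun hy => h.trans (h.symm (hfG i).2) hy
        exact hG.2.2.1 _ (hfG i).1 _ (hfG _).1 _ (hfG' i).1 _ (hfG' _).1 (hc (hfG _).2)
          (hc (hfG' _).2) (hc (hfG' _).2) (hf (Nat.lt_succ_self _)) (hf' (Nat.lt_succ_self _))
    · exact tp_congr K (ext_congr fun y hy => (hpre X hX y hy).trans (hpre X' hX' y hy).symm)

theorem tp_univ_eq (hr : Compat r) (h : OmegaRel cr) {K : ℕ} {S T G X X' : Set A}
    (hI : OmegaInv cr S T) (hG : Hom cr (icoType r P K) T G)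
    (hX : Between cr (S ∪ mins cr T) G X) (hX' : Between cr (S ∪ mins cr T) G X') :
    tp r K Set.univ (ext P X) = tp r K Set.univ (ext P X') := by
  let I := {c : Set A // ∃ x, c = {y | y = x ∨ cr x y}}
  have hcl : ∀ {x y}, y = x ∨ cr x y → {z | z = x ∨ cr x z} = {z | z = y ∨ cr y z} := by
    rintro x y (rfl | hxy)
    · rfl
    · ext z
      refine ⟨?_, ?_⟩ <;> rintro (rfl | hz)
      · exact .inr (h.symm hxy)
      · exact .inr (h.trans (h.symm hxy) hz)
      · exact .inr hxy
      · exact .inr (h.trans hxy hz)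
  have hun : (Set.univ : Set A) = ⋃ c : I, c.1 :=
    Set.ext fun x => iff_of_true trivial (Set.mem_iUnion.2 ⟨⟨_, x, rfl⟩, .inl rfl⟩)
  have hmem : ∀ X, Between cr (S ∪ mins cr T) G X → ∀ x ∈ X, cr x x := fun X hX x hx => by
    rcases hX.2.1 x hx with (h1 | h1) | h1
    · exact hI.left_mem x h1
    · exact hI.right_mem x h1.1
    · exact hI.right_mem x (hG.1 x h1).1
  rw [hun]
  refine tp_eq_of_convex hr ?_ ?_ ?_
  · rintro ⟨_, x, rfl⟩ ⟨_, y, rfl⟩ z hx hy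
    exact Subtype.ext ((hcl hx).trans (hcl hy).symm)
  · rintro ⟨_, x, rfl⟩
    refine ⟨fun y hy z hz w hw => ?_⟩
    change w ∈ {z | z = x ∨ cr x z}
    change z ∈ {z | z = x ∨ cr x z} at hz
    rw [hcl hy] at hz ⊢
    rcases hz with rfl | hz
    · exact .inl (le_antisymm hw.2 hw.1)
    · exact .inr (h.convex hz hw.1 hw.2)
  · rintro ⟨_, x, rfl⟩
    by_cases hx : cr x x
    · have : {y | y = x ∨ cr x y} = {y | cr x y} :=
        Set.ext fun y => ⟨fun h' => h'.elim (fun e => e ▸ hx) id, .inr⟩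
      simp only [this]
      exact tp_class_eq hr h hI hG hX hX' hx
    · refine tp_congr K (ext_congr ?_)
      rintro y (rfl | hy)
      · exact iff_of_false (fun hy => hx (hmem X hX _ hy)) fun hy => hx (hmem X' hX' _ hy)
      · exact absurd (h.left hy) hx

end

section

variable {n : ℕ} {A : Type} {r : A → A → Prop} {P : Fin n → Set A}

namespace Dfn

theorem mem_core (i : ℕ) : Dfn r P fun ρ => ρ.v i ∈ core ρ.p :=
  Dfn.all2 (R := fun X ρ => ρ.p X → ρ.v i ∈ X) 0 ((setHole 0).imp (mem i 0)) fun _ _ _ => Iff.rfl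

theorem mem_rest (i : ℕ) : Dfn r P fun ρ => ρ.v i ∈ rest ρ.p :=
  (Dfn.ex2 (R := fun X ρ => ρ.p X ∧ ρ.v i ∈ X) 0 ((setHole 0).and (mem i 0))
    fun _ _ _ => Iff.rfl).and (mem_core i).not

variable [LinearOrder A]

/-- The type of a half open interval expanded by a set is definable. -/
theorem ico_tp (hr : Compat r) (a b j k : ℕ) (t : Ty k (Option (Fin n))) :
    Dfn r P fun ρ => tp r k (Set.Ico (ρ.v a) (ρ.v b)) (ext P (ρ.V j)) = t := by
  suffices Dfn r P fun ρ => tp r k (Set.Ico (ρ.v 0) (ρ.v 1)) (ext P (ρ.V 0)) = t from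
    this.ren (fun i => if i = 0 then a else b) fun _ => j
  refine Dfn.congr (R := fun ρ => ∃ B : Set A, (∀ x, x ∈ B ↔ ρ.v 0 ≤ x ∧ x < ρ.v 1) ∧
    tp r k B (ext P (ρ.V 0)) = t) ?_ fun ρ => ?_
  · refine Dfn.ex2 1 (Dfn.and ?_ ?_) fun _ _ _ => Iff.rfl
    · exact Dfn.all1 2 ((mem 2 1).iff ((Dfn.le hr 0 2).and (Dfn.lt hr 2 1))) fun _ _ _ => Iff.rfl
    · refine (Dfn.tp_eq k 1 (fun o : Option (Fin n) => o.elim (.inr 0) .inl) t).congr fun ρ => ?_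
      have : (fun o : Option (Fin n) => val P ρ (o.elim (.inr 0) .inl)) = ext P (ρ.V 0) := by
        funext o; cases o <;> rfl
      rw [this]
  · refine ⟨?_, fun h => ⟨_, fun x => Iff.rfl, h⟩⟩
    rintro ⟨B, hB, h⟩
    rwa [show B = Set.Ico (ρ.v 0) (ρ.v 1) from Set.ext hB] at h

theorem icoType_eq (hr : Compat r) (a b k : ℕ) (t : Ty k (Option (Fin n))) :
    Dfn r P fun ρ => icoType r P k (ρ.v a) (ρ.v b) = t := by
  refine Dfn.rel_ren (R := fun x y => icoType r P k x y = t) ?_ a b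
  refine Dfn.congr (R := fun ρ => ∃ U : Set A, (∀ x, x ∈ U ↔ x = ρ.v 0) ∧
    tp r k (Set.Ico (ρ.v 0) (ρ.v 1)) (ext P U) = t) ?_ fun ρ => ?_
  · refine Dfn.ex2 0 (Dfn.and ?_ (ico_tp hr 0 1 0 k t)) fun _ _ _ => Iff.rfl
    exact Dfn.all1 2 ((mem 2 0).iff (Dfn.eq 2 0)) fun _ _ _ => Iff.rfl
  · refine ⟨?_, fun h => ⟨_, fun x => Iff.rfl, h⟩⟩
    rintro ⟨B, hB, h⟩
    rwa [show B = {ρ.v 0} from Set.ext hB] at h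

variable {cr : A → A → Prop}

theorem cof (hr : Compat r) (hcr : Dfn r P fun ρ => cr (ρ.v 0) (ρ.v 1)) (j : ℕ) :
    Dfn r P fun ρ => Cof cr (ρ.V j) := by
  refine Dfn.all1 0 (Dfn.imp (hcr.rel_ren 0 0) ?_) fun _ _ _ => Iff.rfl
  exact Dfn.ex1 1 ((mem 1 j).and (hcr.and (Dfn.lt hr 0 1))) fun _ _ _ => Iff.rfl

theorem mem_mins (hr : Compat r) (hcr : Dfn r P fun ρ => cr (ρ.v 0) (ρ.v 1)) (i j : ℕ) :
    Dfn r P fun ρ => ρ.v i ∈ mins cr (ρ.V j) := by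
  suffices Dfn r P fun ρ => ρ.v 0 ∈ mins cr (ρ.V j) from this.ren (fun _ => i) id
  refine (mem 0 j).and (Dfn.all1 1 ?_ fun _ _ _ => Iff.rfl)
  exact (mem 1 j).imp (hcr.imp (Dfn.le hr 0 1))

theorem thins (hr : Compat r) (hcr : Dfn r P fun ρ => cr (ρ.v 0) (ρ.v 1)) (j : ℕ) :
    Dfn r P fun ρ => Thins cr ρ.t (ρ.V j) := by
  refine Dfn.and (Dfn.all1 0 ?_ fun _ _ _ => Iff.rfl) (Dfn.all1 0 ?_ fun _ _ _ => Iff.rfl)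
  · exact (pointHole 0 j).imp ((mem 0 j).and (mem_mins hr hcr 0 j).not)
  · refine Dfn.imp (hcr.rel_ren 0 0) (Dfn.ex1 1 ?_ fun _ _ _ => Iff.rfl)
    exact (pointHole 1 j).and (hcr.and (Dfn.lt hr 0 1))

theorem omegaStep (hr : Compat r) (hcr : Dfn r P fun ρ => cr (ρ.v 0) (ρ.v 1)) :
    Dfn r P fun ρ => omegaStep cr ρ.p ρ.t (ρ.V 0) := by
  refine Dfn.congr (R := fun ρ => ∃ T : Set A, (∀ x, x ∈ T ↔ x ∈ rest ρ.p) ∧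
    (ρ.p (ρ.V 0) ∧ (∀ x, x ∈ mins cr T → x ∈ ρ.V 0) ∧ (Thins cr ρ.t T → ∀ x, x ∈ ρ.V 0 →
      x ∈ core ρ.p ∨ x ∈ mins cr T ∨ ρ.t x T))) ?_ fun ρ => ?_
  · refine Dfn.ex2 1 (Dfn.and ?_ (Dfn.and (setHole 0) (Dfn.and ?_ (Dfn.imp (thins hr hcr 1) ?_))))
      fun _ _ _ => Iff.rfl
    · exact Dfn.all1 0 ((mem 0 1).iff (mem_rest 0)) fun _ _ _ => Iff.rfl
    · exact Dfn.all1 0 ((mem_mins hr hcr 0 1).imp (mem 0 0)) fun _ _ _ => Iff.rfl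
    · refine Dfn.all1 0 ((mem 0 0).imp ?_) fun _ _ _ => Iff.rfl
      exact (mem_core 0).or ((mem_mins hr hcr 0 1).or (pointHole 0 1))
  · refine ⟨?_, fun h => ⟨_, fun x => Iff.rfl, h⟩⟩
    rintro ⟨B, hB, h⟩
    rwa [show B = rest ρ.p from Set.ext hB] at h

theorem hom (hr : Compat r) (hcr : Dfn r P fun ρ => cr (ρ.v 0) (ρ.v 1)) (k i j : ℕ) :
    Dfn r P fun ρ => Hom cr (icoType r P k) (ρ.V i) (ρ.V j) := by
  refine Dfn.and ?_ ((cof hr hcr j).and (Dfn.and ?_ ?_))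
  · refine Dfn.all1 0 ((mem 0 j).imp ?_) fun _ _ _ => Iff.rfl
    exact (mem 0 i).and (mem_mins hr hcr 0 i).not
  · refine Dfn.all1 0 ((mem 0 j).imp ?_) fun _ _ _ => Iff.rfl
    refine Dfn.all1 1 ((mem 1 j).imp ?_) fun _ _ _ => Iff.rfl
    refine Dfn.all1 2 ((mem 2 j).imp ?_) fun _ _ _ => Iff.rfl
    refine Dfn.all1 3 ((mem 3 j).imp ?_) fun _ _ _ => Iff.rfl
    refine (hcr.rel_ren 0 1).imp ((hcr.rel_ren 0 2).imp ((hcr.rel_ren 0 3).imp ?_))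
    refine (Dfn.lt hr 0 1).imp ((Dfn.lt hr 2 3).imp ?_)
    exact Dfn.of_eq₂ (icoType_eq hr 0 1 k) (icoType_eq hr 2 3 k) Eq
  · refine Dfn.all1 0 ((mem_mins hr hcr 0 i).imp ?_) fun _ _ _ => Iff.rfl
    refine Dfn.all1 1 ((mem 1 j).imp ?_) fun _ _ _ => Iff.rfl
    refine Dfn.all1 2 ((mem 2 j).imp ?_) fun _ _ _ => Iff.rfl
    refine (hcr.rel_ren 0 1).imp ((hcr.rel_ren 0 2).imp ?_)
    exact Dfn.of_eq₂ (icoType_eq hr 0 1 k) (icoType_eq hr 0 2 k) Eq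

theorem greedy_hom (hr : Compat r) (hcr : Dfn r P fun ρ => cr (ρ.v 0) (ρ.v 1)) (k i j : ℕ) :
    Dfn r P fun ρ => Greedy cr (Hom cr (icoType r P k) (ρ.V i)) (ρ.V j) := by
  suffices Dfn r P fun ρ => Greedy cr (Hom cr (icoType r P k) (ρ.V 0)) (ρ.V 1) from
    this.ren id fun m => if m = 0 then i else j
  refine Dfn.all1 0 ((mem 0 1).iff (Dfn.ex2 2 ?_ fun _ _ _ => Iff.rfl)) fun _ _ _ => Iff.rfl
  refine (hom hr hcr k 0 2).and ((mem 0 2).and (Dfn.all1 1 ?_ fun _ _ _ => Iff.rfl))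
  exact hcr.imp ((Dfn.lt hr 1 0).imp ((mem 1 2).iff (mem 1 1)))

end Dfn

/-- The theorem when there is a definable family of classes of order type `ω`. -/
theorem exists_undefinable_of_omegaRel [LinearOrder A] {cr : A → A → Prop} (hr : Compat r)
    (h : OmegaRel cr) (hcr : Dfn r P fun ρ => cr (ρ.v 0) (ρ.v 1)) (hne : ∃ x, cr x x) :
    ∃ Q, ¬ Definable r P Q ∧ TuringRed (TheoryCodes r (Fin.snoc P Q)) (TheoryCodes r P) := by
  have : Nonempty A := ⟨hne.choose⟩
  refine exists_undefinable_of_condSeq hr.irrefl hr.trichotomy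
    (Φ := fun X => (∀ x, x ∈ X → cr x x) ∧ Cof cr X) (W := omegaStep cr) ?_
    (Dfn.omegaStep hr hcr) fun t ht => ?_
  · refine Dfn.and (Dfn.all1 0 ?_ fun _ _ _ => Iff.rfl) (Dfn.cof hr hcr 0)
    exact (Dfn.mem 0 0).imp (hcr.rel_ren 0 0)
  · simp only [condSeq_omegaStep h t]
    refine ⟨omegaLimit cr t, between_omegaLimit h t,
      fun k => exists_between_ne h hne (omegaState_inv h t k) _, fun K => ?_⟩
    obtain ⟨k, hk⟩ := ht (fun x T => ∃ G, Greedy cr (Hom cr (icoType r P K) T) G ∧ x ∈ G)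
      (Dfn.ex2 1 ((Dfn.greedy_hom hr hcr K 0 1).and (Dfn.mem 0 1)) fun _ _ _ => Iff.rfl)
    refine ⟨k + 1, fun X X' hX hX' => ?_⟩
    have hI := omegaState_inv h t k
    rw [omegaState_succ] at hX hX'
    set S := (omegaState cr t k).1
    set T := (omegaState cr t k).2
    obtain ⟨G, hG⟩ := exists_greedy h (Hom cr (icoType r P K) T)
    have hGT : {x | t k x T} = G := by
      ext x
      rw [Set.mem_ofPred_eq, hk]
      refine ⟨?_, fun hx => ⟨G, hG, hx⟩⟩
      rintro ⟨G', hG', hx⟩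
      exact hG.unique h hG' ▸ hx
    have hH := hG.hom h (exists_hom h _ hI.right_mem hI.cof)
    have hth : Thins cr (t k) T :=
      ⟨fun x hx => hH.1 x (hGT ▸ (show x ∈ {x | t k x T} from hx)), hGT ▸ hH.2.1⟩
    have hsnd : (omegaState cr t (k + 1)).2 = G := (if_pos hth).trans hGT
    rw [hsnd] at hX hX'
    exact tp_univ_eq hr h hI hH hX hX'

theorem exists_undefinable_of_right [LinearOrder A] {D : Set A} (hr : Compat r)
    (hD : Dfn r P fun ρ => ρ.v 0 ∈ D) (huniq : ∀ d ∈ D, ∀ d' ∈ D, Near d d' → d = d')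
    {d : A} (hd : d ∈ D) (hinf : {y | Near d y ∧ d ≤ y}.Infinite) :
    ∃ Q, ¬ Definable r P Q ∧ TuringRed (TheoryCodes r (Fin.snoc P Q)) (TheoryCodes r P) := by
  let cr : A → A → Prop := fun x y => ∃ d, (d ∈ D ∧ ¬ {y | Near d y ∧ d ≤ y}.Finite) ∧
    (Near d x ∧ d ≤ x) ∧ Near d y ∧ d ≤ y
  have hcr : Dfn r P fun ρ => cr (ρ.v 0) (ρ.v 1) := by
    refine Dfn.ex1 2 (((hD.elemProp_ren 2).and (Dfn.not ?_)).and ?_) fun _ _ _ => Iff.rfl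
    · exact Dfn.of_set (S := fun ρ => {y | Near (ρ.v 2) y ∧ ρ.v 2 ≤ y}) 3 0 (Dfn.finite hr 0)
        ((Dfn.near hr 2 3).and (Dfn.le hr 2 3)) (fun _ _ => rfl) fun _ _ => rfl
    · exact ((Dfn.near hr 2 0).and (Dfn.le hr 2 0)).and ((Dfn.near hr 2 1).and (Dfn.le hr 2 1))
  refine exists_undefinable_of_omegaRel hr (cr := cr) ⟨?_, ?_, ?_, ?_, ?_⟩ hcr
    ⟨d, d, ⟨hd, hinf⟩, ⟨Near.refl d, le_rfl⟩, Near.refl d, le_rfl⟩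
  · rintro x y ⟨d, hd, hx, hy⟩
    exact ⟨d, hd, hy, hx⟩
  · rintro x y z ⟨d, hd, hx, hy⟩ ⟨d', hd', hy', hz⟩
    obtain rfl := huniq d hd.1 d' hd'.1 (hy.1.trans hy'.1.symm)
    exact ⟨d, hd, hx, hz⟩
  · intro x
    by_cases hx : cr x x
    · obtain ⟨d, hd, hx, -⟩ := hx
      refine hx.1.1.subset ?_
      rintro y ⟨⟨d', hd', hx', hy⟩, hyx⟩
      obtain rfl := huniq d hd.1 d' hd'.1 (hx.1.trans hx'.1.symm)
      exact ⟨hy.2, hyx⟩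
    · refine Set.finite_empty.subset ?_
      rintro y ⟨⟨d, hd, hx', -⟩, -⟩
      exact hx ⟨d, hd, hx', hx'⟩
  · rintro x ⟨d, hd, hx, -⟩
    obtain ⟨y, hy, hyd⟩ := Set.Infinite.exists_notMem_finite hd.2 hx.1.1
    exact ⟨y, ⟨d, hd, hx, hy⟩, not_le.1 fun hle => hyd ⟨hy.2, hle⟩⟩
  · rintro x y z ⟨d, hd, hx, hz⟩ hxy hyz
    exact ⟨d, hd, hx, hz.1.mid (hx.2.trans hxy) hyz, hx.2.trans hxy⟩

/-- The theorem when some infinite classes have a definable distinguished element. -/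
theorem exists_undefinable_of_section [LinearOrder A] {D : Set A} (hr : Compat r)
    (hD : Dfn r P fun ρ => ρ.v 0 ∈ D) (huniq : ∀ d ∈ D, ∀ d' ∈ D, Near d d' → d = d')
    {d : A} (hd : d ∈ D) (hinf : {y | Near d y}.Infinite) :
    ∃ Q, ¬ Definable r P Q ∧ TuringRed (TheoryCodes r (Fin.snoc P Q)) (TheoryCodes r P) := by
  by_cases hright : {y | Near d y ∧ d ≤ y}.Infinite
  · exact exists_undefinable_of_right hr hD huniq hd hright
  · have hleft : {y | Near d y ∧ y ≤ d}.Infinite := fun hfin => by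
      refine hinf (((Set.not_infinite.1 hright).union hfin).subset fun y hy => ?_)
      exact (le_total d y).imp (fun h => ⟨hy, h⟩) fun h => ⟨hy, h⟩
    have hn : ∀ x y : A, Near (A := Aᵒᵈ) x y ↔ Near x y := fun x y => near_dual
    refine exists_undefinable_of_right (A := Aᵒᵈ) (D := D) (d := d) hr.dual hD ?_ hd ?_
    · exact fun d hd d' hd' h => huniq d hd d' hd' ((hn d d').1 h)
    · refine Set.Infinite.mono (fun y hy => ?_) hleft
      exact ⟨(hn d y).2 hy.1, hy.2⟩

end

section

variable {n : ℕ} {A : Type} [LinearOrder A] {r : A → A → Prop} {P : Fin n → Set A}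

/-! ## Generic sets on infinite classes -/

/-- The class of `x` is infinite. -/
def InfClass (x : A) : Prop := ¬ {y | Near x y}.Finite

theorem near_class_eq {x y : A} (h : Near x y) : {z | Near x z} = {z | Near y z} :=
  Set.ext fun _ => ⟨fun hz => h.symm.trans hz, fun hz => h.trans hz⟩

theorem InfClass.of_near {x y : A} (hx : InfClass x) (h : Near x y) : InfClass y := by
  unfold InfClass
  rwa [← near_class_eq h]

theorem Dfn.infClass (hr : Compat r) (i : ℕ) : Dfn r P fun ρ => InfClass (ρ.v i) := by
  suffices Dfn r P fun ρ => InfClass (ρ.v 0) from this.elemProp_ren i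
  exact (Dfn.of_set (S := fun ρ => {y | Near (ρ.v 0) y}) 1 0 (Dfn.finite hr 0)
    (Dfn.near hr 0 1) (fun _ _ => rfl) fun _ _ => rfl).not

/-- Every finite condition on the class of `x` extends to one which forces `t x`. -/
def DenseAt (t : A → Set A → Prop) (x : A) : Prop :=
  ∀ w : Set A, w.Finite → (∀ a, a ∈ w → Near x a) → ∀ Z : Set A, ∃ X w' : Set A, w'.Finite ∧
    (∀ a, a ∈ w' → Near x a) ∧ (∀ a, a ∈ w → (a ∈ X ↔ a ∈ Z)) ∧
    ∀ X' : Set A, (∀ a, a ∈ w' → (a ∈ X' ↔ a ∈ X)) → t x X'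

theorem Dfn.denseAt (hr : Compat r) (i : ℕ) : Dfn r P fun ρ => DenseAt ρ.t (ρ.v i) := by
  suffices Dfn r P fun ρ => DenseAt ρ.t (ρ.v 0) from this.ren (fun _ => i) id
  refine Dfn.all2 0 ((Dfn.finite hr 0).imp (Dfn.imp ?_ ?_)) fun _ _ _ => Iff.rfl
  · exact Dfn.all1 1 ((Dfn.mem 1 0).imp (Dfn.near hr 0 1)) fun _ _ _ => Iff.rfl
  · refine Dfn.all2 1 (Dfn.ex2 2 (Dfn.ex2 3 ?_ fun _ _ _ => Iff.rfl) fun _ _ _ => Iff.rfl)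
      fun _ _ _ => Iff.rfl
    refine (Dfn.finite hr 3).and (Dfn.and ?_ (Dfn.and ?_ ?_))
    · exact Dfn.all1 1 ((Dfn.mem 1 3).imp (Dfn.near hr 0 1)) fun _ _ _ => Iff.rfl
    · exact Dfn.all1 1 ((Dfn.mem 1 0).imp ((Dfn.mem 1 2).iff (Dfn.mem 1 1))) fun _ _ _ => Iff.rfl
    · refine Dfn.all2 4 (Dfn.imp ?_ (Dfn.pointHole 0 4)) fun _ _ _ => Iff.rfl
      exact Dfn.all1 1 ((Dfn.mem 1 3).imp ((Dfn.mem 1 4).iff (Dfn.mem 1 2))) fun _ _ _ => Iff.rfl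

/-- Impose a requirement which is dense on all infinite classes. -/
def genStep (p : Set A → Prop) (t : A → Set A → Prop) (X : Set A) : Prop :=
  p X ∧ ((∀ x, InfClass x → DenseAt t x) → ∀ x, InfClass x → t x X)

theorem Dfn.genStep (hr : Compat r) : Dfn r P fun ρ => genStep ρ.p ρ.t (ρ.V 0) := by
  refine (Dfn.setHole 0).and (Dfn.imp ?_ ?_)
  · exact Dfn.all1 0 ((Dfn.infClass hr 0).imp (Dfn.denseAt hr 0)) fun _ _ _ => Iff.rfl
  · exact Dfn.all1 0 ((Dfn.infClass hr 0).imp (Dfn.pointHole 0 0)) fun _ _ _ => Iff.rfl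

/-- A set of elements of infinite classes satisfying all dense requirements. -/
def Generic (t : ℕ → A → Set A → Prop) (X : Set A) : Prop :=
  (∀ x, x ∈ X → InfClass x) ∧
    ∀ k, (∀ x, InfClass x → DenseAt (t k) x) → ∀ x, InfClass x → t k x X

theorem condSeq_genStep {t : ℕ → A → Set A → Prop} {X : Set A} (k : ℕ) :
    condSeq genStep (fun X => ∀ x, x ∈ X → InfClass x) t k X ↔
      (∀ x, x ∈ X → InfClass x) ∧
        ∀ j < k, (∀ x, InfClass x → DenseAt (t j) x) → ∀ x, InfClass x → t j x X := by
  induction k with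
  | zero => simp [condSeq]
  | succ k ih =>
    simp only [condSeq, genStep]
    rw [ih]
    refine ⟨fun h => ⟨h.1.1, fun j hj => ?_⟩, fun h => ⟨⟨h.1, fun j hj => h.2 j (by omega)⟩,
      h.2 k (by omega)⟩⟩
    rcases Nat.lt_succ_iff_lt_or_eq.1 hj with hj | rfl
    · exact h.1.2 j hj
    · exact h.2

theorem countable_near (x : A) : {y | Near x y}.Countable := by
  have key : ∀ {B : Type} [LinearOrder B] (x : B), {y | Near x y ∧ x ≤ y}.Countable := by
    intro B _ x
    have hinj : Set.InjOn (fun y => (Set.Icc x y).ncard) {y | Near x y ∧ x ≤ y} := by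
      have hlt : ∀ y, x ≤ y → ∀ z, Near x z → y < z →
          (Set.Icc x y).ncard < (Set.Icc x z).ncard := fun y hy z hz hyz =>
        Set.ncard_lt_ncard ⟨Set.Icc_subset_Icc_right hyz.le,
          fun hs => absurd (hs ⟨hy.trans hyz.le, le_rfl⟩).2 (not_le.2 hyz)⟩ hz.1
      intro y hy z hz hyz
      rcases lt_trichotomy y z with h | h | h
      · exact absurd hyz (hlt y hy.2 z hz.1 h).ne
      · exact h
      · exact absurd hyz (hlt z hz.2 y hy.1 h).ne'
    exact (Set.mapsTo_univ _ _).countable_of_injOn hinj Set.countable_univ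
  refine ((key x).union (key (B := Aᵒᵈ) x)).mono fun y hy => ?_
  exact (le_total x y).imp (fun h => ⟨hy, h⟩) fun h => ⟨near_dual.2 hy, h⟩

/-- A generic set on one class. -/
theorem exists_generic_on_class (t : ℕ → A → Set A → Prop) {x : A} (hx : InfClass x)
    {w₀ : Set A} (hw₀ : w₀.Finite) (hw₀x : ∀ a ∈ w₀, Near x a) (Z₀ : Set A) :
    ∃ F : Set A, (∀ a ∈ w₀, a ∈ F ↔ a ∈ Z₀) ∧ ∀ k, (∀ x, InfClass x → DenseAt (t k) x) →
      ∀ y, Near x y → ∀ X, (∀ a, Near x a → (a ∈ X ↔ a ∈ F)) → t k y X := by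
  let C := {y | Near x y}
  have hC : Countable C := countable_near x
  have hne : Nonempty C := ⟨⟨x, Near.refl x⟩⟩
  obtain ⟨g, hg⟩ := exists_surjective_nat (ℕ × C)
  let St := {s : Set A × Set A // s.1.Finite ∧ ∀ a ∈ s.1, Near x a}
  have hstep : ∀ (m : ℕ) (s : St), ∃ s' : St, s.1.1 ⊆ s'.1.1 ∧
      (∀ a ∈ s.1.1, a ∈ s'.1.2 ↔ a ∈ s.1.2) ∧
      ((∀ x, InfClass x → DenseAt (t (g m).1) x) →
        ∀ X', (∀ a ∈ s'.1.1, a ∈ X' ↔ a ∈ s'.1.2) → t (g m).1 (g m).2 X') := by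
    intro m s
    by_cases hd : ∀ x, InfClass x → DenseAt (t (g m).1) x
    · have hxy : Near x (g m).2 := (g m).2.2
      obtain ⟨X, w', hw', hw'x, hXZ, hX⟩ := hd _ (hx.of_near hxy) s.1.1 s.2.1
        (fun a ha => hxy.symm.trans (s.2.2 a ha)) s.1.2
      refine ⟨⟨(s.1.1 ∪ w', X), s.2.1.union hw', ?_⟩, Set.subset_union_left, hXZ,
        fun _ X' hX' => hX X' fun a ha => hX' a (.inr ha)⟩
      rintro a (ha | ha)
      · exact s.2.2 a ha
      · exact hxy.trans (hw'x a ha)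
    · exact ⟨s, subset_rfl, fun _ _ => Iff.rfl, fun h => absurd h hd⟩
  choose next hsub hagree hforce using hstep
  let s : ℕ → St := fun m => m.rec ⟨(w₀, Z₀), hw₀, hw₀x⟩ next
  have hmono : ∀ {i j}, i ≤ j → (s i).1.1 ⊆ (s j).1.1 ∧
      ∀ a ∈ (s i).1.1, a ∈ (s j).1.2 ↔ a ∈ (s i).1.2 := by
    intro i j hij
    induction j, hij using Nat.le_induction with
    | base => exact ⟨subset_rfl, fun _ _ => Iff.rfl⟩
    | succ j _ ih =>
      exact ⟨ih.1.trans (hsub j (s j)), fun a ha =>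
        (hagree j (s j) a (ih.1 ha)).trans (ih.2 a ha)⟩
  have hF : ∀ i, ∀ a ∈ (s i).1.1, (∃ j, a ∈ (s j).1.1 ∧ a ∈ (s j).1.2) ↔ a ∈ (s i).1.2 := by
    refine fun i a ha => ⟨?_, fun h => ⟨i, ha, h⟩⟩
    rintro ⟨j, hj, hj'⟩
    rcases le_total i j with hij | hij
    · exact ((hmono hij).2 a ha).1 hj'
    · exact ((hmono hij).2 a hj).2 hj'
  refine ⟨{a | ∃ j, a ∈ (s j).1.1 ∧ a ∈ (s j).1.2}, hF 0, fun k hk y hy X hX => ?_⟩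
  obtain ⟨m, hm⟩ := hg (k, ⟨y, hy⟩)
  have := hforce m (s m) (by rwa [hm]) X fun a ha =>
    (hX a ((s (m + 1)).2.2 a ha)).trans (hF (m + 1) a ha)
  rwa [hm] at this

theorem exists_generic (t : ℕ → A → Set A → Prop) {x₀ : A} (hx₀ : InfClass x₀) (Z : Set A) :
    ∃ Q, Generic t Q ∧ (x₀ ∈ Q ↔ x₀ ∈ Z) := by
  have key : ∀ c : Set A, ∃ F : Set A, ∀ x, InfClass x → c = {y | Near x y} →
      (∀ a, Near x a → a = x₀ → (a ∈ F ↔ a ∈ Z)) ∧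
      ∀ k, (∀ x, InfClass x → DenseAt (t k) x) →
        ∀ y, Near x y → ∀ X, (∀ a, Near x a → (a ∈ X ↔ a ∈ F)) → t k y X := by
    intro c
    by_cases hc : ∃ x, InfClass x ∧ c = {y | Near x y}
    · obtain ⟨x, hx, rfl⟩ := hc
      obtain ⟨F, hF, hF'⟩ := exists_generic_on_class t hx (w₀ := {a | Near x a ∧ a = x₀})
        ((Set.finite_singleton x₀).subset fun a ha => ha.2) (fun a ha => ha.1) Z
      refine ⟨F, fun x' _ hxx' => ?_⟩
      have hn : ∀ a, Near x' a ↔ Near x a := fun a => (Set.ext_iff.1 hxx' a).symm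
      simp only [hn]
      exact ⟨fun a ha ha' => hF a ⟨ha, ha'⟩, hF'⟩
    · exact ⟨∅, fun x hx hcx => absurd ⟨x, hx, hcx⟩ hc⟩
  choose F hF using key
  refine ⟨{a | InfClass a ∧ a ∈ F {y | Near a y}}, ⟨fun x hx => hx.1, fun k hk x hx => ?_⟩, ?_⟩
  · refine (hF _ x hx rfl).2 k hk x (Near.refl x) _ fun a ha => ?_
    refine (and_iff_right (hx.of_near ha)).trans ?_
    rw [near_class_eq ha]
  · exact (and_iff_right hx₀).trans ((hF _ x₀ hx₀ rfl).1 x₀ (Near.refl x₀) rfl)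

/-- It suffices to find finitely many dense requirements determining the types. -/
theorem exists_undefinable_of_dense (hr : Compat r) {x₀ : A} (hx₀ : InfClass x₀)
    (H : ∀ K, ∃ (J : Type) (_ : Finite J) (R : J → A → Set A → Prop),
      (∀ j, Dfn r P fun ρ => R j (ρ.v 0) (ρ.V 0)) ∧ (∀ j x, InfClass x → DenseAt (R j) x) ∧
      ∀ X X' : Set A, (∀ x, x ∈ X → InfClass x) → (∀ x, x ∈ X' → InfClass x) →
        (∀ j x, InfClass x → R j x X) → (∀ j x, InfClass x → R j x X') →
        tp r K Set.univ (ext P X) = tp r K Set.univ (ext P X')) :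
    ∃ Q, ¬ Definable r P Q ∧ TuringRed (TheoryCodes r (Fin.snoc P Q)) (TheoryCodes r P) := by
  have : Nonempty A := ⟨x₀⟩
  refine exists_undefinable_of_condSeq hr.irrefl hr.trichotomy
    (Φ := fun X => ∀ x, x ∈ X → InfClass x) (W := genStep) ?_ (Dfn.genStep hr) fun t ht => ?_
  · exact Dfn.all1 0 ((Dfn.mem 0 0).imp (Dfn.infClass hr 0)) fun _ _ _ => Iff.rfl
  · obtain ⟨Q, hQ, hxQ⟩ := exists_generic t hx₀ Set.univ
    obtain ⟨Q', hQ', hxQ'⟩ := exists_generic t hx₀ ∅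
    have hgen : ∀ {X}, Generic t X → ∀ k,
        condSeq genStep (fun X => ∀ x, x ∈ X → InfClass x) t k X :=
      fun hX k => (condSeq_genStep k).2 ⟨hX.1, fun j _ => hX.2 j⟩
    refine ⟨Q, hgen hQ, fun k => ⟨Q', fun he => ?_, hgen hQ' k⟩, fun K => ?_⟩
    · exact hxQ'.1 (he ▸ hxQ.2 trivial)
    · obtain ⟨J, hJ, R, hR, hd, htp⟩ := H K
      choose m hm using fun j => ht (R j) (hR j)
      obtain ⟨N, hN⟩ := (Set.finite_range m).bddAbove
      have hsat : ∀ X, condSeq genStep (fun X => ∀ x, x ∈ X → InfClass x) t (N + 1) X →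
          ∀ j x, InfClass x → R j x X := fun X hX j => by
        have := ((condSeq_genStep _).1 hX).2 (m j) (Nat.lt_succ_of_le (hN ⟨j, rfl⟩))
        rw [hm] at this
        exact this (hd j)
      exact ⟨N + 1, fun X X' hX hX' => htp X X' ((condSeq_genStep _).1 hX).1
        ((condSeq_genStep _).1 hX').1 (hsat X hX) (hsat X' hX')⟩

end

section

variable {n : ℕ} {A : Type} [LinearOrder A] {r : A → A → Prop} {P : Fin n → Set A}

/-! ## Recurrence -/

/-- No infinite class has a definable distinguished element. -/
def NoSection (r : A → A → Prop) (P : Fin n → Set A) : Prop :=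
  ∀ D : Set A, (Dfn r P fun ρ => ρ.v 0 ∈ D) → (∀ d ∈ D, ∀ d' ∈ D, Near d d' → d = d') →
    ∀ d ∈ D, ¬ InfClass d

theorem NoSection.dual (h : NoSection r P) : NoSection (A := Aᵒᵈ) r P := by
  have hn : ∀ x y : A, Near (A := Aᵒᵈ) x y ↔ Near x y := fun x y => near_dual
  intro D hD hu d hd hinf
  refine h D hD (fun d hd d' hd' hdd => hu d hd d' hd' ((hn d d').2 hdd)) d hd fun hfin => hinf ?_
  exact hfin.subset fun y hy => (hn d y).1 hy

theorem NoSection.exists_gt (hr : Compat r) (h : NoSection r P) {E : Set A}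
    (hE : Dfn r P fun ρ => ρ.v 0 ∈ E) {e x : A} (he : e ∈ E) (hinf : InfClass e)
    (hx : Near e x) : ∃ e' ∈ E, Near e e' ∧ x < e' := by
  by_contra! hn
  have hex : e ≤ x := hn e he (Near.refl e)
  obtain ⟨m, hm, hmax⟩ := Set.exists_max_image (Set.Icc e x ∩ E) id
    (hx.1.inter_of_left E) ⟨e, ⟨le_rfl, hex⟩, he⟩
  have hem : Near e m := hx.mid hm.1.1 hm.1.2
  refine h {d | d ∈ E ∧ ∀ y, y ∈ E → Near d y → y ≤ d} ?_ ?_ m ⟨hm.2, fun y hy hmy => ?_⟩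
    (hinf.of_near hem)
  · refine hE.and (Dfn.all1 1 ?_ fun _ _ _ => Iff.rfl)
    exact (hE.elemProp_ren 1).imp ((Dfn.near hr 0 1).imp (Dfn.le hr 1 0))
  · exact fun d hd d' hd' hdd => le_antisymm (hd'.2 d hd.1 hdd.symm) (hd.2 d' hd'.1 hdd)
  · rcases le_total e y with hey | hey
    · exact hmax y ⟨⟨hey, hn y hy (hem.trans hmy)⟩, hy⟩
    · exact hey.trans hm.1.1

theorem NoSection.exists_lt (hr : Compat r) (h : NoSection r P) {E : Set A}
    (hE : Dfn r P fun ρ => ρ.v 0 ∈ E) {e x : A} (he : e ∈ E) (hinf : InfClass e)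
    (hx : Near e x) : ∃ e' ∈ E, Near e e' ∧ e' < x := by
  have hn : ∀ x y : A, Near (A := Aᵒᵈ) x y ↔ Near x y := fun x y => near_dual
  obtain ⟨e', h1, h2, h3⟩ := NoSection.exists_gt (A := Aᵒᵈ) hr.dual h.dual (E := E) hE (e := e)
    (x := x) he (fun hfin => hinf (hfin.subset fun y hy => (hn e y).2 hy)) ((hn e x).2 hx)
  exact ⟨e', h1, (hn e e').1 h2, h3⟩

/-- Two consecutive intervals of prescribed types. -/
def Pat (r : A → A → Prop) {ι : Type} {k : ℕ} (W : ι → Set A) (s t : Ty k ι) (x y z : A) : Prop :=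
  (x < y ∧ y < z) ∧ tp r k (Set.Ico x y) W = s ∧ tp r k (Set.Ico y z) W = t

theorem Dfn.pat (hr : Compat r) {k : ℕ} (s t : Ty k (Option (Fin n))) (x y z j : ℕ) :
    Dfn r P fun ρ => Pat r (ext P (ρ.V j)) s t (ρ.v x) (ρ.v y) (ρ.v z) :=
  ((Dfn.lt hr x y).and (Dfn.lt hr y z)).and ((Dfn.ico_tp hr x y j k s).and (Dfn.ico_tp hr y z j k t))

theorem Dfn.pat_base (hr : Compat r) {k : ℕ} (s t : Ty k (Fin n)) (x y z : ℕ) :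
    Dfn r P fun ρ => Pat r P s t (ρ.v x) (ρ.v y) (ρ.v z) := by
  have key : ∀ (s : Ty k (Fin n)) (x y : ℕ),
      Dfn r P fun ρ => tp r k (Set.Ico (ρ.v x) (ρ.v y)) P = s := fun s x y => by
    refine Dfn.rel_ren (R := fun x y => tp r k (Set.Ico x y) P = s) ?_ x y
    exact Dfn.of_set (S := fun ρ => Set.Ico (ρ.v 0) (ρ.v 1)) (R := fun B => tp r k B P = s) 2 0
      (Dfn.tp_eq k 0 Sum.inl s) ((Dfn.le hr 0 2).and (Dfn.lt hr 2 1)) (fun _ _ => rfl)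
      fun _ _ => rfl
  exact ((Dfn.lt hr x y).and (Dfn.lt hr y z)).and ((key s x y).and (key t y z))

/-- The interval from `y` to `z` lies strictly on one side of `x`. -/
def Side (b : Bool) (x y z : A) : Prop := cond b (x < y) (z < x)

theorem NoSection.exists_pat (hr : Compat r) (h : NoSection r P) {k : ℕ} {s t : Ty k (Fin n)}
    {x y z a : A} (hinf : InfClass x) (hxz : Near x z) (hp : Pat r P s t x y z) (ha : Near x a)
    (b : Bool) : ∃ x' y' z', Near x x' ∧ Near x z' ∧ Side b a x' z' ∧ Pat r P s t x' y' z' := by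
  cases b with
  | true =>
    obtain ⟨e, ⟨y', z', hn, hp'⟩, he, hlt⟩ := h.exists_gt hr
      (E := {e | ∃ y z, Near e z ∧ Pat r P s t e y z})
      (Dfn.ex1 1 (Dfn.ex1 2 ((Dfn.near hr 0 2).and (Dfn.pat_base hr s t 0 1 2))
        fun _ _ _ => Iff.rfl) fun _ _ _ => Iff.rfl) ⟨y, z, hxz, hp⟩ hinf ha
    exact ⟨e, y', z', he, he.trans hn, hlt, hp'⟩
  | false =>
    obtain ⟨e, ⟨x', y', hn, hp'⟩, he, hlt⟩ := h.exists_lt hr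
      (E := {e | ∃ x y, Near x e ∧ Pat r P s t x y e})
      (Dfn.ex1 1 (Dfn.ex1 2 ((Dfn.near hr 1 0).and (Dfn.pat_base hr s t 1 2 0))
        fun _ _ _ => Iff.rfl) fun _ _ _ => Iff.rfl) ⟨x, y, hxz, hp⟩ (hinf.of_near hxz)
        (hxz.symm.trans ha)
    have := hxz.trans he
    exact ⟨x', y', e, this.trans hn.symm, this, hlt, hp'⟩

/-- Some expansion has the pattern in the class of `x`. -/
def Realizable (r : A → A → Prop) (P : Fin n → Set A) {k : ℕ} (s t : Ty k (Option (Fin n)))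
    (x : A) : Prop :=
  ∃ Y : Set A, ∃ a b c, Near x a ∧ Near x c ∧ Pat r (ext P Y) s t a b c

/-- A realizable pattern occurs on the given side of `x`. -/
def Recurs (r : A → A → Prop) (P : Fin n → Set A) {k : ℕ} (s t : Ty k (Option (Fin n))) (d : Bool)
    (x : A) (X : Set A) : Prop :=
  Realizable r P s t x → ∃ a b c, Near x a ∧ Near x c ∧ Side d x a c ∧ Pat r (ext P X) s t a b c

theorem Dfn.recurs (hr : Compat r) {k : ℕ} (s t : Ty k (Option (Fin n))) (d : Bool) :
    Dfn r P fun ρ => Recurs r P s t d (ρ.v 0) (ρ.V 0) := by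
  have hs : Dfn r P fun ρ => Side d (ρ.v 0) (ρ.v 1) (ρ.v 3) := by
    cases d
    · exact Dfn.lt hr 3 0
    · exact Dfn.lt hr 0 1
  refine Dfn.imp (Dfn.ex2 1 ?_ fun _ _ _ => Iff.rfl) ?_
  · refine Dfn.ex1 1 (Dfn.ex1 2 (Dfn.ex1 3 ?_ fun _ _ _ => Iff.rfl) fun _ _ _ => Iff.rfl)
      fun _ _ _ => Iff.rfl
    exact (Dfn.near hr 0 1).and ((Dfn.near hr 0 3).and (Dfn.pat hr s t 1 2 3 1))
  · refine Dfn.ex1 1 (Dfn.ex1 2 (Dfn.ex1 3 ?_ fun _ _ _ => Iff.rfl) fun _ _ _ => Iff.rfl)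
      fun _ _ _ => Iff.rfl
    exact (Dfn.near hr 0 1).and ((Dfn.near hr 0 3).and (hs.and (Dfn.pat hr s t 1 2 3 0)))

theorem NoSection.denseAt_recurs (hr : Compat r) (h : NoSection r P) {k : ℕ}
    (s t : Ty k (Option (Fin n))) (d : Bool) {x : A} (hinf : InfClass x) :
    DenseAt (Recurs r P s t d) x := by
  intro w hw hwx Z
  by_cases hre : Realizable r P s t x
  swap
  · exact ⟨Z, ∅, Set.finite_empty, fun a ha => ha.elim, fun _ _ => Iff.rfl,
      fun _ _ h => absurd h hre⟩
  obtain ⟨Y, a, b, c, hxa, hxc, ⟨hab, hbc⟩, hs, ht⟩ := hre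
  obtain ⟨m, hm, hside⟩ : ∃ m, Near x m ∧ ∀ y z, Side d m y z →
      Side d x y z ∧ ∀ v ∈ w, v ∉ Set.Ico y z := by
    have hfin : (insert x w).Finite := hw.insert x
    have hmem : ∀ m ∈ insert x w, Near x m := by
      rintro m (rfl | hm)
      · exact Near.refl _
      · exact hwx m hm
    cases d with
    | true =>
      obtain ⟨m, hm, hmax⟩ := Set.exists_max_image _ id hfin ⟨x, Set.mem_insert x w⟩
      refine ⟨m, hmem m hm, fun y z (hs : m < y) =>
        ⟨lt_of_le_of_lt (hmax x (.inl rfl)) hs, fun v hv hvI => ?_⟩⟩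
      exact absurd (hvI.1.trans (hmax v (.inr hv))) (not_le.2 hs)
    | false =>
      obtain ⟨m, hm, hmin⟩ := Set.exists_min_image _ id hfin ⟨x, Set.mem_insert x w⟩
      refine ⟨m, hmem m hm, fun y z (hs : z < m) =>
        ⟨lt_of_lt_of_le hs (hmin x (.inl rfl)), fun v hv hvI => ?_⟩⟩
      exact absurd (hvI.2.trans hs) (not_lt.2 (hmin v (.inr hv)))
  obtain ⟨a', b', c', ha', hc', hsd, ⟨hab', hbc'⟩, hs', ht'⟩ := h.exists_pat hr
    (k := k + 1) (hinf.of_near hxa) (hxa.symm.trans hxc) ⟨⟨hab, hbc⟩, rfl, rfl⟩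
    (hxa.symm.trans hm) d
  obtain ⟨hsd', hdis⟩ := hside a' c' hsd
  obtain ⟨U, hU⟩ := (tp_succ_eq_iff.1 hs').2.2 Y
  obtain ⟨V, hV⟩ := (tp_succ_eq_iff.1 ht').2.2 Y
  have hxa' := hxa.trans ha'
  have hxc' := hxa.trans hc'
  refine ⟨{v | (v ∈ w ∧ v ∈ Z) ∨ (v ∉ w ∧ (v < b' ∧ v ∈ U ∨ b' ≤ v ∧ v ∈ V))}, Set.Ico a' c',
    (hxa'.symm.trans hxc').1.subset Set.Ico_subset_Icc_self, fun v hv => ?_, fun v hv => ?_,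
    fun X hX _ => ⟨a', b', c', hxa', hxc', hsd', ⟨hab', hbc'⟩, ?_, ?_⟩⟩
  · exact hxa'.trans ((hxa'.symm.trans hxc').mid hv.1 hv.2.le)
  · simp [hv]
  · rw [← hs, ← hU]
    refine tp_congr k (ext_congr fun v hv => ?_)
    have hvc : v ∈ Set.Ico a' c' := ⟨hv.1, hv.2.trans hbc'⟩
    rw [hX v hvc]
    have hvw : v ∉ w := fun hvw => hdis v hvw hvc
    simp [hvw, hv.2, not_le.2 hv.2]
  · rw [← ht, ← hV]
    refine tp_congr k (ext_congr fun v hv => ?_)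
    have hvc : v ∈ Set.Ico a' c' := ⟨hab'.le.trans hv.1, hv.2⟩
    rw [hX v hvc]
    have hvw : v ∉ w := fun hvw => hdis v hvw hvc
    simp [hvw, hv.1, not_lt.2 hv.1]

end

/-! ## Local monoids of finite semigroups -/

/-- The local monoid of a semigroup at an idempotent. -/
def LocalMonoid {S : Type*} [Semigroup S] (f : S) : Type _ := {s : S // f * s = s ∧ s * f = s}

section

variable {S : Type*} [Semigroup S] [Finite S] {f : S}

instance : Finite (LocalMonoid f) := inferInstanceAs (Finite {s : S // f * s = s ∧ s * f = s})

/-- The multiplication of a local monoid. -/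
@[reducible] def localMonoid (hf : f * f = f) : Monoid (LocalMonoid f) where
  mul s t := ⟨s.1 * t.1, by rw [← mul_assoc, s.2.1], by rw [mul_assoc, t.2.2]⟩
  one := ⟨f, hf, hf⟩
  mul_assoc s t u := Subtype.ext (mul_assoc s.1 t.1 u.1)
  one_mul s := Subtype.ext s.2.1
  mul_one s := Subtype.ext s.2.2

theorem mul_eq_one_symm_of_finite {M : Type*} [Monoid M] [Finite M] {a b : M} (h : a * b = 1) :
    b * a = 1 := by
  have hinj : Function.Injective (b * ·) := fun x y hxy => by
    have := congrArg (a * ·) hxy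
    simpa only [← mul_assoc, h, one_mul] using this
  obtain ⟨c, hc⟩ := Finite.surjective_of_injective hinj 1
  have : a = c := by rw [← mul_one a, ← hc]; simp only [← mul_assoc, h, one_mul]
  rw [this]; exact hc

/-- An element of a local monoid whose ideal contains the identity is invertible. -/
theorem exists_inverse (hf : f * f = f) {q u v : S} (h1 : f * q = q) (h2 : q * f = q)
    (h : f = u * q * v) : ∃ w, f * w = w ∧ w * f = w ∧ w * q = f ∧ q * w = f := by
  let _ := localMonoid hf
  have hc : ∀ s : S, f * (f * s * f) = f * s * f ∧ f * s * f * f = f * s * f := fun s => by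
    rw [mul_assoc (f * s), hf, ← mul_assoc, ← mul_assoc, hf]; exact ⟨rfl, rfl⟩
  let a : LocalMonoid f := ⟨f * u * f, hc u⟩
  let b : LocalMonoid f := ⟨q, h1, h2⟩
  let c : LocalMonoid f := ⟨f * v * f, hc v⟩
  have habc : a * (b * c) = 1 := by
    refine Subtype.ext ?_
    change f * u * f * (q * (f * v * f)) = f
    calc f * u * f * (q * (f * v * f)) = f * u * (f * q * f) * v * f := by simp only [mul_assoc]
      _ = f * (u * q * v) * f := by rw [h1, h2]; simp only [mul_assoc]
      _ = f := by rw [← h, hf, hf]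
  have hbca : b * (c * a) = 1 := by rw [← mul_assoc]; exact mul_eq_one_symm_of_finite habc
  have hcab := mul_eq_one_symm_of_finite hbca
  exact ⟨_, (c * a).2.1, (c * a).2.2, congrArg (fun s : LocalMonoid f => s.1) hcab,
    congrArg (fun s : LocalMonoid f => s.1) hbca⟩

theorem eq_of_idempotent (hf : f * f = f) {g u v : S} (h1 : f * g = g) (h2 : g * f = g)
    (hg : g * g = g) (h : f = u * g * v) : g = f := by
  obtain ⟨w, -, -, hw, -⟩ := exists_inverse hf h1 h2 h
  rw [← h1, ← hw, mul_assoc, hg]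

/-- The positive powers in a semigroup: `powSucc q n` has exponent `n + 1`. -/
def powSucc {S : Type*} [Mul S] (q : S) : ℕ → S
  | 0 => q
  | n + 1 => powSucc q n * q

theorem exists_powSucc_eq (hf : f * f = f) {q u v : S} (h1 : f * q = q) (h2 : q * f = q)
    (h : f = u * q * v) : ∃ n, powSucc q n = f := by
  let _ := localMonoid hf
  obtain ⟨w, h3, h4, h5, h6⟩ := exists_inverse hf h1 h2 h
  let b : (LocalMonoid f)ˣ :=
    ⟨⟨q, h1, h2⟩, ⟨w, h3, h4⟩, Subtype.ext h6, Subtype.ext h5⟩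
  have hfin : Finite (LocalMonoid f)ˣ := Finite.of_injective _ Units.val_injective
  obtain ⟨n, hn, hb⟩ := (isOfFinOrder_of_finite b).exists_pow_eq_one
  have key : ∀ n, powSucc q n = ((b ^ (n + 1) : (LocalMonoid f)ˣ) : LocalMonoid f).1 := fun n => by
    induction n with
    | zero => rw [zero_add, pow_one]; rfl
    | succ n ih => rw [powSucc, ih, pow_succ b (n + 1)]; rfl
  refine ⟨n - 1, ?_⟩
  rw [key, Nat.sub_add_cancel hn, hb]
  rfl

/-- Ramsey's theorem for a multiplicative colouring in a local monoid. -/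
theorem exists_subseq_eq (hf : f * f = f) {d : ℕ → ℕ → S}
    (hd : ∀ i j k, i < j → j < k → d i k = d i j * d j k ∨ d i k = d j k * d i j)
    (hc : ∀ i j, i < j → f * d i j = d i j ∧ d i j * f = d i j)
    (hu : ∀ i j, i < j → ∃ u v, f = u * d i j * v) :
    ∃ g : ℕ → ℕ, StrictMono g ∧ ∀ i j, i < j → d (g i) (g j) = f := by
  obtain ⟨g, hg, a, ha⟩ := exists_homogeneous d
  have h01 := hg (show 0 < 1 by decide)
  have h12 := hg (show 1 < 2 by decide)
  have haa : a * a = a := by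
    have := hd _ _ _ h01 h12
    rw [ha 0 1 (by decide), ha 1 2 (by decide), ha 0 2 (by decide), or_self] at this
    exact this.symm
  obtain ⟨u, v, huv⟩ := hu _ _ h01
  have hc := hc _ _ h01
  rw [ha 0 1 (by decide)] at huv hc
  obtain rfl := eq_of_idempotent hf hc.1 hc.2 haa huv
  exact ⟨g, hg, ha⟩

end

/-! ## Sequences of blocks -/

section

variable {A A' : Type} {r : A → A → Prop} {r' : A' → A' → Prop} {I : Type*} [LinearOrder I]

/-- A family of sets ordered by the relation `r` along the index. -/
def Blocks (r : A → A → Prop) (B : I → Set A) : Prop :=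
  ∀ i j, i < j → ∀ x ∈ B i, ∀ y ∈ B j, r x y ∧ ¬ r y x

theorem Blocks.index_eq {B : I → Set A} (h : Blocks r B) (i j : I) (x : A) (hi : x ∈ B i)
    (hj : x ∈ B j) : i = j := by
  rcases lt_trichotomy i j with hij | hij | hij
  · exact absurd (h i j hij x hi x hj).1 (h i j hij x hi x hj).2
  · exact hij
  · exact absurd (h j i hij x hj x hi).1 (h j i hij x hj x hi).2

theorem Blocks.tp_eq {B : I → Set A} {B' : I → Set A'} (h : Blocks r B) (h' : Blocks r' B')
    {k : ℕ} {ι : Type} {W : ι → Set A} {W' : ι → Set A'}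
    (ht : ∀ i, tp r k (B i) W = tp r' k (B' i) W') :
    tp r k (⋃ i, B i) W = tp r' k (⋃ i, B' i) W' := by
  refine tp_iUnion k h.index_eq h'.index_eq (fun i j hij x hx y hy x' hx' y' hy' => ?_) ht
  rcases hij.lt_or_gt with hij | hij
  · exact iff_of_true (h i j hij x hx y hy).1 (h' i j hij x' hx' y' hy').1
  · exact iff_of_false (h j i hij y hy x hx).2 (h' j i hij y' hy' x' hx').2

theorem tp_image {j : A → A'} (hj : Function.Injective j) (hr : ∀ x y, r x y ↔ r' (j x) (j y))
    (k : ℕ) : ∀ {ι : Type} {B : Set A} {W : ι → Set A} {W' : ι → Set A'},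
    (∀ i, ∀ x ∈ B, x ∈ W i ↔ j x ∈ W' i) → tp r k B W = tp r' k (j '' B) W' := by
  have hat : ∀ {ι : Type} {B : Set A} {W : ι → Set A} {W' : ι → Set A'},
      (∀ i, ∀ x ∈ B, x ∈ W i ↔ j x ∈ W' i) → atp r B W = atp r' (j '' B) W' := by
    intro ι B W W' h
    refine Prod.ext (funext fun a => funext fun b => propext ?_)
      (funext fun a => funext fun b => propext ?_)
    · constructor
      · rintro ⟨x, hx, h1, h2⟩
        exact ⟨j x, ⟨x, hx, rfl⟩, (h a x hx).1 h1, (h b x hx).1 h2⟩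
      · rintro ⟨_, ⟨x, hx, rfl⟩, h1, h2⟩
        exact ⟨x, hx, (h a x hx).2 h1, (h b x hx).2 h2⟩
    · constructor
      · rintro ⟨x, hx, y, hy, h1, h2, h3⟩
        exact ⟨j x, ⟨x, hx, rfl⟩, j y, ⟨y, hy, rfl⟩, (h a x hx).1 h1, (h b y hy).1 h2,
          (hr x y).1 h3⟩
      · rintro ⟨_, ⟨x, hx, rfl⟩, _, ⟨y, hy, rfl⟩, h1, h2, h3⟩
        exact ⟨x, hx, y, hy, (h a x hx).2 h1, (h b y hy).2 h2, (hr x y).2 h3⟩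
  induction k with
  | zero => exact hat
  | succ k ih =>
    intro ι B W W' h
    refine tp_succ_eq_iff.2 ⟨hat h, fun U => ⟨j '' U, ih ?_⟩, fun U' => ⟨j ⁻¹' U', ih ?_⟩⟩
    · rintro (_ | i) x hx
      · exact (hj.mem_set_image).symm
      · exact h i x hx
    · rintro (_ | i) x hx
      · rfl
      · exact h i x hx

/-- The order of an `ω`-sequence of copies of a structure. -/
def copyRel (r : A → A → Prop) (p q : ℕ × A) : Prop := p.1 < q.1 ∨ p.1 = q.1 ∧ r p.2 q.2

/-- A type one of whose powers is `f` is absorbed by an `ω`-sequence of blocks of type `f`. -/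
theorem mul_tp_iUnion {k : ℕ} {ι : Type} {W : ι → Set A} {B : ℕ → Set A} (hB : Blocks r B)
    {f : Ty k ι} (hf : ∀ i, tp r k (B i) W = f) {D : Set A} {n : ℕ}
    (hn : powSucc (tp r k D W) n = f) :
    tp r k D W * tp r k (⋃ i, B i) W = tp r k (⋃ i, B i) W := by
  let K : ℕ → Set (ℕ × A) := fun i => Prod.mk i '' D
  let V : ι → Set (ℕ × A) := fun s => {p | p.2 ∈ W s}
  have hK : Blocks (copyRel r) K := by
    rintro i j hij _ ⟨x, -, rfl⟩ _ ⟨y, -, rfl⟩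
    exact ⟨.inl hij, by rintro (h | h) <;> simp only at h <;> omega⟩
  have hKt : ∀ i, tp (copyRel r) k (K i) V = tp r k D W := fun i =>
    (tp_image (Prod.mk_right_injective i) (fun x y => by simp [copyRel]) k fun s x _ => Iff.rfl).symm
  have hS : Blocks (copyRel r) fun i => K (i + 1) := fun i j hij => hK _ _ (by omega)
  have hshift : tp (copyRel r) k (⋃ i, K (i + 1)) V = tp (copyRel r) k (⋃ i, K i) V :=
    hS.tp_eq hK fun i => (hKt _).trans (hKt _).symm
  have hun : (⋃ i, K i) = K 0 ∪ ⋃ i, K (i + 1) := Set.union_iUnion_nat_succ K |>.symm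
  have hmul : tp (copyRel r) k (⋃ i, K i) V = tp r k D W * tp (copyRel r) k (⋃ i, K i) V := by
    conv_lhs => rw [hun]
    have h0 : ∀ x ∈ K 0, ∀ y ∈ ⋃ i, K (i + 1), copyRel r x y ∧ ¬ copyRel r y x :=
      fun x hx y hy => by
        obtain ⟨i, hi⟩ := Set.mem_iUnion.1 hy
        exact hK 0 (i + 1) (by omega) x hx y hi
    rw [tp_union (fun x hx y hy => (h0 x hx y hy).1) (fun x hx y hy => (h0 x hx y hy).2)
      (Set.disjoint_left.2 fun x hx hy => (h0 x hx x hy).2 (h0 x hx x hy).1), hKt, hshift]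
  let G : ℕ → ℕ → Set (ℕ × A) := fun i m => ⋃ j ∈ Set.Icc (i * (n + 1)) (i * (n + 1) + m), K j
  have hG : ∀ i m, tp (copyRel r) k (G i m) V = powSucc (tp r k D W) m := fun i m => by
    induction m with
    | zero =>
      have hG0 : G i 0 = K (i * (n + 1)) := by
        simp only [G, add_zero, Set.Icc_self, Set.mem_singleton_iff, Set.iUnion_iUnion_eq_left]
      rw [hG0, hKt, powSucc]
    | succ m ih =>
      have hGm : G i (m + 1) = G i m ∪ K (i * (n + 1) + (m + 1)) := by
        ext x
        simp only [G, Set.mem_iUnion, Set.mem_Icc, Set.mem_union, exists_prop]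
        constructor
        · rintro ⟨j, hj, hx⟩
          rcases (show j ≤ i * (n + 1) + m ∨ j = i * (n + 1) + (m + 1) by omega) with h | rfl
          · exact .inl ⟨j, ⟨hj.1, h⟩, hx⟩
          · exact .inr hx
        · rintro (⟨j, hj, hx⟩ | hx)
          · exact ⟨j, ⟨hj.1, by omega⟩, hx⟩
          · exact ⟨_, ⟨by omega, le_rfl⟩, hx⟩
      have h0 : ∀ x ∈ G i m, ∀ y ∈ K (i * (n + 1) + (m + 1)),
          copyRel r x y ∧ ¬ copyRel r y x := fun x hx y hy => by
        simp only [G, Set.mem_iUnion, Set.mem_Icc, exists_prop] at hx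
        obtain ⟨j, hj, hx⟩ := hx
        exact hK _ _ (by omega) x hx y hy
      rw [hGm, tp_union (fun x hx y hy => (h0 x hx y hy).1) (fun x hx y hy => (h0 x hx y hy).2)
        (Set.disjoint_left.2 fun x hx hy => (h0 x hx x hy).2 (h0 x hx x hy).1), ih, hKt]
      rfl
  have hGB : Blocks (copyRel r) fun i => G i n := fun i j hij x hx y hy => by
    simp only [G, Set.mem_iUnion, Set.mem_Icc, exists_prop] at hx hy
    obtain ⟨a, ha, hx⟩ := hx
    obtain ⟨b, hb, hy⟩ := hy
    have : (i + 1) * (n + 1) ≤ j * (n + 1) := Nat.mul_le_mul_right _ hij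
    exact hK a b (by linarith) x hx y hy
  have hGK : (⋃ i, G i n) = ⋃ i, K i := by
    ext x
    simp only [G, Set.mem_iUnion, Set.mem_Icc, exists_prop]
    constructor
    · rintro ⟨i, j, -, hx⟩
      exact ⟨j, hx⟩
    · rintro ⟨j, hx⟩
      refine ⟨j / (n + 1), j, ⟨Nat.div_mul_le_self _ _, ?_⟩, hx⟩
      have h1 := Nat.div_add_mod' j (n + 1)
      have h2 : j % (n + 1) < n + 1 := Nat.mod_lt j n.succ_pos
      omega
  have hR : tp r k (⋃ i, B i) W = tp (copyRel r) k (⋃ i, K i) V := by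
    rw [← hGK]
    exact hB.tp_eq hGB fun i => (hf i).trans (hn.symm.trans (hG i n).symm)
  rw [hR, ← hmul]

end

section

variable {n : ℕ} {A : Type} [LinearOrder A] {r : A → A → Prop} {P : Fin n → Set A}

/-! ## The type of a recurrent class -/

theorem exists_lt_of_strictMono {x : A} {y : ℕ → A} (hy : StrictMono y)
    (hn : ∀ i, Near x (y i)) {b : A} (hb : Near x b) : ∃ i, b < y i := by
  by_contra! h
  refine Set.infinite_of_injective_forall_mem hy.injective (fun i => ?_)
    ((hn 0).symm.trans hb).1
  exact ⟨hy.monotone i.zero_le, h i⟩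

theorem exists_gt_of_strictAnti {x : A} {y : ℕ → A} (hy : StrictAnti y)
    (hn : ∀ i, Near x (y i)) {b : A} (hb : Near x b) : ∃ i, y i < b := by
  by_contra! h
  refine Set.infinite_of_injective_forall_mem hy.injective (fun i => ?_)
    (hb.symm.trans (hn 0)).1
  exact ⟨h i, hy.antitone i.zero_le⟩

theorem tp_ico_mul (hlt : ∀ x y, r x y ↔ x < y) {k : ℕ} {ι : Type} (W : ι → Set A) {x y z : A}
    (hxy : x ≤ y) (hyz : y ≤ z) :
    tp r k (Set.Ico x z) W = tp r k (Set.Ico x y) W * tp r k (Set.Ico y z) W := by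
  have h : ∀ a ∈ Set.Ico x y, ∀ b ∈ Set.Ico y z, a < b := fun a ha b hb => ha.2.trans_le hb.1
  rw [← Set.Ico_union_Ico_eq_Ico hxy hyz]
  exact tp_union (fun a ha b hb => (hlt a b).2 (h a ha b hb))
    (fun a ha b hb hr => (h a ha b hb).not_gt ((hlt b a).1 hr))
    (Set.disjoint_left.2 fun a ha hb => lt_irrefl _ (h a ha a hb)) k W

theorem Realizable.of_near {k : ℕ} {s t : Ty k (Option (Fin n))} {x y : A}
    (h : Realizable r P s t x) (hxy : Near x y) : Realizable r P s t y := by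
  obtain ⟨Y, a, b, c, ha, hc, hp⟩ := h
  exact ⟨Y, a, b, c, hxy.symm.trans ha, hxy.symm.trans hc, hp⟩

/-- All realizable patterns recur in the class of `x`. -/
def Recurrent (r : A → A → Prop) (P : Fin n → Set A) (k : ℕ) (x : A) (X : Set A) : Prop :=
  ∀ (s t : Ty k (Option (Fin n))) d y, Near x y → Recurs r P s t d y X

theorem Recurrent.exists_pat {k : ℕ} {x : A} {X : Set A} (h : Recurrent r P k x X)
    {s t : Ty k (Option (Fin n))} (hst : Realizable r P s t x) (d : Bool) {y : A}
    (hy : Near x y) : ∃ a b c, Near x a ∧ Near x b ∧ Near x c ∧ Side d y a c ∧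
      Pat r (ext P X) s t a b c := by
  obtain ⟨a, b, c, ha, hc, hd, hp⟩ := h s t d y hy (hst.of_near hy)
  have hxa := hy.trans ha
  have hxc := hy.trans hc
  exact ⟨a, b, c, hxa, hxa.trans ((hxa.symm.trans hxc).mid hp.1.1.le hp.1.2.le), hxc, hd, hp⟩

/-- An idempotent type below all types of intervals of the class of `x`. -/
structure Kernel (r : A → A → Prop) (P : Fin n → Set A) {k : ℕ} (x : A)
    (f : Ty k (Option (Fin n))) : Prop where
  idem : f * f = f
  real : Realizable r P f f x
  le : ∀ s t, Realizable r P s t x → ∃ u v, f = u * s * v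

theorem exists_kernel (hlt : ∀ x y, r x y ↔ x < y) {k : ℕ} {x : A} {X : Set A}
    (hup : ∀ y, Near x y → ∃ z, Near x z ∧ y < z) (hX : Recurrent r P k x X) :
    ∃ f : Ty k (Option (Fin n)), Kernel r P x f := by
  choose nx hnx using fun y : {y // Near x y} => hup y.1 y.2
  let y : ℕ → {y // Near x y} := fun i => (fun z => ⟨nx z, (hnx z).1⟩)^[i] ⟨x, Near.refl x⟩
  have hy : StrictMono fun i => (y i : A) := strictMono_nat_of_lt_succ fun i => by
    simp only [y, Function.iterate_succ_apply']
    exact (hnx _).2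
  obtain ⟨g, hg, f, hf⟩ := exists_homogeneous fun i j =>
    tp r k (Set.Ico (y i : A) (y j)) (ext P X)
  have h01 : g 0 < g 1 := hg (by decide)
  have h12 : g 1 < g 2 := hg (by decide)
  refine ⟨f, ?_, ?_, fun s t hst => ?_⟩
  · conv_rhs => rw [← hf 0 2 (by decide), tp_ico_mul hlt _ (hy h01).le (hy h12).le,
      hf 0 1 (by decide), hf 1 2 (by decide)]
  · exact ⟨X, y (g 0), y (g 1), y (g 2), (y _).2, (y _).2, ⟨hy h01, hy h12⟩,
      hf 0 1 (by decide), hf 1 2 (by decide)⟩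
  · obtain ⟨a, b, c, -, hb, -, hd, hp⟩ := hX.exists_pat hst true (y (g 0)).2
    obtain ⟨i, hi⟩ := exists_lt_of_strictMono (hy.comp hg) (fun i => (y _).2) hb
    have hd : (y (g 0) : A) < a := hd
    have hi : b < y (g i) := hi
    have h0i : 0 < i := by
      by_contra h
      obtain rfl : i = 0 := by omega
      exact absurd (hi.trans (hd.trans hp.1.1)) (lt_irrefl _)
    refine ⟨tp r k (Set.Ico (y (g 0) : A) a) (ext P X), tp r k (Set.Ico b (y (g i))) (ext P X), ?_⟩
    rw [← hf 0 i h0i, tp_ico_mul hlt _ (hd.trans hp.1.1).le hi.le,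
      tp_ico_mul hlt _ hd.le hp.1.1.le, hp.2.1]

theorem Kernel.exists_mul {k : ℕ} {x : A} {f : Ty k (Option (Fin n))} (hf : Kernel r P x f)
    (hup : ∀ y, Near x y → ∃ z, Near x z ∧ y < z) (X : Set A) {a b : A} (ha : Near x a)
    (hb : Near x b) (hab : a < b) : ∃ u v, f = u * tp r k (Set.Ico a b) (ext P X) * v := by
  obtain ⟨c, hc, hbc⟩ := hup b hb
  exact hf.le _ _ ⟨X, a, b, c, ha, hc, ⟨hab, hbc⟩, rfl, rfl⟩

theorem Kernel.corner {k : ℕ} {x : A} {f : Ty k (Option (Fin n))} (hf : Kernel r P x f)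
    (s : Ty k (Option (Fin n))) : f * (f * s * f) = f * s * f ∧ f * s * f * f = f * s * f := by
  rw [mul_assoc (f * s), hf.idem, ← mul_assoc, ← mul_assoc, hf.idem]
  exact ⟨rfl, rfl⟩

theorem Kernel.exists_right (hlt : ∀ x y, r x y ↔ x < y) {k : ℕ} {x : A} {X : Set A}
    (hup : ∀ y, Near x y → ∃ z, Near x z ∧ y < z) (hX : Recurrent r P k x X)
    {f : Ty k (Option (Fin n))} (hf : Kernel r P x f) :
    ∃ b : ℕ → A, StrictMono b ∧ (∀ i, Near x (b i) ∧ x < b i) ∧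
      ∀ i, tp r k (Set.Ico (b i) (b (i + 1))) (ext P X) = f := by
  choose lo md hi h1 h2 h3 h4 h5 using fun y : {y // Near x y} => hX.exists_pat hf.real true y.2
  have h4 : ∀ y : {y // Near x y}, (y : A) < lo y := h4
  let z : ℕ → {y // Near x y} := fun i => (fun y => ⟨hi y, h3 y⟩)^[i] ⟨x, Near.refl x⟩
  have hz1 : ∀ i, (z (i + 1) : A) = hi (z i) := fun i => by
    simp only [z, Function.iterate_succ_apply']
  have hz : StrictMono fun i => (z i : A) := strictMono_nat_of_lt_succ fun i => by
    rw [hz1]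
    exact (h4 _).trans ((h5 _).1.1.trans (h5 _).1.2)
  have hzl : ∀ {i j}, i < j → hi (z i) ≤ lo (z j) := fun {i j} hij =>
    (hz1 i).symm.le.trans ((hz.monotone hij).trans (h4 _).le)
  have hy : StrictMono fun i => md (z i) := fun i j hij =>
    (h5 _).1.2.trans_le ((hzl hij).trans (h5 _).1.1.le)
  have hd : ∀ i j, i < j → tp r k (Set.Ico (md (z i)) (md (z j))) (ext P X) =
      f * tp r k (Set.Ico (hi (z i)) (lo (z j))) (ext P X) * f := fun i j hij => by
    rw [tp_ico_mul hlt _ ((h5 (z i)).1.2.le.trans (hzl hij)) (h5 (z j)).1.1.le,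
      tp_ico_mul hlt _ (h5 (z i)).1.2.le (hzl hij), (h5 (z i)).2.2, (h5 (z j)).2.1]
  obtain ⟨g, hg, hgf⟩ := exists_subseq_eq hf.idem
    (d := fun i j => tp r k (Set.Ico (md (z i)) (md (z j))) (ext P X))
    (fun i j l hij hjl => .inl (tp_ico_mul hlt _ (hy hij).le (hy hjl).le))
    (fun i j hij => by
      rw [hd i j hij]
      exact hf.corner _)
    fun i j hij => hf.exists_mul hup X (h2 _) (h2 _) (hy hij)
  refine ⟨fun i => md (z (g i)), hy.comp hg, fun i => ⟨h2 _, ?_⟩,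
    fun i => hgf _ _ i.lt_succ_self⟩
  exact (hz.monotone (g i).zero_le).trans_lt ((h4 _).trans (h5 _).1.1)

theorem Kernel.exists_left (hlt : ∀ x y, r x y ↔ x < y) {k : ℕ} {x : A} {X : Set A}
    (hup : ∀ y, Near x y → ∃ z, Near x z ∧ y < z) (hX : Recurrent r P k x X)
    {f : Ty k (Option (Fin n))} (hf : Kernel r P x f) :
    ∃ a : ℕ → A, StrictAnti a ∧ (∀ i, Near x (a i) ∧ a i < x) ∧
      ∀ i, tp r k (Set.Ico (a (i + 1)) (a i)) (ext P X) = f := by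
  choose lo md hi h1 h2 h3 h4 h5 using fun y : {y // Near x y} => hX.exists_pat hf.real false y.2
  have h4 : ∀ y : {y // Near x y}, hi y < (y : A) := h4
  let z : ℕ → {y // Near x y} := fun i => (fun y => ⟨lo y, h1 y⟩)^[i] ⟨x, Near.refl x⟩
  have hz1 : ∀ i, (z (i + 1) : A) = lo (z i) := fun i => by
    simp only [z, Function.iterate_succ_apply']
  have hz : StrictAnti fun i => (z i : A) := strictAnti_nat_of_succ_lt fun i => by
    rw [hz1]
    exact (h5 _).1.1.trans ((h5 _).1.2.trans (h4 _))
  have hzl : ∀ {i j}, i < j → hi (z j) ≤ lo (z i) := fun {i j} hij =>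
    (h4 _).le.trans ((hz.antitone hij).trans (hz1 i).le)
  have hy : StrictAnti fun i => md (z i) := fun i j hij =>
    (h5 _).1.2.trans_le ((hzl hij).trans (h5 _).1.1.le)
  have hd : ∀ i j, i < j → tp r k (Set.Ico (md (z j)) (md (z i))) (ext P X) =
      f * tp r k (Set.Ico (hi (z j)) (lo (z i))) (ext P X) * f := fun i j hij => by
    rw [tp_ico_mul hlt _ ((h5 (z j)).1.2.le.trans (hzl hij)) (h5 (z i)).1.1.le,
      tp_ico_mul hlt _ (h5 (z j)).1.2.le (hzl hij), (h5 (z j)).2.2, (h5 (z i)).2.1]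
  obtain ⟨g, hg, hgf⟩ := exists_subseq_eq hf.idem
    (d := fun i j => tp r k (Set.Ico (md (z j)) (md (z i))) (ext P X))
    (fun i j l hij hjl => .inr (tp_ico_mul hlt _ (hy hjl).le (hy hij).le))
    (fun i j hij => by
      rw [hd i j hij]
      exact hf.corner _)
    fun i j hij => hf.exists_mul hup X (h2 _) (h2 _) (hy hij)
  refine ⟨fun i => md (z (g i)), hy.comp_strictMono hg, fun i => ⟨h2 _, ?_⟩,
    fun i => hgf _ _ i.lt_succ_self⟩
  exact ((h5 _).1.2.trans (h4 _)).trans_le (hz.antitone (g i).zero_le)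

/-- A recurrent class has the type of an `ω*`-sequence followed by an `ω`-sequence of blocks. -/
theorem Kernel.exists_blocks (hlt : ∀ x y, r x y ↔ x < y) {k : ℕ} {x : A} {X : Set A}
    (hup : ∀ y, Near x y → ∃ z, Near x z ∧ y < z) (hX : Recurrent r P k x X)
    {f : Ty k (Option (Fin n))} (hf : Kernel r P x f) :
    ∃ (L : ℕᵒᵈ → Set A) (R : ℕ → Set A), (Blocks r L ∧ Blocks r R) ∧
      ((∀ i, tp r k (L i) (ext P X) = f) ∧ ∀ i, tp r k (R i) (ext P X) = f) ∧
      tp r k {y | Near x y} (ext P X) =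
        tp r k (⋃ i, L i) (ext P X) * tp r k (⋃ i, R i) (ext P X) := by
  obtain ⟨b, hb, hbx, hbf⟩ := hf.exists_right hlt hup hX
  obtain ⟨a, ha, hax, haf⟩ := hf.exists_left hlt hup hX
  let L : ℕᵒᵈ → Set A := fun i => Set.Ico (a (OrderDual.ofDual i + 2)) (a (OrderDual.ofDual i + 1))
  let R : ℕ → Set A := fun i => Set.Ico (b (i + 1)) (b (i + 2))
  have hL : Blocks r L := fun i j hij y hy z hz => by
    have hij : OrderDual.ofDual j < OrderDual.ofDual i := hij
    have : y < z := hy.2.trans_le ((ha.antitone (by omega)).trans hz.1)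
    exact ⟨(hlt _ _).2 this, fun h => this.not_gt ((hlt _ _).1 h)⟩
  have hR : Blocks r R := fun i j hij y hy z hz => by
    have : y < z := hy.2.trans_le ((hb.monotone (by omega)).trans hz.1)
    exact ⟨(hlt _ _).2 this, fun h => this.not_gt ((hlt _ _).1 h)⟩
  have hLf : ∀ i, tp r k (L i) (ext P X) = f := fun i => haf _
  have hRf : ∀ i, tp r k (R i) (ext P X) = f := fun i => hbf _
  have hLU : (⋃ i, L i) = {y | Near x y ∧ y < a 1} := by
    ext y
    refine Set.mem_iUnion.trans ⟨?_, fun ⟨hy, hya⟩ => ?_⟩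
    · rintro ⟨i, hi⟩
      refine ⟨(hax _).1.trans (((hax _).1.symm.trans (hax _).1).mid hi.1 hi.2.le),
        hi.2.trans_le (ha.antitone (by omega))⟩
    · classical
      have hex : ∃ i, a (i + 2) ≤ y := by
        obtain ⟨i, hi⟩ := exists_gt_of_strictAnti ha (fun i => (hax i).1) hy
        exact ⟨i, (ha.antitone (by omega)).trans hi.le⟩
      refine ⟨OrderDual.toDual (Nat.find hex), Nat.find_spec hex, ?_⟩
      change y < a (Nat.find hex + 1)
      rcases hm : Nat.find hex with _ | m
      · exact hya
      · exact not_le.1 (Nat.find_min hex (m := m) (by omega))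
  have hRU : (⋃ i, R i) = {y | Near x y ∧ b 1 ≤ y} := by
    ext y
    refine Set.mem_iUnion.trans ⟨?_, fun ⟨hy, hyb⟩ => ?_⟩
    · rintro ⟨i, hi⟩
      exact ⟨(hbx _).1.trans (((hbx _).1.symm.trans (hbx _).1).mid hi.1 hi.2.le),
        (hb.monotone (by omega)).trans hi.1⟩
    · classical
      have hex : ∃ i, y < b (i + 2) := by
        obtain ⟨i, hi⟩ := exists_lt_of_strictMono hb (fun i => (hbx i).1) hy
        exact ⟨i, hi.trans_le (hb.monotone (by omega))⟩
      refine ⟨Nat.find hex, ?_, Nat.find_spec hex⟩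
      rcases hm : Nat.find hex with _ | m
      · exact hyb
      · exact not_lt.1 (Nat.find_min hex (m := m) (by omega))
  have hab : a 1 < b 1 := (hax 1).2.trans (hbx 1).2
  have hU : {y | Near x y} = (⋃ i, L i) ∪ (Set.Ico (a 1) (b 1) ∪ ⋃ i, R i) := by
    rw [hLU, hRU]
    ext y
    constructor
    · intro hy
      rcases lt_or_ge y (a 1) with h | h
      · exact .inl ⟨hy, h⟩
      · rcases lt_or_ge y (b 1) with h' | h'
        · exact .inr (.inl ⟨h, h'⟩)
        · exact .inr (.inr ⟨hy, h'⟩)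
    · rintro (h | h | h)
      · exact h.1
      · exact (hax 1).1.trans (((hax 1).1.symm.trans (hbx 1).1).mid h.1 h.2.le)
      · exact h.1
  have hun : ∀ {B C : Set A}, (∀ y ∈ B, ∀ z ∈ C, y < z) → tp r k (B ∪ C) (ext P X) =
      tp r k B (ext P X) * tp r k C (ext P X) := fun h =>
    tp_union (fun y hy z hz => (hlt _ _).2 (h y hy z hz))
      (fun y hy z hz h' => (h y hy z hz).not_gt ((hlt _ _).1 h'))
      (Set.disjoint_left.2 fun y hy hz => lt_irrefl _ (h y hy y hz)) _ _
  have hq : tp r k (Set.Ico (a 1) (b 1)) (ext P X) =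
      f * tp r k (Set.Ico (a 0) (b 0)) (ext P X) * f := by
    have h0 : a 0 ≤ b 0 := ((hax 0).2.trans (hbx 0).2).le
    have h1 : a 1 ≤ a 0 := ha.antitone (by omega)
    have h2 : b 0 ≤ b 1 := hb.monotone (by omega)
    rw [tp_ico_mul hlt _ (h1.trans h0) h2, tp_ico_mul hlt _ h1 h0, haf 0, hbf 0]
  obtain ⟨u, v, huv⟩ := hf.exists_mul hup X (hax 1).1 (hbx 1).1 hab
  have hc := hf.corner (tp r k (Set.Ico (a 0) (b 0)) (ext P X))
  rw [← hq] at hc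
  obtain ⟨m, hm⟩ := exists_powSucc_eq hf.idem hc.1 hc.2 huv
  refine ⟨L, R, ⟨hL, hR⟩, ⟨hLf, hRf⟩, ?_⟩
  rw [hU, hun, hun, mul_tp_iUnion hR hRf hm]
  · rw [hRU]
    exact fun y hy z hz => hy.2.trans_le hz.2
  · rw [hLU, hRU]
    rintro y hy z (hz | hz)
    · exact hy.2.trans_le hz.1
    · exact hy.2.trans (hab.trans_le hz.2)

theorem Recurrent.tp_eq (hlt : ∀ x y, r x y ↔ x < y) {k : ℕ} {x : A} {X X' : Set A}
    (hup : ∀ y, Near x y → ∃ z, Near x z ∧ y < z) (hX : Recurrent r P k x X)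
    (hX' : Recurrent r P k x X') :
    tp r k {y | Near x y} (ext P X) = tp r k {y | Near x y} (ext P X') := by
  obtain ⟨f, hf⟩ := exists_kernel hlt hup hX
  obtain ⟨L, R, ⟨h1, h2⟩, ⟨h3, h4⟩, h⟩ := hf.exists_blocks hlt hup hX
  obtain ⟨L', R', ⟨h1', h2'⟩, ⟨h3', h4'⟩, h'⟩ := hf.exists_blocks hlt hup hX'
  rw [h, h', h1.tp_eq h1' fun i => (h3 i).trans (h3' i).symm,
    h2.tp_eq h2' fun i => (h4 i).trans (h4' i).symm]

theorem tp_univ_eq_of_recurrent (hlt : ∀ x y, r x y ↔ x < y) (h : NoSection r P) {k : ℕ}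
    {X X' : Set A} (hX : ∀ x ∈ X, InfClass x) (hX' : ∀ x ∈ X', InfClass x)
    (hR : ∀ x, InfClass x → Recurrent r P k x X) (hR' : ∀ x, InfClass x → Recurrent r P k x X') :
    tp r k Set.univ (ext P X) = tp r k Set.univ (ext P X') := by
  let I := {c : Set A // ∃ x, c = {y | Near x y}}
  have hcl : ∀ {x y : A}, Near x y → {z | Near x z} = {z | Near y z} := fun hxy =>
    Set.ext fun z => ⟨hxy.symm.trans, hxy.trans⟩
  have hun : (Set.univ : Set A) = ⋃ c : I, c.1 :=
    Set.ext fun x => iff_of_true trivial (Set.mem_iUnion.2 ⟨⟨_, x, rfl⟩, Near.refl x⟩)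
  rw [hun]
  refine tp_eq_of_convex (.inl hlt) ?_ ?_ ?_
  · rintro ⟨_, x, rfl⟩ ⟨_, y, rfl⟩ z hx hy
    exact Subtype.ext ((hcl hx).trans (hcl hy).symm)
  · rintro ⟨_, x, rfl⟩
    exact ⟨fun y hy z hz w hw =>
      Near.trans hy (((Near.symm hy).trans hz).mid hw.1 hw.2)⟩
  · rintro ⟨_, x, rfl⟩
    by_cases hx : InfClass x
    · refine Recurrent.tp_eq hlt (fun y hy => ?_) (hR x hx) (hR' x hx)
      obtain ⟨z, -, hz, hyz⟩ := h.exists_gt (.inl hlt) (E := Set.univ) (Dfn.const True)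
        (Set.mem_univ x) hx hy
      exact ⟨z, hz, hyz⟩
    · have hn : ∀ y, Near x y → ¬ InfClass y := fun y hy hyi => hx (hyi.of_near hy.symm)
      exact tp_congr k (ext_congr fun y hy =>
        iff_of_false (fun h' => hn y hy (hX y h')) fun h' => hn y hy (hX' y h'))

theorem exists_undefinable [Infinite A] (hlt : ∀ x y, r x y ↔ x < y)
    (hscat : IsEmpty (ℚ ↪o A)) : ∃ Q, ¬ Definable r P Q ∧
      TuringRed (TheoryCodes r (Fin.snoc P Q)) (TheoryCodes r P) := by
  by_cases h : NoSection r P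
  · obtain ⟨x₀, hx₀⟩ := exists_infinite_class hscat
    refine exists_undefinable_of_dense (.inl hlt) (x₀ := x₀) hx₀ fun K =>
      ⟨Ty K (Option (Fin n)) × Ty K (Option (Fin n)) × Bool, inferInstance,
        fun j => Recurs r P j.1 j.2.1 j.2.2, fun j => Dfn.recurs (.inl hlt) _ _ _,
        fun j x hx => h.denseAt_recurs (.inl hlt) _ _ _ hx, fun X X' hX hX' hR hR' => ?_⟩
    exact tp_univ_eq_of_recurrent hlt h hX hX'
      (fun x hx s t d y hy => hR (s, t, d) y (hx.of_near hy))
      fun x hx s t d y hy => hR' (s, t, d) y (hx.of_near hy)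
  · simp only [NoSection, not_forall, not_not] at h
    obtain ⟨D, hD, hu, d, hd, hinf⟩ := h
    exact exists_undefinable_of_section (.inl hlt) hD hu hd hinf

end

end MSO
end Paper

open Paper

/-- Let `M = (A, <, P₁, …, Pₙ)` where `(A, <)` is an infinite scattered linear
order (there is no order embedding of `ℚ` into `A`).  Then there is a set
`Q ⊆ A`, not MSO-definable in `M`, such that the MSO theory of the expansion
`M' = (A, <, P₁, …, Pₙ, Q)` is recursive in the MSO theory of `M`. -/
theorem stmt_18 {A : Type} [LinearOrder A] [Infinite A] {n : ℕ}
    (P : Fin n → Set A) (hscat : IsEmpty (ℚ ↪o A)) :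
    ∃ Q : Set A,
      ¬ MSO.Definable (fun x y : A => x < y) P Q ∧
      TuringRed (MSO.TheoryCodes (fun x y : A => x < y) (Fin.snoc P Q))
        (MSO.TheoryCodes (fun x y : A => x < y) P) := by
  exact MSO.exists_undefinable (fun _ _ => Iff.rfl) hscat
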